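/- Let n ≥ 1, δ > (n-1)/2, p ∈ (0,∞) with 2n/(n+1+2δ) ≤ p, and let ω ∈ A_{p(n+1+2δ)/(2n)}(ℝ^n). Then there exists a constant C > 0 such that for every Schwartz function f on ℝ^n and every ε > 0, ‖M(B^δ_{1/ε}(f), Φ)‖_{WL^p_ω} ≤ C ‖M(f,Φ)‖_{L^p_ω}; that is, the Bochner–Riesz means of order δ is bounded from the weighted Hardy space H^p_ω(ℝ^n) to the weighted weak Hardy space WH^p_ω(ℝ^n), uniformly in ε. -/

import Mathlib

noncomputable section

open MeasureTheory Real Set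
open scoped ENNReal NNReal

abbrev En (n : ℕ) : Type := EuclideanSpace ℝ (Fin n)

/-- The Bochner–Riesz kernel of order `δ`: the Fourier transform of `ξ ↦ ((1-|ξ|²)⁺)^δ`. -/
def brKernel (n : ℕ) (δ : ℝ) (x : En n) : ℂ :=
  ∫ ξ : En n, (((max (1 - ‖ξ‖ ^ 2) 0) ^ δ : ℝ) : ℂ) *
    Complex.exp (-(2 * Real.pi) * Complex.I * ((∑ i, x i * ξ i : ℝ) : ℂ))

/-- The dilated kernel `φ_ε(x) = ε^{-n} φ(x/ε)`. -/
def brKernelDil (n : ℕ) (δ ε : ℝ) (x : En n) : ℂ :=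
  (ε ^ n)⁻¹ • brKernel n δ (ε⁻¹ • x)

/-- The Bochner–Riesz means `B^δ_{1/ε} f = f * φ_ε`. -/
def brMeans (n : ℕ) (δ ε : ℝ) (f : En n → ℂ) (x : En n) : ℂ :=
  ∫ y, f y * brKernelDil n δ ε (x - y)

/-- The maximal Bochner–Riesz means `B^δ_* f`. -/
def brMax (n : ℕ) (δ : ℝ) (f : En n → ℂ) (x : En n) : ℝ≥0∞ :=
  ⨆ (ε : ℝ) (_ : 0 < ε), (‖brMeans n δ ε f x‖₊ : ℝ≥0∞)

/-- The radial maximal function `M(f,Φ)(x) = sup_{t>0} |(Φ_t * f)(x)|`. -/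
def radMax (n : ℕ) (Φ : En n → ℂ) (f : En n → ℂ) (x : En n) : ℝ≥0∞ :=
  ⨆ (t : ℝ) (_ : 0 < t), (‖∫ y, (t ^ n)⁻¹ • Φ (t⁻¹ • (x - y)) * f y‖₊ : ℝ≥0∞)

/-- Average of `ω` over the ball `B(x,r)`. -/
def ballAvg (n : ℕ) (ω : En n → ℝ≥0∞) (x : En n) (r : ℝ) : ℝ≥0∞ :=
  (volume (Metric.ball x r))⁻¹ * ∫⁻ y in Metric.ball x r, ω y

/-- The Muckenhoupt class `A_1(ℝ^n)`. -/
def IsA1 (n : ℕ) (ω : En n → ℝ≥0∞) : Prop :=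
  ∃ C : ℝ≥0∞, C < ⊤ ∧ ∀ (x : En n) (r : ℝ), 0 < r →
    ballAvg n ω x r * essSup (fun y => (ω y)⁻¹) (volume.restrict (Metric.ball x r)) ≤ C

/-- The Muckenhoupt class `A_p(ℝ^n)` for `p ∈ (1,∞)`. -/
def IsApGT1 (n : ℕ) (p : ℝ) (ω : En n → ℝ≥0∞) : Prop :=
  ∃ C : ℝ≥0∞, C < ⊤ ∧ ∀ (x : En n) (r : ℝ), 0 < r →
    ballAvg n ω x r * (ballAvg n (fun y => ω y ^ (1/(1-p))) x r) ^ (p - 1) ≤ C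

/-- The Muckenhoupt class `A_p(ℝ^n)` for `p ∈ [1,∞)`. -/
def IsAp (n : ℕ) (p : ℝ) (ω : En n → ℝ≥0∞) : Prop :=
  if p = 1 then IsA1 n ω else IsApGT1 n p ω

/-- The weighted Lebesgue quasinorm `‖g‖_{L^p_ω}` (of a nonnegative function). -/
def wLp (n : ℕ) (ω : En n → ℝ≥0∞) (p : ℝ) (g : En n → ℝ≥0∞) : ℝ≥0∞ :=
  (∫⁻ x, g x ^ p * ω x) ^ (1/p)

/-- The weighted weak Lebesgue quasinorm `‖g‖_{WL^p_ω}`. -/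
def wWLp (n : ℕ) (ω : En n → ℝ≥0∞) (p : ℝ) (g : En n → ℝ≥0∞) : ℝ≥0∞ :=
  ⨆ (α : ℝ≥0) (_ : 0 < α),
    (α : ℝ≥0∞) * (∫⁻ x in {x | (α : ℝ≥0∞) < g x}, ω x) ^ (1/p)

section
open MeasureTheory Real Set
open scoped ENNReal NNReal

/-- powers are dominated by exponentials -/
lemma rpow_le_mul_exp (μ c : ℝ) (hμ : 0 < μ) (hc : 0 < c) :
    ∃ K : ℝ, 0 < K ∧ ∀ x : ℝ, 0 < x → x ^ μ ≤ K * Real.exp (c * x) := by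
  refine ⟨Real.exp (-(μ * Real.log (c / μ))), Real.exp_pos _, fun x hx => ?_⟩
  rw [Real.rpow_def_of_pos hx, ← Real.exp_add]
  apply Real.exp_le_exp.2
  have h1 := Real.log_le_sub_one_of_pos (show 0 < c * x / μ by positivity)
  have h2 : Real.log (c * x / μ) = Real.log (c / μ) + Real.log x := by
    rw [← Real.log_mul (by positivity) (by positivity)]; congr 1; ring
  rw [h2] at h1
  have h3 : μ * (Real.log (c / μ) + Real.log x) ≤ μ * (c * x / μ - 1) :=
    mul_le_mul_of_nonneg_left h1 hμ.le
  have h4 : μ * (c * x / μ - 1) = c * x - μ := by field_simp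
  nlinarith

/-- integrand for the contour shift -/
def ctF (μ l : ℝ) (z : ℂ) : ℂ := (1 - z ^ 2) ^ (μ : ℂ) * Complex.exp (-(l : ℂ) * Complex.I * z)

lemma ctF_re (z : ℂ) : (1 - z ^ 2).re = 1 - z.re ^ 2 + z.im ^ 2 := by
  simp [pow_two]; ring

lemma ctF_im (z : ℂ) : (1 - z ^ 2).im = - (2 * z.re * z.im) := by
  simp [pow_two]; ring

lemma ctF_cont (μ l : ℝ) (hμ : 0 < μ) (R : ℝ) :
    ContinuousOn (ctF μ l) (uIcc (-1) 1 ×ℂ uIcc (-R) 0) := by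
  apply ContinuousOn.mul _ (by fun_prop)
  intro z hz
  have hre : z.re ∈ Icc (-1:ℝ) 1 := by
    have := hz.1; simpa using this
  by_cases h0 : 1 - z ^ 2 = 0
  · have : ContinuousAt (fun w : ℂ => w ^ (μ : ℂ)) (1 - z^2) := by
      rw [h0]
      exact Complex.continuousAt_cpow_const_of_re_pos (by simp) (by simpa using hμ)
    exact (ContinuousAt.comp (f := fun z : ℂ => 1 - z^2) this (by fun_prop)).continuousWithinAt
  · have hs : 1 - z ^ 2 ∈ Complex.slitPlane := by
      rw [Complex.mem_slitPlane_iff_not_le_zero]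
      intro hle
      rw [Complex.le_def] at hle
      obtain ⟨h1, h2⟩ := hle
      rw [ctF_re] at h1
      rw [ctF_im] at h2
      simp at h1 h2
      have : z.im ^ 2 = 0 := by nlinarith [hre.1, hre.2, sq_nonneg z.im]
      have him : z.im = 0 := by simpa using this
      apply h0
      apply Complex.ext
      · rw [ctF_re]; simp; nlinarith [hre.1, hre.2]
      · rw [ctF_im, him]; simp
    exact (ContinuousAt.comp (f := fun z : ℂ => 1 - z^2) (g := fun w : ℂ => w ^ (μ : ℂ))
      (continuousAt_cpow_const hs) (by fun_prop)).continuousWithinAt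

lemma ctF_diff (μ l : ℝ) (R : ℝ) :
    DifferentiableOn ℂ (ctF μ l) (Ioo (-1) 1 ×ℂ Ioo (-R) 0) := by
  intro z hz
  have hre : z.re ∈ Ioo (-1:ℝ) 1 := hz.1
  have hs : 1 - z ^ 2 ∈ Complex.slitPlane := by
    left; rw [ctF_re]; nlinarith [hre.1, hre.2, sq_nonneg z.im]
  apply DifferentiableAt.differentiableWithinAt
  apply DifferentiableAt.mul _ (by fun_prop)
  exact DifferentiableAt.cpow (by fun_prop) (by fun_prop) hs

lemma ctF_norm_le (μ l : ℝ) (hμ : 0 < μ) (z : ℂ) :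
    ‖ctF μ l z‖ ≤ ‖1 - z ^ 2‖ ^ μ * Real.exp (l * z.im) := by
  unfold ctF
  rw [norm_mul, Complex.norm_exp]
  have h1 : ‖(1 - z ^ 2) ^ (μ : ℂ)‖ = ‖1 - z ^ 2‖ ^ μ :=
    Complex.norm_cpow_real _ _
  rw [h1]
  gcongr
  simp

lemma ctF_side (μ : ℝ) (hμ : 0 < μ) : ∃ C : ℝ, 0 < C ∧ ∀ l : ℝ, 1 ≤ l → ∀ R : ℝ, 0 < R →
    ∀ e : ℂ, e ^ 2 = 1 → e.im = 0 →
    ‖∫ y in (-R)..0, ctF μ l (e + y * Complex.I)‖ ≤ C * l ^ (-(μ + 1)) := by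
  obtain ⟨K, hK, hKb⟩ := rpow_le_mul_exp μ (1/2) hμ (by norm_num)
  refine ⟨K * Real.exp 1 * (2 ^ (μ+1) * Real.Gamma (μ+1)), ?_, ?_⟩
  · have := Real.Gamma_pos_of_pos (show 0 < μ + 1 by linarith)
    positivity
  intro l hl R hR e he hei
  have hen : ‖e‖ = 1 := by
    have : ‖e‖ ^ 2 = 1 := by rw [← norm_pow, he]; simp
    nlinarith [norm_nonneg e]
  have hneg := intervalIntegral.integral_comp_neg (a := 0) (b := R) (f := fun y : ℝ => ctF μ l (e + y * Complex.I))
  rw [neg_zero] at hneg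
  rw [← hneg]
  have hInteg : IntegrableOn (fun v : ℝ => v ^ μ * Real.exp (-(l/2 * v))) (Ioi 0) := by
    have := integrableOn_rpow_mul_exp_neg_mul_rpow (p := 1) (s := μ) (b := l/2) (by linarith) (by norm_num) (by linarith)
    simpa using this
  have hval : ∫ v in Ioi (0:ℝ), v ^ μ * Real.exp (-(l/2 * v)) = (1/(l/2)) ^ (μ+1) * Real.Gamma (μ+1) := by
    have := Real.integral_rpow_mul_exp_neg_mul_Ioi (a := μ+1) (r := l/2) (by linarith) (by linarith)
    simpa using this
  have hpt : ∀ v ∈ Ioc (0:ℝ) R, ‖ctF μ l (e + (-v : ℝ) * Complex.I)‖ ≤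
      K * Real.exp 1 * (v ^ μ * Real.exp (-(l/2 * v))) := by
    intro v hv
    have hv0 : 0 < v := hv.1
    refine (ctF_norm_le μ l hμ _).trans ?_
    have h1 : (1 - (e + (-v : ℝ) * Complex.I) ^ 2) = v * (v + 2 * e * Complex.I) := by
      have : (e + (-v : ℝ) * Complex.I) ^ 2 = e ^ 2 - 2 * e * v * Complex.I + v ^ 2 * Complex.I ^ 2 := by
        push_cast; ring
      rw [this, he, Complex.I_sq]; ring
    have h2 : ‖(1 - (e + (-v : ℝ) * Complex.I) ^ 2)‖ ≤ v * (v + 2) := by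
      rw [h1, norm_mul]
      have : ‖(v : ℂ) + 2 * e * Complex.I‖ ≤ v + 2 := by
        refine (norm_add_le _ _).trans ?_
        simp [hen, abs_of_pos hv0]
      have h3 : ‖(v : ℂ)‖ = v := by simp [abs_of_pos hv0]
      rw [h3]; gcongr
    have h3 : ‖(1 - (e + (-v : ℝ) * Complex.I) ^ 2)‖ ^ μ ≤ v ^ μ * (K * Real.exp (1/2 * (v+2))) := by
      calc _ ≤ (v * (v+2)) ^ μ := by gcongr
        _ = v ^ μ * (v+2) ^ μ := Real.mul_rpow hv0.le (by linarith)
        _ ≤ _ := by gcongr; exact hKb _ (by linarith)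
    have him : (e + (-v : ℝ) * Complex.I).im = -v := by simp [hei]
    rw [him]
    calc _ ≤ v ^ μ * (K * Real.exp (1/2 * (v+2))) * Real.exp (l * -v) := by gcongr
      _ = K * v ^ μ * (Real.exp (1/2 * (v+2) + l * -v)) := by rw [Real.exp_add]; ring
      _ ≤ K * v ^ μ * (Real.exp (1 + -(l/2*v))) := by
          exact mul_le_mul_of_nonneg_left (Real.exp_le_exp.2 (by nlinarith)) (by positivity)
      _ = _ := by rw [Real.exp_add]; ring
  rw [intervalIntegral.integral_of_le hR.le]
  refine (norm_integral_le_of_norm_le (g := fun v => K * Real.exp 1 * (v ^ μ * Real.exp (-(l/2 * v)))) ?_ ?_).trans ?_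
  · exact (hInteg.mono_set Ioc_subset_Ioi_self).const_mul _
  · exact (ae_restrict_iff' measurableSet_Ioc).2 (Filter.Eventually.of_forall hpt)
  · rw [integral_const_mul, mul_assoc (K * Real.exp 1)]
    gcongr
    calc _ ≤ ∫ v in Ioi (0:ℝ), v ^ μ * Real.exp (-(l/2 * v)) := by
          apply setIntegral_mono_set hInteg
          · refine (ae_restrict_iff' measurableSet_Ioi).2 (Filter.Eventually.of_forall fun v hv => ?_)
            have : (0:ℝ) < v := hv
            simp only [Pi.zero_apply]
            positivity
          · exact Ioc_subset_Ioi_self.eventuallyLE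
      _ = _ := by
          rw [hval]
          have : (1/(l/2)) ^ (μ+1) = 2 ^ (μ+1) * l ^ (-(μ+1)) := by
            rw [Real.rpow_neg (by linarith), ← Real.inv_rpow (by linarith), ← Real.mul_rpow (by norm_num) (by positivity)]
            congr 1; field_simp
          rw [this]; ring

lemma ctF_bottom (μ l : ℝ) (hμ : 0 < μ) (hl : 1 ≤ l) :
    Filter.Tendsto (fun R : ℝ => ∫ x in (-1:ℝ)..1, ctF μ l (x + ((-R : ℝ) : ℂ) * Complex.I)) Filter.atTop (nhds 0) := by
  have h := tendsto_rpow_mul_exp_neg_mul_atTop_nhds_zero (2 * μ) 1 one_pos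
  have h' := (h.comp (Filter.tendsto_atTop_add_const_right _ (2:ℝ) Filter.tendsto_id)).const_mul (Real.exp 2 * 2)
  rw [mul_zero] at h'
  refine squeeze_zero_norm' ?_ h'
  filter_upwards [Filter.eventually_ge_atTop (0:ℝ)] with R hR
  have hb : ∀ x ∈ Set.uIoc (-1:ℝ) 1, ‖ctF μ l (x + ((-R : ℝ) : ℂ) * Complex.I)‖ ≤ (R+2)^(2*μ) * Real.exp (-R) := by
    intro x hx
    rw [uIoc_of_le (by norm_num)] at hx
    refine (ctF_norm_le μ l hμ _).trans ?_
    have h1 : ‖(1 - ((x:ℂ) + ((-R : ℝ) : ℂ) * Complex.I) ^ 2)‖ ≤ (R+2)^2 := by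
      refine (norm_sub_le _ _).trans ?_
      rw [norm_pow]
      have : ‖(x:ℂ) + ((-R : ℝ) : ℂ) * Complex.I‖ ≤ 1 + R := by
        refine (norm_add_le _ _).trans ?_
        simp only [Complex.norm_real, norm_mul, Complex.norm_I, mul_one, Real.norm_eq_abs, abs_neg, abs_of_nonneg hR]
        have : |x| ≤ 1 := abs_le.2 ⟨hx.1.le, hx.2⟩
        linarith
      have h0 := norm_nonneg ((x:ℂ) + ((-R : ℝ) : ℂ) * Complex.I)
      simp only [norm_one]
      nlinarith
    have h2 : ((x:ℂ) + ((-R : ℝ) : ℂ) * Complex.I).im = -R := by simp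
    rw [h2]
    have h3 : ‖(1 - ((x:ℂ) + ((-R : ℝ) : ℂ) * Complex.I) ^ 2)‖ ^ μ ≤ (R+2)^(2*μ) := by
      rw [Real.rpow_mul (by linarith)]
      gcongr
      simpa using h1
    gcongr
    nlinarith
  refine (intervalIntegral.norm_integral_le_of_norm_le_const hb).trans (le_of_eq ?_)
  have e1 : Real.exp (-R) = Real.exp 2 * Real.exp (-1 * (R+2)) := by rw [← Real.exp_add]; congr 1; ring
  rw [e1]
  have : |(1:ℝ) - -1| = 2 := by norm_num
  rw [this]
  simp only [Function.comp, id]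
  ring

/-- one dimensional oscillatory integral decay -/
lemma oneD_decay (μ : ℝ) (hμ : 0 < μ) : ∃ C : ℝ, 0 < C ∧ ∀ l : ℝ, 1 ≤ l →
    ‖∫ u in (-1:ℝ)..1, (((1 - u^2) ^ μ : ℝ) : ℂ) * Complex.exp (-(l : ℂ) * Complex.I * u)‖ ≤ C * l ^ (-(μ+1)) := by
  obtain ⟨C, hC, h⟩ := ctF_side μ hμ
  refine ⟨2 * C, by positivity, fun l hl => ?_⟩
  have e1 : ∫ u in (-1:ℝ)..1, (((1 - u^2) ^ μ : ℝ) : ℂ) * Complex.exp (-(l : ℂ) * Complex.I * u) =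
      ∫ u in (-1:ℝ)..1, ctF μ l (u + ((0:ℝ):ℂ) * Complex.I) := by
    apply intervalIntegral.integral_congr
    intro u hu
    rw [uIcc_of_le (by norm_num)] at hu
    simp only [ctF, Complex.ofReal_zero, zero_mul, add_zero]
    rw [Complex.ofReal_cpow (by nlinarith [hu.1, hu.2])]
    push_cast; rfl
  rw [e1]
  have hlim := (ctF_bottom μ l hμ hl).norm
  rw [norm_zero] at hlim
  have hlim2 := hlim.add_const (2 * C * l ^ (-(μ+1)))
  rw [zero_add] at hlim2
  refine ge_of_tendsto hlim2 ?_
  filter_upwards [Filter.eventually_gt_atTop (0:ℝ)] with R hR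
  have key := Complex.integral_boundary_rect_eq_zero_of_continuousOn_of_differentiableOn (ctF μ l)
    (⟨-1, -R⟩ : ℂ) (⟨1, 0⟩ : ℂ) (ctF_cont μ l hμ R) (by
      simp only [min_eq_left (show (-1:ℝ) ≤ 1 by norm_num), max_eq_right (show (-1:ℝ) ≤ 1 by norm_num),
        min_eq_left (show -R ≤ 0 by linarith), max_eq_right (show -R ≤ 0 by linarith)]
      exact ctF_diff μ l R)
  simp only at key
  have s1 := h l hl R hR ((1:ℝ):ℂ) (by simp) (by simp)
  have s2 := h l hl R hR ((-1:ℝ):ℂ) (by simp) (by simp)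
  have e2 : ∫ u in (-1:ℝ)..1, ctF μ l (u + ((0:ℝ):ℂ) * Complex.I) =
     (∫ x in (-1:ℝ)..1, ctF μ l (x + ((-R : ℝ) : ℂ) * Complex.I)) +
      (Complex.I • (∫ y in (-R)..0, ctF μ l (((1:ℝ):ℂ) + y * Complex.I)) -
      Complex.I • (∫ y in (-R)..0, ctF μ l (((-1:ℝ):ℂ) + y * Complex.I))) := by
    linear_combination -key
  rw [e2]
  refine (norm_add_le _ _).trans ?_
  gcongr
  refine (norm_sub_le _ _).trans ?_
  rw [norm_smul, norm_smul]
  simp only [Complex.norm_I, one_mul]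
  linarith
end

section
open MeasureTheory Real Set
open scoped ENNReal NNReal

/-- The Bochner–Riesz multiplier. -/
def brMul (n : ℕ) (δ : ℝ) (ξ : En n) : ℝ := (max (1 - ‖ξ‖ ^ 2) 0) ^ δ

lemma brMul_cont (n : ℕ) (δ : ℝ) (hδ : 0 < δ) : Continuous (brMul n δ) := by
  unfold brMul
  exact Continuous.rpow_const (by fun_prop) (fun _ => Or.inr hδ.le)

lemma brMul_zero (n : ℕ) (δ : ℝ) (hδ : 0 < δ) (ξ : En n) (h : 1 ≤ ‖ξ‖) : brMul n δ ξ = 0 := by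
  unfold brMul
  rw [max_eq_right (by nlinarith), Real.zero_rpow hδ.ne']

lemma brMul_compact (n : ℕ) (δ : ℝ) (hδ : 0 < δ) : HasCompactSupport (brMul n δ) := by
  apply HasCompactSupport.intro (isCompact_closedBall (0 : En n) 1)
  intro ξ hξ
  apply brMul_zero n δ hδ
  simp at hξ
  exact hξ.le

lemma brMul_int (n : ℕ) (δ : ℝ) (hδ : 0 < δ) : Integrable (brMul n δ) :=
  (brMul_cont n δ hδ).integrable_of_hasCompactSupport (brMul_compact n δ hδ)

lemma inner_eq_sum {n : ℕ} (x ξ : En n) : inner ℝ x ξ = ∑ i, x i * ξ i := by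
  simp [PiLp.inner_apply, mul_comm]

lemma brKernel_eq_inner (n : ℕ) (δ : ℝ) (x : En n) : brKernel n δ x =
    ∫ ξ : En n, (brMul n δ ξ : ℂ) * Complex.exp (-(2 * Real.pi) * Complex.I * ((inner ℝ x ξ : ℝ) : ℂ)) := by
  unfold brKernel brMul
  simp only [inner_eq_sum]

lemma brKernel_rot (n : ℕ) (δ : ℝ) (x y : En n) (h : ‖x‖ = ‖y‖) : brKernel n δ x = brKernel n δ y := by
  let T := (Submodule.span ℝ {x - y})ᗮ.reflection
  have hT : T x = y := Submodule.reflection_sub h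
  rw [brKernel_eq_inner, brKernel_eq_inner]
  have hmp := T.measurePreserving
  symm
  rw [← hmp.integral_comp T.toHomeomorph.measurableEmbedding]
  have : ∀ ξ : En n, inner ℝ y (T ξ) = inner ℝ x ξ := by
    intro ξ; rw [← hT]; exact T.inner_map_map x ξ
  simp only [this, brMul, LinearIsometryEquiv.norm_map]

/-- the slice integral -/
def brJ (m : ℕ) (δ : ℝ) (a : ℝ) : ℝ := ∫ η : Fin m → ℝ, (max (a - ∑ i, η i ^ 2) 0) ^ δ

lemma brJ_nonpos (m : ℕ) (δ : ℝ) (hδ : 0 < δ) (a : ℝ) (ha : a ≤ 0) : brJ m δ a = 0 := by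
  unfold brJ
  have : ∀ η : Fin m → ℝ, (max (a - ∑ i, η i ^ 2) 0) ^ δ = 0 := by
    intro η
    have : 0 ≤ ∑ i, η i ^ 2 := Finset.sum_nonneg fun i _ => sq_nonneg _
    rw [max_eq_right (by linarith), Real.zero_rpow hδ.ne']
  simp [this]

lemma brJ_pos (m : ℕ) (δ : ℝ) (a : ℝ) (ha : 0 < a) :
    brJ m δ a = a ^ (δ + m / 2) * brJ m δ 1 := by
  unfold brJ
  have h := Measure.integral_comp_smul (volume : Measure (Fin m → ℝ)) (fun η => (max (a - ∑ i, η i ^ 2) 0) ^ δ) (Real.sqrt a)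
  simp only [Module.finrank_fintype_fun_eq_card, Fintype.card_fin, smul_eq_mul] at h
  have hs : 0 < Real.sqrt a := Real.sqrt_pos.2 ha
  rw [abs_of_pos (by positivity)] at h
  have h2 : ∀ η : Fin m → ℝ, (max (a - ∑ i, (Real.sqrt a • η) i ^ 2) 0) ^ δ = a ^ δ * (max (1 - ∑ i, η i ^ 2) 0) ^ δ := by
    intro η
    rw [← Real.mul_rpow ha.le (le_max_right _ _), mul_max_of_nonneg _ _ ha.le]
    congr 2
    · simp only [Pi.smul_apply, smul_eq_mul, mul_pow, Real.sq_sqrt ha.le, ← Finset.mul_sum]; ring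
    · simp
  simp only [h2, integral_const_mul] at h
  have h3 : (Real.sqrt a) ^ m = a ^ ((m:ℝ)/2) := by
    rw [Real.sqrt_eq_rpow, ← Real.rpow_natCast, ← Real.rpow_mul ha.le]; congr 1; ring
  rw [Real.rpow_add ha, ← h3]
  have : Real.sqrt a ^ m ≠ 0 := by positivity
  field_simp at h ⊢
  linarith

lemma brKernel_slice (m : ℕ) (δ : ℝ) (hδ : 0 < δ) (l : ℝ) :
    brKernel (m+1) δ (l • EuclideanSpace.single 0 1) =
      (brJ m δ 1 : ℂ) * ∫ u in (-1:ℝ)..1, (((1 - u^2) ^ (δ + m/2) : ℝ) : ℂ) * Complex.exp (-((2 * Real.pi * l : ℝ) : ℂ) * Complex.I * u) := by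
  have e1 := (EuclideanSpace.volume_preserving_symm_measurableEquiv_toLp (Fin (m+1))).symm
  have e2 := (volume_preserving_piFinSuccAbove (fun _ : Fin (m+1) => ℝ) 0).symm
  have e := e1.comp e2
  set G : ℝ × (Fin m → ℝ) → En (m+1) := fun x => (MeasurableEquiv.toLp 2 (Fin (m+1) → ℝ)) ((MeasurableEquiv.piFinSuccAbove (fun _ => ℝ) 0).symm x) with hG
  have hGm : MeasurePreserving G volume volume := e
  have hGe : MeasurableEmbedding G := by
    exact (MeasurableEquiv.measurableEmbedding _).comp (MeasurableEquiv.measurableEmbedding _)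
  have hG0 : ∀ x, G x 0 = x.1 := by
    intro x; simp [hG, MeasurableEquiv.piFinSuccAbove]
  have hGn : ∀ x, ‖G x‖ ^ 2 = x.1 ^ 2 + ∑ i, x.2 i ^ 2 := by
    intro x; rw [EuclideanSpace.norm_sq_eq, Fin.sum_univ_succ]
    simp [hG, MeasurableEquiv.piFinSuccAbove]
  have hinner : ∀ ξ : En (m+1), inner ℝ (l • EuclideanSpace.single (0: Fin (m+1)) (1:ℝ)) ξ = l * ξ 0 := by
    intro ξ
    rw [inner_smul_left, EuclideanSpace.inner_single_left]; simp
  have hInteg : Integrable (fun ξ : En (m+1) => (brMul (m+1) δ ξ : ℂ) * Complex.exp (-(2 * Real.pi) * Complex.I * ((inner ℝ (l • EuclideanSpace.single (0: Fin (m+1)) (1:ℝ)) ξ : ℝ) : ℂ))) := by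
    apply Integrable.mul_bdd (c := 1)
    · exact (brMul_int _ δ hδ).ofReal
    · exact Continuous.aestronglyMeasurable (by fun_prop)
    · refine Filter.Eventually.of_forall fun ξ => ?_
      rw [Complex.norm_exp]; simp
  rw [brKernel_eq_inner]
  rw [← hGm.integral_comp hGe]
  have hInteg2 := hGm.integrable_comp_of_integrable hInteg
  change ∫ x : ℝ × (Fin m → ℝ), _ ∂(volume.prod volume) = _
  refine (integral_prod _ hInteg2).trans ?_
  simp only [Function.comp]
  have hin : ∀ u : ℝ, (∫ η : Fin m → ℝ, (brMul (m+1) δ (G (u,η)) : ℂ) * Complex.exp (-(2 * Real.pi) * Complex.I * ((inner ℝ (l • EuclideanSpace.single (0: Fin (m+1)) (1:ℝ)) (G (u,η)) : ℝ) : ℂ)))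
      = (brJ m δ (1 - u^2) : ℂ) * Complex.exp (-((2 * Real.pi * l : ℝ) : ℂ) * Complex.I * u) := by
    intro u
    simp only [hinner, hG0]
    rw [integral_mul_const]
    congr 1
    · unfold brJ brMul
      rw [← integral_complex_ofReal]
      simp only [hGn]
      congr 1; ext η; rw [sub_add_eq_sub_sub]
    · congr 1; push_cast; ring
  simp only [hin]
  have hsupp : ∀ u : ℝ, u ∉ Ioc (-1:ℝ) 1 → (brJ m δ (1 - u^2) : ℂ) * Complex.exp (-((2 * Real.pi * l : ℝ) : ℂ) * Complex.I * u) = 0 := by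
    intro u hu
    rw [brJ_nonpos m δ hδ]
    · simp
    · by_contra hc
      push Not at hc
      apply hu
      have : |u| < 1 := by rw [← sq_lt_one_iff_abs_lt_one]; linarith
      rw [abs_lt] at this
      exact ⟨this.1, this.2.le⟩
  rw [← setIntegral_eq_integral_of_forall_compl_eq_zero hsupp, ← intervalIntegral.integral_of_le (by norm_num),
    ← intervalIntegral.integral_const_mul]
  apply intervalIntegral.integral_congr
  intro u hu
  rw [uIcc_of_le (by norm_num)] at hu
  simp only
  rcases eq_or_lt_of_le (show 0 ≤ 1 - u^2 by nlinarith [hu.1, hu.2]) with h0 | h0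
  · rw [← h0, brJ_nonpos m δ hδ 0 le_rfl, Real.zero_rpow (by positivity)]; simp
  · rw [brJ_pos m δ _ h0]; push_cast; ring

/-- decay of the Bochner–Riesz kernel -/
theorem brKernel_decay (n : ℕ) (hn : 1 ≤ n) (δ : ℝ) (hδ : 0 < δ) :
    ∃ C : ℝ, 0 < C ∧ ∀ x : En n, ‖brKernel n δ x‖ ≤ C * (1 + ‖x‖) ^ (-(((n:ℝ)+1)/2 + δ)) := by
  obtain ⟨m, rfl⟩ : ∃ m, n = m + 1 := ⟨n - 1, by omega⟩
  set s : ℝ := (((m+1 : ℕ):ℝ)+1)/2 + δ with hs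
  have hs0 : 0 < s := by positivity
  obtain ⟨C, hC, h⟩ := oneD_decay (δ + m/2) (by positivity)
  set K : ℝ := ∫ ξ : En (m+1), brMul (m+1) δ ξ with hK
  have hK0 : 0 ≤ K := integral_nonneg fun ξ => by unfold brMul; positivity
  refine ⟨(K + |brJ m δ 1| * C + 1) * 2 ^ s, by positivity, fun x => ?_⟩
  rcases le_or_gt ‖x‖ 1 with hx | hx
  · have h1 : ‖brKernel (m+1) δ x‖ ≤ K := by
      rw [brKernel_eq_inner]
      refine norm_integral_le_of_norm_le (brMul_int _ δ hδ) (Filter.Eventually.of_forall fun ξ => ?_)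
      rw [norm_mul, Complex.norm_exp]
      have : 0 ≤ brMul (m+1) δ ξ := by unfold brMul; positivity
      simp [abs_of_nonneg this]
    have h2 : 1 ≤ 2 ^ s * (1 + ‖x‖) ^ (-s) := by
      rw [Real.rpow_neg (by positivity), ← div_eq_mul_inv, one_le_div (by positivity)]
      gcongr; linarith
    calc _ ≤ K := h1
      _ ≤ (K + |brJ m δ 1| * C + 1) * 1 := by
          have : 0 ≤ |brJ m δ 1| * C := by positivity
          linarith
      _ ≤ (K + |brJ m δ 1| * C + 1) * (2 ^ s * (1 + ‖x‖) ^ (-s)) := by gcongr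
      _ = _ := by ring
  · have hr : brKernel (m+1) δ x = brKernel (m+1) δ (‖x‖ • EuclideanSpace.single 0 1) := by
      apply brKernel_rot; simp [norm_smul]
    rw [hr, brKernel_slice m δ hδ, norm_mul]
    have hpi : 1 ≤ 2 * Real.pi := by linarith [Real.pi_gt_three]
    have h1 := h (2 * Real.pi * ‖x‖) (by nlinarith)
    have es : -(δ + m/2 + 1) = -s := by rw [hs]; push_cast; ring
    rw [es] at h1
    have h2 : (2 * Real.pi * ‖x‖) ^ (-s) ≤ 2 ^ s * (1 + ‖x‖) ^ (-s) := by
      have : (2:ℝ) ^ s = (1/2) ^ (-s) := by rw [Real.rpow_neg (by norm_num), ← Real.inv_rpow (by norm_num)]; norm_num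
      rw [this, ← Real.mul_rpow (by norm_num) (by positivity)]
      apply Real.rpow_le_rpow_of_nonpos (by positivity) _ (by linarith)
      nlinarith
    have h3 : ‖(brJ m δ 1 : ℂ)‖ = |brJ m δ 1| := by simp
    rw [h3]
    calc _ ≤ |brJ m δ 1| * (C * (2 ^ s * (1 + ‖x‖) ^ (-s))) := by
          gcongr
          exact h1.trans (by gcongr)
      _ = (|brJ m δ 1| * C) * (2 ^ s * (1 + ‖x‖) ^ (-s)) := by ring
      _ ≤ (K + |brJ m δ 1| * C + 1) * (2 ^ s * (1 + ‖x‖) ^ (-s)) := by gcongr; linarith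
      _ = _ := by ring

lemma brKernel_cont (n : ℕ) (δ : ℝ) (hδ : 0 < δ) : Continuous (brKernel n δ) := by
  have : brKernel n δ = fun x => ∫ ξ : En n, (brMul n δ ξ : ℂ) * Complex.exp (-(2 * Real.pi) * Complex.I * ((inner ℝ x ξ : ℝ) : ℂ)) := by
    ext x; exact brKernel_eq_inner n δ x
  rw [this]
  have hc := brMul_cont n δ hδ
  refine continuous_of_dominated (bound := fun ξ => brMul n δ ξ) ?_ ?_ (brMul_int n δ hδ) ?_
  · intro x; exact Continuous.aestronglyMeasurable (by fun_prop)
  · intro x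
    refine Filter.Eventually.of_forall fun ξ => ?_
    rw [norm_mul, Complex.norm_exp]
    have : 0 ≤ brMul n δ ξ := by unfold brMul; positivity
    simp [abs_of_nonneg this]
  · refine Filter.Eventually.of_forall fun ξ => ?_
    fun_prop
end

section
open MeasureTheory Real Set
open scoped ENNReal NNReal

open scoped FourierTransform

abbrev Sw (n : ℕ) : Type := SchwartzMap (En n) ℂ

variable {n : ℕ}

def sc (K f : Sw n) : Sw n := SchwartzMap.convolution (ContinuousLinearMap.mul ℂ ℂ) K f

lemma sc_apply (K f : Sw n) (x : En n) : sc K f x = ∫ y, K (x - y) * f y := by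
  unfold sc
  rw [SchwartzMap.convolution_apply]
  unfold MeasureTheory.convolution
  rw [← integral_sub_left_eq_self _ volume x]
  simp

lemma sc_apply' (K f : Sw n) (x : En n) : sc K f x = ∫ y, K y * f (x - y) := by
  rw [sc_apply]
  rw [← integral_sub_left_eq_self _ volume x]
  simp

lemma fourier_sc (K f : Sw n) (ξ : En n) : 𝓕 (sc K f) ξ = 𝓕 K ξ * 𝓕 f ξ := by
  unfold sc
  rw [SchwartzMap.fourier_convolution, SchwartzMap.pairing_apply_apply]
  simp

lemma sw_ext {a b : Sw n} (h : ∀ ξ, 𝓕 a ξ = 𝓕 b ξ) : a = b := by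
  have : 𝓕 a = 𝓕 b := SchwartzMap.ext h
  have h2 := congrArg (fun z : Sw n => (𝓕⁻ z : Sw n)) this
  simpa using h2

def dS (t : ℝ) (K : Sw n) : Sw n :=
  if h : t ≠ 0 then ((t ^ n)⁻¹ : ℝ) •
    SchwartzMap.compCLMOfContinuousLinearEquiv ℂ (ContinuousLinearEquiv.smulLeft (Units.mk0 t⁻¹ (inv_ne_zero h)) : En n ≃L[ℝ] En n) K
  else 0

lemma dS_apply {t : ℝ} (ht : 0 < t) (K : Sw n) (x : En n) : dS t K x = (t ^ n)⁻¹ • K (t⁻¹ • x) := by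
  unfold dS
  rw [dif_pos ht.ne']
  simp

lemma integral_dil {E : Type*} [NormedAddCommGroup E] [NormedSpace ℝ E] {t : ℝ} (ht : 0 < t) (g : En n → E) :
    ∫ x, (t ^ n)⁻¹ • g (t⁻¹ • x) = ∫ x, g x := by
  rw [integral_smul, Measure.integral_comp_smul]
  simp [abs_of_pos ht, smul_smul]
  rw [inv_mul_cancel₀ (by positivity), one_smul]

lemma fourier_dS {t : ℝ} (ht : 0 < t) (K : Sw n) (ξ : En n) : 𝓕 (dS t K) ξ = 𝓕 K (t • ξ) := by
  rw [SchwartzMap.fourier_coe, SchwartzMap.fourier_coe, Real.fourier_eq, Real.fourier_eq]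
  symm
  rw [← integral_dil ht]
  congr 1; ext v
  have : inner ℝ (t⁻¹ • v) (t • ξ) = inner ℝ v ξ := by
    rw [inner_smul_left, inner_smul_right]
    simp [ht.ne']
  rw [dS_apply ht, smul_comm, this]

lemma sc_assoc (a b c : Sw n) : sc (sc a b) c = sc a (sc b c) :=
  sw_ext fun ξ => by simp only [fourier_sc, mul_assoc]

lemma sc_comm (a b : Sw n) : sc a b = sc b a :=
  sw_ext fun ξ => by simp only [fourier_sc, mul_comm]

lemma dS_sc {t : ℝ} (ht : 0 < t) (a b : Sw n) : dS t (sc a b) = sc (dS t a) (dS t b) :=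
  sw_ext fun ξ => by simp only [fourier_sc, fourier_dS ht]

lemma fourier_inv_sw (m : Sw n) (ξ : En n) : 𝓕 (𝓕⁻ m : Sw n) ξ = m ξ := by simp

/-- the Bochner-Riesz means only see a band limited part of `f` -/
lemma brKernel_fourier (δ : ℝ) (x : En n) : brKernel n δ x = 𝓕 (fun ξ => (brMul n δ ξ : ℂ)) x := by
  rw [brKernel_eq_inner, Real.fourier_eq]
  congr 1; ext ξ
  rw [Circle.smul_def, Real.fourierChar_apply, smul_eq_mul, mul_comm]
  congr 2
  rw [real_inner_comm]; push_cast; ring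

lemma brMeans_eq (δ : ℝ) (hδ : 0 < δ) {ε : ℝ} (hε : 0 < ε) (f : Sw n) (x : En n) :
    brMeans n δ ε f x = ∫ ξ, (brMul n δ ξ : ℂ) * (Complex.exp (-(2 * Real.pi) * Complex.I * ((inner ℝ x (ε⁻¹ • ξ) : ℝ) : ℂ)) * ((ε ^ n)⁻¹ • 𝓕 f (-(ε⁻¹ • ξ)))) := by
  unfold brMeans brKernelDil
  simp only [brKernel_eq_inner]
  have : ∀ y, f y * ((ε ^ n)⁻¹ • ∫ ξ : En n, (brMul n δ ξ : ℂ) * Complex.exp (-(2 * Real.pi) * Complex.I * ((inner ℝ (ε⁻¹ • (x - y)) ξ : ℝ) : ℂ)))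
     = ∫ ξ : En n, f y * ((ε ^ n)⁻¹ • ((brMul n δ ξ : ℂ) * Complex.exp (-(2 * Real.pi) * Complex.I * ((inner ℝ (ε⁻¹ • (x - y)) ξ : ℝ) : ℂ)))) := by
    intro y
    rw [integral_const_mul, integral_smul]
  simp only [this]
  rw [integral_integral_swap]
  · congr 1; ext ξ
    rw [SchwartzMap.fourier_coe, Real.fourier_eq, ← integral_smul, ← integral_const_mul, ← integral_const_mul]
    congr 1; ext y
    rw [Circle.smul_def, Real.fourierChar_apply]
    simp only [Complex.real_smul, smul_eq_mul]
    have : Complex.exp (-(2 * Real.pi) * Complex.I * ((inner ℝ (ε⁻¹ • (x - y)) ξ : ℝ) : ℂ)) =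
      Complex.exp (-(2 * Real.pi) * Complex.I * ((inner ℝ x (ε⁻¹ • ξ) : ℝ) : ℂ)) * Complex.exp (((2 * π * -inner ℝ y (-(ε⁻¹ • ξ)) : ℝ) : ℂ) * Complex.I) := by
      rw [← Complex.exp_add]; congr 1
      simp only [inner_smul_left, inner_smul_right, inner_sub_left, inner_neg_right]
      simp
      ring
    rw [this]; ring
  · have h1 : Integrable (fun z : En n × En n => f z.1 * ((brMul n δ z.2 : ℝ) : ℂ)) (volume.prod volume) :=
      f.integrable.mul_prod (brMul_int n δ hδ).ofReal
    have h2 : Integrable (fun z : En n × En n => (f z.1 * ((brMul n δ z.2 : ℝ) : ℂ)) * ((ε ^ n)⁻¹ • Complex.exp (-(2 * Real.pi) * Complex.I * ((inner ℝ (ε⁻¹ • (x - z.1)) z.2 : ℝ) : ℂ)))) (volume.prod volume) := by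
      apply Integrable.mul_bdd (c := (ε^n)⁻¹) h1
      · exact Continuous.aestronglyMeasurable (by fun_prop)
      · refine Filter.Eventually.of_forall fun ξ => ?_
        rw [norm_smul, Complex.norm_exp]; simp [abs_of_pos hε]
    refine h2.congr (Filter.Eventually.of_forall fun z => ?_)
    simp only [Function.uncurry, Complex.real_smul]
    ring

lemma brMeans_band (δ : ℝ) (hδ : 0 < δ) {ε : ℝ} (hε : 0 < ε) (Ψ f : Sw n)
    (hΨ : ∀ ξ, ‖ξ‖ ≤ 1 → 𝓕 Ψ ξ = 1) :
    brMeans n δ ε (sc (dS ε Ψ) f) = brMeans n δ ε f := by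
  ext x
  rw [brMeans_eq δ hδ hε, brMeans_eq δ hδ hε]
  congr 1; ext ξ
  by_cases h : 1 ≤ ‖ξ‖
  · rw [brMul_zero n δ hδ ξ h]; simp
  · rw [fourier_sc, fourier_dS hε, hΨ, one_mul]
    rw [smul_neg, smul_inv_smul₀ hε.ne', norm_neg]; linarith

lemma exists_hat_bump (r R : ℝ) (hr : 0 < r) (hR : r < R) : ∃ Ψ : Sw n,
    (∀ ξ, ‖ξ‖ ≤ r → 𝓕 Ψ ξ = 1) ∧ (∀ ξ, R ≤ ‖ξ‖ → 𝓕 Ψ ξ = 0) ∧ ∀ ξ, ‖𝓕 Ψ ξ‖ ≤ 1 := by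
  let b : ContDiffBump (0 : En n) := ⟨r, R, hr, hR⟩
  have hs : ContDiff ℝ (⊤ : ℕ∞) (fun x => ((b x : ℝ) : ℂ)) := Complex.ofRealCLM.contDiff.comp b.contDiff
  have hc : HasCompactSupport (fun x => ((b x : ℝ) : ℂ)) := b.hasCompactSupport.comp_left (g := fun x : ℝ => (x : ℂ)) (by simp)
  refine ⟨𝓕⁻ (hc.toSchwartzMap hs), fun ξ hξ => ?_, fun ξ hξ => ?_, fun ξ => ?_⟩
  · rw [fourier_inv_sw]
    change ((b ξ : ℝ) : ℂ) = 1
    rw [b.one_of_mem_closedBall (by simpa using hξ)]; simp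
  · rw [fourier_inv_sw]
    change ((b ξ : ℝ) : ℂ) = 0
    rw [b.zero_of_le_dist (by simpa using hξ)]; simp
  · rw [fourier_inv_sw]
    change ‖((b ξ : ℝ) : ℂ)‖ ≤ 1
    rw [Complex.norm_real, Real.norm_of_nonneg b.nonneg]; exact b.le_one
end

section
open MeasureTheory Real Set
open scoped ENNReal NNReal
open scoped FourierTransform
variable {n : ℕ}

lemma sw_int_pow (K : Sw n) (N : ℕ) : Integrable (fun z => ‖K z‖ * (1 + ‖z‖) ^ N) := by
  have h1 := (K.integrable_pow_mul volume 0).add (K.integrable_pow_mul volume N)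
  refine (h1.const_mul (2 ^ (N-1))).mono' ?_ ?_
  · exact Continuous.aestronglyMeasurable (by have := K.continuous; fun_prop)
  · refine Filter.Eventually.of_forall fun z => ?_
    rw [Real.norm_of_nonneg (by positivity)]
    have := add_pow_le zero_le_one (norm_nonneg z) N
    simp only [Pi.add_apply, pow_zero, one_mul, one_pow] at *
    nlinarith [norm_nonneg (K z)]

def cK (N : ℕ) (K : Sw n) : ℝ := ∫ z, ‖K z‖ * (1 + ‖z‖) ^ N

lemma cK_nonneg (N : ℕ) (K : Sw n) : 0 ≤ cK N K := integral_nonneg fun z => by positivity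

lemma pw_mul (x y z : En n) {u v : ℝ} (hv : 0 < v) (hvu : v ≤ u) (N : ℕ) :
    (1 + dist x (y - z) / u) ^ N ≤ (1 + dist x y / u) ^ N * (1 + ‖v⁻¹ • z‖) ^ N := by
  have hu : 0 < u := hv.trans_le hvu
  rw [← mul_pow]
  have h1 : dist x (y - z) ≤ dist x y + ‖z‖ := by
    have := dist_triangle x y (y - z)
    simpa [dist_eq_norm] using this
  rw [norm_smul, norm_inv, Real.norm_of_nonneg hv.le]
  have h2 : u⁻¹ ≤ v⁻¹ := by gcongr
  have h3 : dist x (y - z) / u ≤ dist x y / u + v⁻¹ * ‖z‖ := by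
    calc _ ≤ (dist x y + ‖z‖) / u := by gcongr
      _ = dist x y / u + u⁻¹ * ‖z‖ := by field_simp
      _ ≤ _ := by gcongr
  have h4 : 0 ≤ dist x y / u * (v⁻¹ * ‖z‖) := by positivity
  gcongr
  nlinarith

lemma conv_bound (N : ℕ) (K g : Sw n) (x y : En n) {u v B : ℝ} (hv : 0 < v) (hvu : v ≤ u)
    (hB : 0 ≤ B) (hg : ∀ z, ‖g z‖ ≤ B * (1 + dist x z / u) ^ N) :
    ‖sc (dS v K) g y‖ ≤ cK N K * B * (1 + dist x y / u) ^ N := by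
  have hu : 0 < u := hv.trans_le hvu
  rw [sc_apply']
  have hi : Integrable (fun z => (v ^ n)⁻¹ • (‖K (v⁻¹ • z)‖ * (1 + ‖v⁻¹ • z‖) ^ N)) :=
    (Integrable.comp_smul (sw_int_pow K N) (inv_ne_zero hv.ne')).const_mul _
  calc ‖∫ z, dS v K z * g (y - z)‖ ≤ ∫ z, ((v ^ n)⁻¹ • (‖K (v⁻¹ • z)‖ * (1 + ‖v⁻¹ • z‖) ^ N)) * (B * (1 + dist x y / u) ^ N) := by
        apply norm_integral_le_of_norm_le (hi.mul_const _)
        refine Filter.Eventually.of_forall fun z => ?_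
        rw [norm_mul, dS_apply hv, norm_smul, norm_inv, norm_pow, Real.norm_of_nonneg hv.le, smul_eq_mul]
        have h1 := hg (y - z)
        have h2 := pw_mul x y z hv hvu N
        calc _ ≤ (v ^ n)⁻¹ * ‖K (v⁻¹ • z)‖ * (B * ((1 + dist x y / u) ^ N * (1 + ‖v⁻¹ • z‖) ^ N)) := by
              gcongr; exact h1.trans (by gcongr)
          _ = _ := by ring
    _ = _ := by
        rw [integral_mul_const, integral_dil hv (fun z => ‖K z‖ * (1 + ‖z‖) ^ N), cK]; ring

/-- division of a compactly supported function -/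
lemma exists_hat_div (a b : En n → ℂ) (ha : ContDiff ℝ (⊤ : ℕ∞) a) (hb : ContDiff ℝ (⊤ : ℕ∞) b)
    (hc : HasCompactSupport a) (h : ∀ ξ ∈ tsupport a, b ξ ≠ 0) :
    ∃ X : Sw n, ∀ ξ, 𝓕 X ξ * b ξ = a ξ := by
  have hs : ContDiff ℝ (⊤ : ℕ∞) (fun ξ => a ξ / b ξ) := by
    rw [contDiff_iff_contDiffAt]
    intro ξ
    by_cases hξ : ξ ∈ tsupport a
    · simp only [div_eq_mul_inv]
      exact ContDiffAt.mul ha.contDiffAt (ContDiffAt.inv hb.contDiffAt (h ξ hξ))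
    · have h0 : (fun ξ => a ξ / b ξ) =ᶠ[nhds ξ] fun _ => 0 := by
        have := notMem_tsupport_iff_eventuallyEq.1 hξ
        filter_upwards [this] with z hz
        simp [hz]
      exact contDiffAt_const.congr_of_eventuallyEq h0
  have hcs : HasCompactSupport (fun ξ => a ξ / b ξ) := by
    simp only [div_eq_mul_inv]
    exact hc.mul_right
  refine ⟨𝓕⁻ (hcs.toSchwartzMap hs), fun ξ => ?_⟩
  rw [fourier_inv_sw]
  change a ξ / b ξ * b ξ = a ξ
  by_cases hξ : b ξ = 0
  · have : ξ ∉ tsupport a := fun h' => h ξ h' hξ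
    rw [image_eq_zero_of_notMem_tsupport this]; simp
  · field_simp

lemma approx_id (E g : Sw n) (hE0 : 𝓕 E 0 = 1) (hE : ∀ ξ, ‖𝓕 E ξ‖ ≤ 1) (v : ℕ → ℝ) (hv : ∀ k, 0 < v k)
    (hv0 : Filter.Tendsto v Filter.atTop (nhds 0)) (y : En n) :
    Filter.Tendsto (fun k => sc (dS (v k) E) g y) Filter.atTop (nhds (g y)) := by
  have key : ∀ h : Sw n, h y = ∫ ξ, 𝐞 (inner ℝ ξ y) • 𝓕 h ξ := by
    intro h
    have : h = 𝓕⁻ (𝓕 h : Sw n) := by simp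
    conv_lhs => rw [this, SchwartzMap.fourierInv_coe, Real.fourierInv_eq]
  rw [key g]
  simp only [key (sc _ _), fourier_sc]
  apply tendsto_integral_of_dominated_convergence (fun ξ => ‖𝓕 g ξ‖)
  · intro k
    apply Continuous.aestronglyMeasurable
    have h1 := (𝓕 g).continuous
    have h2 := (𝓕 (dS (v k) E)).continuous
    have h3 := Real.continuous_fourierChar
    have h4 : Continuous fun x : En n => inner ℝ x y := by fun_prop
    exact Continuous.smul (continuous_subtype_val.comp (h3.comp h4)) (h2.mul h1)
  · exact (𝓕 g).integrable.norm
  · intro k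
    refine Filter.Eventually.of_forall fun ξ => ?_
    rw [Circle.norm_smul, norm_mul, fourier_dS (hv k)]
    exact mul_le_of_le_one_left (norm_nonneg _) (hE _)
  · refine Filter.Eventually.of_forall fun ξ => ?_
    have : Filter.Tendsto (fun k => 𝓕 (dS (v k) E) ξ) Filter.atTop (nhds 1) := by
      simp only [fourier_dS (hv _)]
      rw [← hE0]
      have h2 := (𝓕 E).continuous.tendsto (0 : En n)
      have h3 : Filter.Tendsto (fun k => v k • ξ) Filter.atTop (nhds 0) := by
        simpa using hv0.smul_const ξ
      exact h2.comp h3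
    have h4 := (this.mul_const (𝓕 g ξ)).const_smul (𝐞 (inner ℝ ξ y))
    simpa using h4
end

section
open MeasureTheory Real Set
open scoped ENNReal NNReal
open scoped FourierTransform
variable {n : ℕ}

lemma fs_setup (Φ : Sw n) (hΦ : (∫ x, Φ x) ≠ 0) (L : ℕ) (Θ : Sw n) : ∃ E X0 X H : Sw n,
    𝓕 E 0 = 1 ∧ (∀ ξ, ‖𝓕 E ξ‖ ≤ 1) ∧ (∀ ξ, 𝓕 X0 ξ * 𝓕 Φ ξ = 𝓕 E ξ) ∧
    (∀ ξ, 𝓕 X ξ * ((((‖ξ‖ ^ 2) ^ L : ℝ) : ℂ) * 𝓕 Φ ξ) = 𝓕 E ξ - 𝓕 E ((2:ℝ) • ξ)) ∧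
    (∀ ξ, 𝓕 H ξ = (((‖ξ‖ ^ 2) ^ L : ℝ) : ℂ) * 𝓕 Θ ξ) := by
  have h0 : 𝓕 Φ 0 ≠ 0 := by
    rw [SchwartzMap.fourier_coe, Real.fourier_eq]
    simpa using hΦ
  have hev : ∀ᶠ ξ in nhds (0 : En n), 𝓕 Φ ξ ≠ 0 := (𝓕 Φ).continuous.continuousAt.eventually_ne h0
  obtain ⟨ρ, hρ, hball⟩ := Metric.eventually_nhds_iff.1 hev
  obtain ⟨E, hE1, hE2, hE3⟩ := exists_hat_bump (n := n) (ρ/4) (ρ/2) (by linarith) (by linarith)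
  have hcE : HasCompactSupport (𝓕 E : Sw n) := by
    apply HasCompactSupport.intro (isCompact_closedBall (0 : En n) (ρ/2))
    intro ξ hξ; apply hE2; simp at hξ; exact hξ.le
  have hsE : ContDiff ℝ (⊤ : ℕ∞) (𝓕 E : Sw n) := (𝓕 E : Sw n).smooth _
  have hsΦ : ContDiff ℝ (⊤ : ℕ∞) (𝓕 Φ : Sw n) := (𝓕 Φ : Sw n).smooth _
  obtain ⟨X0, hX0⟩ := exists_hat_div (𝓕 E : Sw n) (𝓕 Φ : Sw n) hsE hsΦ hcE (by
    intro ξ hξ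
    have : tsupport (𝓕 E : Sw n) ⊆ Metric.closedBall 0 (ρ/2) := by
      apply closure_minimal _ Metric.isClosed_closedBall
      intro ξ hξ
      by_contra hc
      simp at hc
      exact hξ (hE2 ξ hc.le)
    have := this hξ
    simp at this
    apply hball; simp; linarith)
  have hsn : ContDiff ℝ (⊤ : ℕ∞) (fun ξ : En n => (((‖ξ‖ ^ 2) ^ L : ℝ) : ℂ)) :=
    Complex.ofRealCLM.contDiff.comp ((contDiff_norm_sq ℝ).pow L)
  have ha0 : ∀ ξ, (‖ξ‖ < ρ/8 ∨ ρ/2 < ‖ξ‖) → 𝓕 E ξ - 𝓕 E ((2:ℝ) • ξ) = 0 := by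
    intro ξ h
    have h2 : ‖(2:ℝ) • ξ‖ = 2 * ‖ξ‖ := by rw [norm_smul]; simp
    rcases h with h | h
    · rw [hE1 ξ (by linarith), hE1 _ (by rw [h2]; linarith), sub_self]
    · rw [hE2 ξ (by linarith), hE2 _ (by rw [h2]; linarith), sub_self]
  have hsa : ContDiff ℝ (⊤ : ℕ∞) (fun ξ : En n => 𝓕 E ξ - 𝓕 E ((2:ℝ) • ξ)) :=
    hsE.sub (hsE.comp (contDiff_const_smul _))
  obtain ⟨X, hX⟩ := exists_hat_div (fun ξ : En n => 𝓕 E ξ - 𝓕 E ((2:ℝ) • ξ)) (fun ξ => (((‖ξ‖ ^ 2) ^ L : ℝ) : ℂ) * 𝓕 Φ ξ) hsa (hsn.mul hsΦ) (by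
      apply HasCompactSupport.intro (isCompact_closedBall (0 : En n) (ρ/2))
      intro ξ hξ; apply ha0; simp at hξ; exact Or.inr hξ) (by
    intro ξ hξ
    have : tsupport (fun ξ : En n => 𝓕 E ξ - 𝓕 E ((2:ℝ) • ξ)) ⊆ {ξ | ρ/8 ≤ ‖ξ‖ ∧ ‖ξ‖ ≤ ρ/2} := by
      apply closure_minimal
      · intro ξ hξ
        by_contra hc
        simp only [mem_setOf_eq, not_and_or, not_le] at hc
        exact hξ (ha0 ξ hc)
      · exact (isClosed_le continuous_const continuous_norm).inter (isClosed_le continuous_norm continuous_const)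
    have := this hξ
    simp only [mem_setOf_eq] at this
    have hξ0 : 0 < ‖ξ‖ := by linarith
    refine mul_ne_zero ?_ ?_
    · exact_mod_cast (by positivity : (‖ξ‖ ^ 2) ^ L ≠ 0)
    · apply hball; simp; linarith)
  have htg : (fun ξ : En n => (((‖ξ‖ ^ 2) ^ L : ℝ) : ℂ)).HasTemperateGrowth := by
    have h1 : (fun ξ : En n => ‖ξ‖ ^ 2).HasTemperateGrowth := Function.hasTemperateGrowth_norm_sq _
    have h2 : (fun ξ : En n => ((‖ξ‖ ^ 2) ^ L : ℝ)).HasTemperateGrowth := by fun_prop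
    exact Function.HasTemperateGrowth.comp (Complex.ofRealCLM.hasTemperateGrowth) h2
  refine ⟨E, X0, X, 𝓕⁻ (SchwartzMap.smulLeftCLM ℂ (fun ξ : En n => (((‖ξ‖ ^ 2) ^ L : ℝ) : ℂ)) (𝓕 Θ)), hE1 0 (by simp; linarith), hE3, hX0, hX, ?_⟩
  intro ξ
  rw [fourier_inv_sw, SchwartzMap.smulLeftCLM_apply_apply htg, smul_eq_mul]

theorem FS1 (Φ : Sw n) (hΦ : (∫ x, Φ x) ≠ 0) (N : ℕ) (Θ : Sw n) : ∃ C : ℝ, 0 ≤ C ∧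
    ∀ (f : Sw n) (x y : En n) (t B : ℝ), 0 < t → 0 ≤ B →
      (∀ u, 0 < u → u ≤ t → ∀ z, ‖sc (dS u Φ) f z‖ ≤ B * (1 + dist x z / u) ^ N) →
      ‖sc (dS t Θ) f y‖ ≤ C * B * (1 + dist x y / t) ^ N := by
  obtain ⟨E, X0, X, H, hE0, hE1, hX0, hX, hH⟩ := fs_setup Φ hΦ (N+1) Θ
  set c0 := cK N X0 * cK N Θ with hc0
  set c1 := cK N X * cK N H with hc1
  have hc0' : 0 ≤ c0 := mul_nonneg (cK_nonneg _ _) (cK_nonneg _ _)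
  have hc1' : 0 ≤ c1 := mul_nonneg (cK_nonneg _ _) (cK_nonneg _ _)
  refine ⟨c0 + c1, by positivity, fun f x y t B ht hB hf => ?_⟩
  set P := B * (1 + dist x y / t) ^ N with hP
  have hP' : 0 ≤ P := by positivity
  have hu : ∀ k : ℕ, 0 < t * (1/2)^k := fun k => by positivity
  have hbase : ‖sc (dS t E) (sc (dS t Θ) f) y‖ ≤ c0 * P := by
    have : sc (dS t E) (sc (dS t Θ) f) = sc (dS t X0) (sc (dS t Θ) (sc (dS t Φ) f)) := by
      apply sw_ext; intro ξ
      simp only [fourier_sc, fourier_dS ht, ← hX0]; ring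
    rw [this]
    have h1 : ∀ z, ‖sc (dS t Θ) (sc (dS t Φ) f) z‖ ≤ (cK N Θ * B) * (1 + dist x z / t) ^ N := fun z =>
      conv_bound N Θ _ x z ht le_rfl hB (hf t ht le_rfl)
    have h2 := conv_bound N X0 _ x y ht le_rfl (mul_nonneg (cK_nonneg _ _) hB) h1
    refine h2.trans_eq ?_
    rw [hP, hc0]; ring
  have hterm : ∀ k : ℕ, ‖sc (dS (t * (1/2)^k) X) (sc (dS t H) (sc (dS (t * (1/2)^k) Φ) f)) y‖ ≤ 2 ^ (k*N) * c1 * P := by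
    intro k
    have hk1 : (1/2:ℝ)^k ≤ 1 := pow_le_one₀ (by norm_num) (by norm_num)
    have hle : t * (1/2)^k ≤ t := mul_le_of_le_one_right ht.le hk1
    have h0 : ∀ z, ‖sc (dS (t * (1/2)^k) Φ) f z‖ ≤ (B * 2 ^ (k*N)) * (1 + dist x z / t) ^ N := by
      intro z
      refine (hf _ (hu k) hle z).trans ?_
      rw [mul_assoc, pow_mul, ← mul_pow]
      gcongr
      have : dist x z / (t * (1/2)^k) = 2^k * (dist x z / t) := by
        field_simp; rw [div_pow]; field_simp; simp
      rw [this, mul_add]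
      have : (1:ℝ) ≤ 2^k := one_le_pow₀ (by norm_num)
      linarith
    have h1 : ∀ z, ‖sc (dS t H) (sc (dS (t * (1/2)^k) Φ) f) z‖ ≤ (cK N H * (B * 2 ^ (k*N))) * (1 + dist x z / t) ^ N := fun z =>
      conv_bound N H _ x z ht le_rfl (by positivity) h0
    have h2 := conv_bound N X _ x y (hu k) hle (mul_nonneg (cK_nonneg _ _) (by positivity)) h1
    refine h2.trans_eq ?_
    rw [hP, hc1]; ring
  have hstep : ∀ k : ℕ, sc (dS (t * (1/2)^(k+1)) E) (sc (dS t Θ) f) = sc (dS (t * (1/2)^k) E) (sc (dS t Θ) f)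
      + (((1/4)^((k+1) * (N+1)) : ℝ) : ℂ) • sc (dS (t * (1/2)^(k+1)) X) (sc (dS t H) (sc (dS (t * (1/2)^(k+1)) Φ) f)) := by
    intro k
    apply sw_ext; intro ξ
    rw [FourierTransform.fourier_add, FourierTransform.fourier_smul]
    simp only [SchwartzMap.add_apply, SchwartzMap.smul_apply, fourier_sc, fourier_dS ht, fourier_dS (hu _), hH, smul_eq_mul]
    have := hX ((t * (1/2)^(k+1)) • ξ)
    have e1 : (2:ℝ) • (t * (1/2)^(k+1)) • ξ = (t * (1/2)^k) • ξ := by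
      rw [smul_smul]; congr 1; rw [pow_succ]; ring
    rw [e1] at this
    have e2 : (‖(t * (1/2)^(k+1)) • ξ‖^2)^(N+1) = (1/4)^((k+1)*(N+1)) * (‖t • ξ‖^2)^(N+1) := by
      rw [norm_smul, norm_smul, norm_mul, norm_pow, pow_mul, ← mul_pow]
      congr 1
      rw [show (1/4:ℝ) = (1/2)^2 by norm_num, ← pow_mul, mul_comm 2 (k+1), pow_mul]
      norm_num
      ring
    rw [e2] at this
    push_cast at this ⊢
    linear_combination (-(𝓕 Θ (t • ξ) * 𝓕 f ξ)) * this
  have hind : ∀ k : ℕ, ‖sc (dS (t * (1/2)^k) E) (sc (dS t Θ) f) y‖ ≤ (c0 + c1 * (1 - (1/2)^k)) * P := by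
    intro k
    induction k with
    | zero => simpa using hbase
    | succ k ih =>
      rw [hstep, SchwartzMap.add_apply, SchwartzMap.smul_apply]
      refine (norm_add_le _ _).trans ?_
      rw [norm_smul]
      have h1 := hterm (k+1)
      have h2 : ‖(((1/4)^((k+1) * (N+1)) : ℝ) : ℂ)‖ = (1/4)^((k+1) * (N+1)) := by
        rw [Complex.norm_real, Real.norm_of_nonneg (by positivity)]
      rw [h2]
      have h3 : (1/4:ℝ)^((k+1) * (N+1)) * 2 ^ ((k+1)*N) ≤ (1/2)^(k+1) := by
        calc (1/4:ℝ)^((k+1) * (N+1)) * 2 ^ ((k+1)*N) = ((1/4)^(N+1) * 2^N)^(k+1) := by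
              rw [mul_pow, ← pow_mul, ← pow_mul]; ring_nf
          _ ≤ _ := by
              gcongr
              calc (1/4:ℝ)^(N+1) * 2^N = (1/2)^N * (1/4) := by
                    rw [pow_succ, mul_right_comm, ← mul_pow]; norm_num
                _ ≤ 1 * (1/4) := by gcongr; exact pow_le_one₀ (by norm_num) (by norm_num)
                _ ≤ _ := by norm_num
      calc _ ≤ (c0 + c1 * (1 - (1/2)^k)) * P + (1/4)^((k+1) * (N+1)) * (2 ^ ((k+1)*N) * c1 * P) := by gcongr
        _ = (c0 + c1 * (1 - (1/2)^k)) * P + ((1/4)^((k+1) * (N+1)) * 2 ^ ((k+1)*N)) * (c1 * P) := by ring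
        _ ≤ (c0 + c1 * (1 - (1/2)^k)) * P + (1/2)^(k+1) * (c1 * P) := by gcongr
        _ = _ := by ring
  have hlim := approx_id E (sc (dS t Θ) f) hE0 hE1 (fun k => t * (1/2)^k) hu (by
    have := (tendsto_pow_atTop_nhds_zero_of_lt_one (r := (1/2:ℝ)) (by norm_num) (by norm_num)).const_mul t
    simpa using this) y
  have := le_of_tendsto hlim.norm (b := (c0 + c1) * P) (Filter.Eventually.of_forall fun k => (hind k).trans ?_)
  · rw [hP] at this; linarith
  · have h4 : (0:ℝ) ≤ (1/2)^k := by positivity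
    have h5 : c1 * (1 - (1/2)^k) ≤ c1 := by nlinarith
    gcongr
end

section
open MeasureTheory Real Set
open scoped ENNReal NNReal
open scoped FourierTransform LineDeriv
variable {n : ℕ}

/-- tangential (Peetre) maximal function -/
def AM (Φ : Sw n) (N : ℕ) (f : Sw n) (x : En n) : ℝ≥0∞ :=
  ⨆ (t : ℝ) (_ : 0 < t) (w : En n), ENNReal.ofReal (‖sc (dS t Φ) f w‖ / (1 + dist x w / t) ^ N)

lemma sc_bdd (Φ f : Sw n) : ∃ M : ℝ, 0 ≤ M ∧ ∀ t, 0 < t → ∀ w, ‖sc (dS t Φ) f w‖ ≤ M := by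
  refine ⟨cK 0 Φ * SchwartzMap.seminorm ℝ 0 0 f, mul_nonneg (cK_nonneg _ _) (apply_nonneg _ _), fun t ht w => ?_⟩
  have := conv_bound 0 Φ f w w (B := SchwartzMap.seminorm ℝ 0 0 f) ht le_rfl (apply_nonneg _ _) (by
    intro z; simpa using SchwartzMap.norm_le_seminorm ℝ f z)
  simpa using this

lemma AM_bdd (Φ : Sw n) (N : ℕ) (f : Sw n) : ∃ M : ℝ≥0∞, M ≠ ⊤ ∧ ∀ x, AM Φ N f x ≤ M := by
  obtain ⟨M, hM, h⟩ := sc_bdd Φ f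
  refine ⟨ENNReal.ofReal M, ENNReal.ofReal_ne_top, fun x => iSup_le fun t => iSup_le fun ht => iSup_le fun w => ?_⟩
  apply ENNReal.ofReal_le_ofReal
  refine (div_le_self (norm_nonneg _) ?_).trans (h t ht w)
  exact one_le_pow₀ (by have : 0 ≤ dist x w / t := by positivity
                        linarith)

lemma AM_ne_top (Φ : Sw n) (N : ℕ) (f : Sw n) (x : En n) : AM Φ N f x ≠ ⊤ := by
  obtain ⟨M, hM, h⟩ := AM_bdd Φ N f
  exact ne_top_of_le_ne_top hM (h x)

lemma AM_lsc (Φ : Sw n) (N : ℕ) (f : Sw n) : LowerSemicontinuous (AM Φ N f) := by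
  unfold AM
  refine lowerSemicontinuous_iSup fun t => lowerSemicontinuous_iSup fun ht => lowerSemicontinuous_iSup fun w => ?_
  apply Continuous.lowerSemicontinuous
  apply ENNReal.continuous_ofReal.comp
  apply Continuous.div continuous_const (by fun_prop)
  intro x
  have : 0 ≤ dist x w / t := by positivity
  positivity

lemma AM_spec (Φ : Sw n) (N : ℕ) (f : Sw n) (x w : En n) {t : ℝ} (ht : 0 < t) :
    ‖sc (dS t Φ) f w‖ ≤ (AM Φ N f x).toReal * (1 + dist x w / t) ^ N := by
  have h0 : 0 ≤ dist x w / t := by positivity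
  have : ENNReal.ofReal (‖sc (dS t Φ) f w‖ / (1 + dist x w / t) ^ N) ≤ AM Φ N f x :=
    le_iSup_of_le t (le_iSup_of_le ht (le_iSup_of_le w le_rfl))
  have h2 := (ENNReal.ofReal_le_iff_le_toReal (AM_ne_top Φ N f x)).1 this
  rwa [div_le_iff₀ (by positivity)] at h2

lemma AM_FS (Φ : Sw n) (hΦ : (∫ x, Φ x) ≠ 0) (N : ℕ) (Θ : Sw n) : ∃ C : ℝ, 0 ≤ C ∧
    ∀ (f : Sw n) (x y : En n) (t : ℝ), 0 < t →
      ‖sc (dS t Θ) f y‖ ≤ C * (AM Φ N f x).toReal * (1 + dist x y / t) ^ N := by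
  obtain ⟨C, hC, h⟩ := FS1 Φ hΦ N Θ
  exact ⟨C, hC, fun f x y t ht => h f x y t _ ht ENNReal.toReal_nonneg fun u hu _ z => AM_spec Φ N f x z hu⟩

lemma radMax_eq (Φ f : Sw n) (x : En n) :
    radMax n Φ f x = ⨆ (t : ℝ) (_ : 0 < t), ‖sc (dS t Φ) f x‖ₑ := by
  unfold radMax
  refine iSup_congr fun t => iSup_congr fun ht => ?_
  rw [sc_apply]
  simp only [dS_apply ht]
  rfl

lemma radMax_lsc (Φ f : Sw n) : LowerSemicontinuous (radMax n Φ f) := by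
  have : radMax n Φ f = fun x => ⨆ (t : ℝ) (_ : 0 < t), ‖sc (dS t Φ) f x‖ₑ := funext fun x => radMax_eq Φ f x
  rw [this]
  refine lowerSemicontinuous_iSup fun t => lowerSemicontinuous_iSup fun ht => ?_
  apply Continuous.lowerSemicontinuous
  have := (sc (dS t Φ) f).continuous
  fun_prop

lemma lineDeriv_sc (v : En n) {t : ℝ} (ht : 0 < t) (Φ f : Sw n) :
    ∂_{v} (sc (dS t Φ) f) = ((t⁻¹ : ℝ) : ℂ) • sc (dS t (∂_{v} Φ)) f := by
  have htg : (fun x : En n => inner ℝ x v).HasTemperateGrowth := by fun_prop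
  apply sw_ext; intro ξ
  rw [FourierTransform.fourier_smul, SchwartzMap.smul_apply]
  simp only [fourier_sc, fourier_dS ht, SchwartzMap.fourier_lineDerivOp_eq, SchwartzMap.smul_apply, SchwartzMap.smulLeftCLM_apply_apply htg,
    inner_smul_left, smul_eq_mul, Complex.real_smul]
  have : (t : ℂ) ≠ 0 := by exact_mod_cast ht.ne'
  push_cast
  simp
  field_simp

/-- gradient bound -/
lemma AM_grad (Φ : Sw n) (hΦ : (∫ x, Φ x) ≠ 0) (N : ℕ) : ∃ C : ℝ, 0 ≤ C ∧
    ∀ (f : Sw n) (x y : En n) (t : ℝ), 0 < t →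
      ‖fderiv ℝ (sc (dS t Φ) f) y‖ ≤ C * (AM Φ N f x).toReal * (1 + dist x y / t) ^ N / t := by
  choose C hC h using fun i : Fin n => AM_FS Φ hΦ N (∂_{(EuclideanSpace.single i (1:ℝ) : En n)} Φ)
  refine ⟨∑ i, C i, Finset.sum_nonneg fun i _ => hC i, fun f x y t ht => ?_⟩
  have h0 : 0 ≤ dist x y / t := by positivity
  have hA : 0 ≤ (AM Φ N f x).toReal := ENNReal.toReal_nonneg
  apply ContinuousLinearMap.opNorm_le_bound _ (by
    have : 0 ≤ ∑ i, C i := Finset.sum_nonneg fun i _ => hC i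
    positivity)
  intro v
  have hv : v = ∑ i, v i • (EuclideanSpace.single i (1:ℝ) : En n) := by
    ext j; simp [Finset.sum_apply, Pi.single_apply]
  conv_lhs => rw [hv]
  rw [map_sum]
  calc _ ≤ ∑ i, ‖fderiv ℝ (sc (dS t Φ) f) y (v i • (EuclideanSpace.single i (1:ℝ) : En n))‖ := norm_sum_le _ _
    _ ≤ ∑ i, C i * (AM Φ N f x).toReal * (1 + dist x y / t) ^ N / t * ‖v‖ := by
        refine Finset.sum_le_sum fun i _ => ?_
        rw [map_smul, ← SchwartzMap.lineDerivOp_apply_eq_fderiv, lineDeriv_sc _ ht, SchwartzMap.smul_apply, norm_smul, norm_smul]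
        have h1 := h i f x y t ht
        have h2 : ‖v i‖ ≤ ‖v‖ := PiLp.norm_apply_le v i
        have h3 : ‖((t⁻¹ : ℝ) : ℂ)‖ = t⁻¹ := by rw [Complex.norm_real, Real.norm_of_nonneg (by positivity)]
        rw [h3]
        calc _ ≤ ‖v‖ * (t⁻¹ * (C i * (AM Φ N f x).toReal * (1 + dist x y / t) ^ N)) := by gcongr
          _ = _ := by field_simp
    _ = _ := by simp only [div_eq_mul_inv, ← Finset.sum_mul]

lemma AM_ball (Φ : Sw n) (hΦ : (∫ x, Φ x) ≠ 0) (N : ℕ) : ∃ κ : ℝ, 0 < κ ∧ κ ≤ 1 ∧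
    ∀ (f : Sw n) (x : En n), AM Φ N f x ≠ 0 → ∃ w t, 0 < t ∧ ∀ y ∈ Metric.closedBall w (κ * t),
      (AM Φ N f x).toReal / 4 * (1 + dist x w / t) ^ N ≤ ‖sc (dS t Φ) f y‖ := by
  obtain ⟨C, hC, h⟩ := AM_grad Φ hΦ N
  refine ⟨min 1 (1 / ((C + 1) * 2 ^ (N+2))), by positivity, min_le_left _ _, fun f x hx => ?_⟩
  set κ := min 1 (1 / ((C + 1) * 2 ^ (N+2))) with hκ
  have hκ0 : 0 < κ := by positivity
  have hκ1 : κ ≤ 1 := min_le_left _ _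
  have hκ2 : κ * ((C + 1) * 2 ^ (N+2)) ≤ 1 := by
    rw [← le_div_iff₀ (by positivity)]; exact min_le_right _ _
  set a := (AM Φ N f x).toReal with ha
  have hap : 0 < a := ENNReal.toReal_pos hx (AM_ne_top Φ N f x)
  have : ENNReal.ofReal (a / 2) < AM Φ N f x := by
    rw [ENNReal.ofReal_lt_iff_lt_toReal (by positivity) (AM_ne_top Φ N f x)]; linarith
  unfold AM at this
  simp only [lt_iSup_iff] at this
  obtain ⟨t, ht, w, hw⟩ := this
  refine ⟨w, t, ht, fun y hy => ?_⟩
  have h0 : 0 ≤ dist x w / t := by positivity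
  have hw2 : a / 2 * (1 + dist x w / t) ^ N < ‖sc (dS t Φ) f w‖ := by
    rw [← lt_div_iff₀ (by positivity)]
    exact (ENNReal.ofReal_lt_ofReal_iff_of_nonneg (by positivity)).1 hw
  have hbound : ∀ z ∈ Metric.closedBall w (κ * t), ‖fderiv ℝ (sc (dS t Φ) f) z‖ ≤ C * a * (2 ^ N * (1 + dist x w / t) ^ N) / t := by
    intro z hz
    refine (h f x z t ht).trans ?_
    rw [← mul_pow]
    have h3 : dist x z ≤ dist x w + t := by
      rw [Metric.mem_closedBall] at hz
      have := dist_triangle x w z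
      rw [dist_comm w z] at this
      nlinarith
    have h4 : dist x z / t ≤ dist x w / t + 1 := by
      rw [div_add_one ht.ne']; gcongr
    have h5 : 0 ≤ dist x z / t := by positivity
    gcongr
    linarith
  have hmv := (convex_closedBall w (κ * t)).norm_image_sub_le_of_norm_fderiv_le (𝕜 := ℝ) (f := sc (dS t Φ) f)
    (fun z _ => (sc (dS t Φ) f).differentiableAt) hbound (Metric.mem_closedBall_self (by positivity)) hy
  have hyn : ‖y - w‖ ≤ κ * t := by rwa [Metric.mem_closedBall, dist_eq_norm] at hy
  have h6 : C * a * (2 ^ N * (1 + dist x w / t) ^ N) / t * ‖y - w‖ ≤ a / 4 * (1 + dist x w / t) ^ N := by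
    calc _ ≤ C * a * (2 ^ N * (1 + dist x w / t) ^ N) / t * (κ * t) := by gcongr
      _ = (κ * (C * 2^(N+2))) * (a / 4 * (1 + dist x w / t) ^ N) := by field_simp; ring
      _ ≤ 1 * (a / 4 * (1 + dist x w / t) ^ N) := by
          gcongr
          refine le_trans ?_ hκ2
          gcongr; linarith
      _ = _ := one_mul _
  have h7 := norm_sub_norm_le (sc (dS t Φ) f w) (sc (dS t Φ) f y)
  rw [norm_sub_rev] at h7
  have h8 := hmv.trans h6
  have h9 : a / 2 * (1 + dist x w / t) ^ N = a / 4 * (1 + dist x w / t) ^ N + a / 4 * (1 + dist x w / t) ^ N := by ring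
  linarith

lemma AM_max (hn : 1 ≤ n) (Φ : Sw n) (hΦ : (∫ x, Φ x) ≠ 0) (N : ℕ) (hN : 1 ≤ N) : ∃ c : ℝ≥0∞, c ≠ 0 ∧ c ≠ ⊤ ∧
    ∀ (f : Sw n) (x : En n), AM Φ N f x ≠ 0 → ∃ R, 0 < R ∧
      AM Φ N f x ^ ((n:ℝ)/N) * ENNReal.ofReal R ^ n ≤ c * ∫⁻ y in Metric.closedBall x R, radMax n Φ f y ^ ((n:ℝ)/N) := by
  obtain ⟨κ, hκ0, hκ1, h⟩ := AM_ball Φ hΦ N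
  have hn' : (0:ℝ) < n := by exact_mod_cast hn
  have hN' : (0:ℝ) < N := by exact_mod_cast hN
  set V := volume (Metric.closedBall (0 : En n) 1) with hV
  have hV0 : V ≠ 0 := (Metric.measure_closedBall_pos volume _ one_pos).ne'
  have hVt : V ≠ ⊤ := measure_closedBall_lt_top.ne
  set c1 : ℝ≥0∞ := ENNReal.ofReal (4 ^ ((n:ℝ)/N)) * (ENNReal.ofReal κ ^ n * V)⁻¹ with hc1
  have hκe : ENNReal.ofReal κ ^ n * V ≠ 0 := by
    refine mul_ne_zero (pow_ne_zero _ ?_) hV0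
    simpa using hκ0
  have hκt : ENNReal.ofReal κ ^ n * V ≠ ⊤ := ENNReal.mul_ne_top (by finiteness) hVt
  refine ⟨c1, ?_, ?_, fun f x hx => ?_⟩
  · refine mul_ne_zero ?_ (ENNReal.inv_ne_zero.2 hκt)
    simp; positivity
  · exact ENNReal.mul_ne_top ENNReal.ofReal_ne_top (ENNReal.inv_ne_top.2 hκe)
  obtain ⟨w, t, ht, hw⟩ := h f x hx
  set a := (AM Φ N f x).toReal with ha
  have hap : 0 < a := ENNReal.toReal_pos hx (AM_ne_top Φ N f x)
  have haA : AM Φ N f x = ENNReal.ofReal a := (ENNReal.ofReal_toReal (AM_ne_top Φ N f x)).symm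
  have h0 : 0 ≤ dist x w / t := by positivity
  refine ⟨dist x w + κ * t, by positivity, ?_⟩
  have hsub : Metric.closedBall w (κ * t) ⊆ Metric.closedBall x (dist x w + κ * t) := by
    apply Metric.closedBall_subset_closedBall'
    rw [dist_comm w x]; linarith
  have hlow : ∀ y ∈ Metric.closedBall w (κ * t), ENNReal.ofReal (a ^ ((n:ℝ)/N) * (1 + dist x w / t) ^ n / 4 ^ ((n:ℝ)/N)) ≤ radMax n Φ f y ^ ((n:ℝ)/N) := by
    intro y hy
    have h1 := hw y hy
    have h2 : ‖sc (dS t Φ) f y‖ₑ ≤ radMax n Φ f y := by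
      rw [radMax_eq]
      exact le_iSup_of_le t (le_iSup_of_le ht le_rfl)
    calc _ = ENNReal.ofReal (a / 4 * (1 + dist x w / t) ^ N) ^ ((n:ℝ)/N) := by
          rw [ENNReal.ofReal_rpow_of_pos (by positivity)]
          congr 1
          rw [Real.mul_rpow (by positivity) (by positivity), Real.div_rpow (by positivity) (by positivity), ← Real.rpow_natCast (_) N, ← Real.rpow_mul (by positivity), ← Real.rpow_natCast (_) n]
          rw [mul_div_cancel₀ _ hN'.ne']; ring
      _ ≤ ENNReal.ofReal (‖sc (dS t Φ) f y‖) ^ ((n:ℝ)/N) := by gcongr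
      _ ≤ _ := by rw [ofReal_norm_eq_enorm]; gcongr
  have hInteg : ENNReal.ofReal (a ^ ((n:ℝ)/N) * (1 + dist x w / t) ^ n / 4 ^ ((n:ℝ)/N)) * volume (Metric.closedBall w (κ * t)) ≤
      ∫⁻ y in Metric.closedBall x (dist x w + κ * t), radMax n Φ f y ^ ((n:ℝ)/N) := by
    rw [← setLIntegral_const]
    refine (setLIntegral_mono' measurableSet_closedBall hlow).trans ?_
    exact lintegral_mono_set hsub
  refine le_trans ?_ (mul_le_mul_right hInteg c1)
  have hvol : volume (Metric.closedBall w (κ * t)) = ENNReal.ofReal (κ * t) ^ n * V := by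
    rw [Measure.addHaar_closedBall' _ _ (by positivity)]
    simp [hV, ENNReal.ofReal_pow (by positivity : 0 ≤ κ * t)]
  rw [hvol, haA, ENNReal.ofReal_rpow_of_pos hap, ENNReal.ofReal_mul hκ0.le, mul_pow]
  calc ENNReal.ofReal (a ^ ((n:ℝ) / N)) * ENNReal.ofReal (dist x w + κ * t) ^ n ≤
      ENNReal.ofReal (a ^ ((n:ℝ) / N)) * ENNReal.ofReal ((1 + dist x w / t) * t) ^ n := by
        gcongr
        rw [add_mul, div_mul_cancel₀ _ ht.ne']; nlinarith
    _ = ENNReal.ofReal (4 ^ ((n:ℝ)/N)) * ENNReal.ofReal (a ^ ((n:ℝ)/N) * (1 + dist x w / t) ^ n / 4 ^ ((n:ℝ)/N)) * ENNReal.ofReal t ^ n := by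
        rw [← ENNReal.ofReal_mul (by positivity), ← ENNReal.ofReal_pow (by positivity), ← ENNReal.ofReal_pow (by positivity), ← ENNReal.ofReal_mul (by positivity), ← ENNReal.ofReal_mul (by positivity)]
        congr 1
        rw [mul_pow]
        have : (0:ℝ) < 4 ^ ((n:ℝ)/N) := by positivity
        generalize (1 + dist x w / t) = q
        field_simp
    _ = ENNReal.ofReal (4 ^ ((n:ℝ)/N)) * ENNReal.ofReal (a ^ ((n:ℝ)/N) * (1 + dist x w / t) ^ n / 4 ^ ((n:ℝ)/N)) * ENNReal.ofReal t ^ n * ((ENNReal.ofReal κ ^ n * V)⁻¹ * (ENNReal.ofReal κ ^ n * V)) := by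
        rw [ENNReal.inv_mul_cancel hκe hκt, mul_one]
    _ = _ := by rw [hc1]; ring
end

section
open MeasureTheory Real Set
open scoped ENNReal NNReal
variable {n : ℕ}

lemma vol_ball (x : En n) {r : ℝ} (hr : 0 < r) : volume (Metric.ball x r) = ENNReal.ofReal r ^ n * volume (Metric.ball (0 : En n) 1) := by
  rw [Measure.addHaar_ball_of_pos _ _ hr]
  simp [ENNReal.ofReal_pow hr.le]

lemma vol_cball (x : En n) {r : ℝ} (hr : 0 < r) : volume (Metric.closedBall x r) = ENNReal.ofReal r ^ n * volume (Metric.ball (0 : En n) 1) := by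
  rw [Measure.addHaar_closedBall _ _ hr.le]
  simp [ENNReal.ofReal_pow hr.le]

/-- the Hoelder consequence of `A_q` on open balls, case `q = 1` -/
lemma aq_one (ω : En n → ℝ≥0∞) (hm : Measurable ω)
    (hloc : ∀ (x : En n) (r : ℝ), 0 < r → (∫⁻ y in Metric.ball x r, ω y) < ⊤) (h1 : IsA1 n ω) :
    ∃ C : ℝ≥0∞, C ≠ ⊤ ∧ ∀ (x : En n) (R : ℝ), 0 < R → ∀ h : En n → ℝ≥0∞,
      (∫⁻ y in Metric.ball x R, h y) * (∫⁻ y in Metric.ball x R, ω y) ≤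
        C * volume (Metric.ball x R) * ∫⁻ y in Metric.ball x R, h y * ω y := by
  obtain ⟨C, hC, H⟩ := h1
  refine ⟨C, hC.ne, fun x R hR h => ?_⟩
  have hH := H x R hR
  unfold ballAvg at hH
  set a := ∫⁻ y in Metric.ball x R, ω y with ha
  set V := volume (Metric.ball x R) with hV
  have hV0 : V ≠ 0 := (Metric.measure_ball_pos volume x hR).ne'
  have hVt : V ≠ ⊤ := measure_ball_lt_top.ne
  set m := essSup (fun y => (ω y)⁻¹) (volume.restrict (Metric.ball x R)) with hm'
  by_cases ha0 : a = 0
  · simp [ha0]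
  have hmt : m ≠ ⊤ := by
    intro hmt
    rw [hmt, ENNReal.mul_top (mul_ne_zero (ENNReal.inv_ne_zero.2 hVt) ha0)] at hH
    exact absurd hH (not_le.2 hC)
  have hle : ∀ᵐ y ∂(volume.restrict (Metric.ball x R)), h y ≤ m * (h y * ω y) := by
    have e1 := ENNReal.ae_le_essSup (μ := volume.restrict (Metric.ball x R)) (fun y => (ω y)⁻¹)
    have e2 : ∀ᵐ y ∂(volume.restrict (Metric.ball x R)), ω y < ⊤ := ae_lt_top hm (hloc x R hR).ne
    filter_upwards [e1, e2] with y h1 h2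
    have h0 : ω y ≠ 0 := by
      intro h0; rw [h0] at h1; simp at h1; exact hmt h1
    calc h y = (ω y)⁻¹ * ω y * h y := by rw [ENNReal.inv_mul_cancel h0 h2.ne, one_mul]
      _ ≤ m * ω y * h y := by gcongr
      _ = _ := by ring
  calc (∫⁻ y in Metric.ball x R, h y) * a ≤ (∫⁻ y in Metric.ball x R, m * (h y * ω y)) * a := by
        gcongr ?_ * _; exact lintegral_mono_ae hle
    _ = m * (∫⁻ y in Metric.ball x R, (h y * ω y)) * a := by rw [lintegral_const_mul' _ _ hmt]
    _ = V * (V⁻¹ * a * m) * (∫⁻ y in Metric.ball x R, (h y * ω y)) := by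
        rw [← mul_assoc, ← mul_assoc, ENNReal.mul_inv_cancel hV0 hVt]; ring
    _ ≤ V * C * (∫⁻ y in Metric.ball x R, (h y * ω y)) := by gcongr
    _ = _ := by ring

lemma aq_gt (ω : En n → ℝ≥0∞) (hm : Measurable ω) (q : ℝ) (hq : 1 < q)
    (hloc : ∀ (x : En n) (r : ℝ), 0 < r → (∫⁻ y in Metric.ball x r, ω y) < ⊤) (h1 : IsApGT1 n q ω) :
    ∃ C : ℝ≥0∞, C ≠ ⊤ ∧ ∀ (x : En n) (R : ℝ), 0 < R → ∀ h : En n → ℝ≥0∞, Measurable h →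
      (∫⁻ y in Metric.ball x R, h y) ^ q * (∫⁻ y in Metric.ball x R, ω y) ≤
        C * volume (Metric.ball x R) ^ q * ∫⁻ y in Metric.ball x R, h y ^ q * ω y := by
  obtain ⟨C, hC, H⟩ := h1
  refine ⟨C, hC.ne, fun x R hR h hh => ?_⟩
  have hH := H x R hR
  unfold ballAvg at hH
  set a := ∫⁻ y in Metric.ball x R, ω y with ha
  set V := volume (Metric.ball x R) with hV
  have hV0 : V ≠ 0 := (Metric.measure_ball_pos volume x hR).ne'
  have hVt : V ≠ ⊤ := measure_ball_lt_top.ne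
  set b := ∫⁻ y in Metric.ball x R, ω y ^ (1/(1-q)) with hb
  have hq0 : 0 < q := by linarith
  have hq1 : 0 < q - 1 := by linarith
  by_cases ha0 : a = 0
  · simp [ha0]
  have hbt : b ≠ ⊤ := by
    intro hbt
    rw [hbt, ENNReal.mul_top (ENNReal.inv_ne_zero.2 hVt), ENNReal.top_rpow_of_pos hq1, ENNReal.mul_top (mul_ne_zero (ENNReal.inv_ne_zero.2 hVt) ha0)] at hH
    exact absurd hH (not_le.2 hC)
  have hae : ∀ᵐ y ∂(volume.restrict (Metric.ball x R)), h y = (h y * ω y ^ (1/q)) * (ω y ^ (-(1/q))) := by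
    have e1 : ∀ᵐ y ∂(volume.restrict (Metric.ball x R)), ω y ^ (1/(1-q)) < ⊤ := ae_lt_top (hm.pow_const _) hbt
    have e2 : ∀ᵐ y ∂(volume.restrict (Metric.ball x R)), ω y < ⊤ := ae_lt_top hm (hloc x R hR).ne
    filter_upwards [e1, e2] with y h1 h2
    have h0 : ω y ≠ 0 := by
      intro h0; rw [h0, ENNReal.zero_rpow_of_neg (div_neg_of_pos_of_neg one_pos (by linarith))] at h1
      exact lt_irrefl _ h1
    rw [mul_assoc, ← ENNReal.rpow_add _ _ h0 h2.ne]; simp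
  have hconj : q.HolderConjugate (q/(q-1)) := Real.HolderConjugate.conjExponent hq
  have hold := ENNReal.lintegral_mul_le_Lp_mul_Lq (volume.restrict (Metric.ball x R)) hconj
    (f := fun y => h y * ω y ^ (1/q)) (g := fun y => ω y ^ (-(1/q))) (hh.mul (hm.pow_const _)).aemeasurable (hm.pow_const _).aemeasurable
  have e3 : ∀ y, (h y * ω y ^ (1/q)) ^ q = h y ^ q * ω y := by
    intro y
    rw [ENNReal.mul_rpow_of_nonneg _ _ hq0.le, ← ENNReal.rpow_mul, one_div_mul_cancel hq0.ne', ENNReal.rpow_one]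
  have e4 : ∀ y, (ω y ^ (-(1/q))) ^ (q/(q-1)) = ω y ^ (1/(1-q)) := by
    intro y
    rw [← ENNReal.rpow_mul]; congr 1
    have : 1 - q ≠ 0 := by linarith
    field_simp; ring
  simp only [Pi.mul_apply, e3, e4] at hold
  have hI : (∫⁻ y in Metric.ball x R, h y) ^ q ≤ (∫⁻ y in Metric.ball x R, h y ^ q * ω y) * b ^ (q-1) := by
    rw [lintegral_congr_ae hae]
    refine (ENNReal.rpow_le_rpow hold hq0.le).trans_eq ?_
    rw [ENNReal.mul_rpow_of_nonneg _ _ hq0.le, ← ENNReal.rpow_mul, ← ENNReal.rpow_mul, one_div_mul_cancel hq0.ne', ENNReal.rpow_one]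
    congr 2
    field_simp
  calc (∫⁻ y in Metric.ball x R, h y) ^ q * a ≤ (∫⁻ y in Metric.ball x R, h y ^ q * ω y) * b ^ (q-1) * a := by gcongr
    _ = V ^ q * (V⁻¹ * a * (V⁻¹ * b) ^ (q-1)) * (∫⁻ y in Metric.ball x R, h y ^ q * ω y) := by
        have : V ^ q * V⁻¹ * V⁻¹ ^ (q-1) = 1 := by
          rw [← ENNReal.rpow_neg_one, ← ENNReal.rpow_mul, ← ENNReal.rpow_add _ _ hV0 hVt, ← ENNReal.rpow_add _ _ hV0 hVt]
          ring_nf; simp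
        rw [ENNReal.mul_rpow_of_nonneg _ _ hq1.le]
        calc _ = 1 * ((∫⁻ y in Metric.ball x R, h y ^ q * ω y) * b ^ (q-1) * a) := by rw [one_mul]
          _ = _ := by rw [← this]; ring
    _ ≤ V ^ q * C * (∫⁻ y in Metric.ball x R, h y ^ q * ω y) := by gcongr
    _ = _ := by ring

/-- Standing data about the weight: the Hoelder inequality on closed balls. -/
structure AQ (n : ℕ) (q : ℝ) (ω : En n → ℝ≥0∞) (C : ℝ) : Prop where
  hn : 1 ≤ n
  hq : 1 ≤ q
  hC : 0 < C
  meas : Measurable ω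
  fin : ∀ (x : En n) (r : ℝ), volume.withDensity ω (Metric.closedBall x r) < ⊤
  aq : ∀ (x : En n) (R : ℝ), 0 < R → ∀ h : En n → ℝ≥0∞, Measurable h →
      (∫⁻ y in Metric.closedBall x R, h y) ^ q * volume.withDensity ω (Metric.closedBall x R) ≤
        ENNReal.ofReal (C * R ^ (n * q)) * ∫⁻ y in Metric.closedBall x R, h y ^ q ∂(volume.withDensity ω)

lemma exists_AQ (hn : 1 ≤ n) (ω : En n → ℝ≥0∞) (hm : Measurable ω) (q : ℝ) (hq : 1 ≤ q)
    (hloc : ∀ (x : En n) (r : ℝ), 0 < r → (∫⁻ y in Metric.ball x r, ω y) < ⊤) (h1 : IsAp n q ω) :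
    ∃ C, AQ n q ω C := by
  have hq0 : 0 < q := by linarith
  have key : ∃ C : ℝ≥0∞, C ≠ ⊤ ∧ ∀ (x : En n) (R : ℝ), 0 < R → ∀ h : En n → ℝ≥0∞, Measurable h →
      (∫⁻ y in Metric.ball x R, h y) ^ q * (∫⁻ y in Metric.ball x R, ω y) ≤
        C * volume (Metric.ball x R) ^ q * ∫⁻ y in Metric.ball x R, h y ^ q * ω y := by
    by_cases h : q = 1
    · rw [IsAp, if_pos h] at h1
      obtain ⟨C, hC, H⟩ := aq_one ω hm hloc h1
      refine ⟨C, hC, fun x R hR g _ => ?_⟩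
      simpa [h] using H x R hR g
    · rw [IsAp, if_neg h] at h1
      exact aq_gt ω hm q (lt_of_le_of_ne hq (Ne.symm h)) hloc h1
  obtain ⟨C, hC, H⟩ := key
  set v := volume (Metric.ball (0 : En n) 1) with hv
  have hvt : v ≠ ⊤ := measure_ball_lt_top.ne
  set C' := (C * v ^ q).toReal * 2 ^ (n * q) + 1 with hC'
  have hfin : ∀ (x : En n) (r : ℝ), volume.withDensity ω (Metric.closedBall x r) < ⊤ := by
    intro x r
    have : Metric.closedBall x r ⊆ Metric.ball x (|r| + 1) := Metric.closedBall_subset_ball (by linarith [le_abs_self r])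
    refine (measure_mono this).trans_lt ?_
    rw [withDensity_apply _ measurableSet_ball]
    exact hloc x _ (by positivity)
  refine ⟨C', hn, hq, by positivity, hm, hfin, fun x R hR h hh => ?_⟩
  have hsub : Metric.closedBall x R ⊆ Metric.ball x (2 * R) := Metric.closedBall_subset_ball (by linarith)
  have h2 := H x (2 * R) (by linarith) ((Metric.closedBall x R).indicator h) (hh.indicator measurableSet_closedBall)
  have e1 : ∫⁻ y in Metric.ball x (2 * R), (Metric.closedBall x R).indicator h y = ∫⁻ y in Metric.closedBall x R, h y := by
    rw [setLIntegral_indicator measurableSet_closedBall, Set.inter_eq_left.2 hsub]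
  have e2 : ∫⁻ y in Metric.ball x (2 * R), (Metric.closedBall x R).indicator h y ^ q * ω y = ∫⁻ y in Metric.closedBall x R, h y ^ q ∂(volume.withDensity ω) := by
    rw [restrict_withDensity measurableSet_closedBall, lintegral_withDensity_eq_lintegral_mul _ hm (hh.pow_const _)]
    have : ∀ y, (Metric.closedBall x R).indicator h y ^ q * ω y = (Metric.closedBall x R).indicator (ω * fun y => h y ^ q) y := by
      intro y
      by_cases hy : y ∈ Metric.closedBall x R
      · simp [hy, mul_comm]
      · simp [hy, ENNReal.zero_rpow_of_pos hq0]
    simp only [this]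
    rw [setLIntegral_indicator measurableSet_closedBall, Set.inter_eq_left.2 hsub]
  rw [e1, e2] at h2
  calc _ ≤ (∫⁻ y in Metric.closedBall x R, h y) ^ q * (∫⁻ y in Metric.ball x (2 * R), ω y) := by
        gcongr
        rw [withDensity_apply _ measurableSet_closedBall]
        exact lintegral_mono_set hsub
    _ ≤ _ := h2
    _ ≤ _ := by
        gcongr
        rw [vol_ball x (by linarith : 0 < 2 * R), ENNReal.mul_rpow_of_nonneg _ _ hq0.le, mul_comm _ (v ^ q), ← mul_assoc, ← ENNReal.rpow_natCast, ← ENNReal.rpow_mul,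
          ENNReal.ofReal_rpow_of_pos (by positivity)]
        rw [← ENNReal.ofReal_toReal (a := C * v ^ q) (ENNReal.mul_ne_top hC (ENNReal.rpow_ne_top_of_nonneg hq0.le hvt)), ← ENNReal.ofReal_mul ENNReal.toReal_nonneg]
        apply ENNReal.ofReal_le_ofReal
        rw [Real.mul_rpow (by norm_num) hR.le, ← mul_assoc]
        gcongr
        linarith
end

section
open MeasureTheory Real Set
open scoped ENNReal NNReal
variable {n : ℕ}

def wm (ω : En n → ℝ≥0∞) (x : En n) (R : ℝ) : ℝ := (volume.withDensity ω (Metric.closedBall x R)).toReal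

lemma wm_nonneg (ω : En n → ℝ≥0∞) (x : En n) (R : ℝ) : 0 ≤ wm ω x R := ENNReal.toReal_nonneg

lemma AQ.ofReal_wm {q C : ℝ} {ω : En n → ℝ≥0∞} (H : AQ n q ω C) (x : En n) (R : ℝ) :
    ENNReal.ofReal (wm ω x R) = volume.withDensity ω (Metric.closedBall x R) :=
  ENNReal.ofReal_toReal (H.fin x R).ne

lemma AQ.wm_mono {q C : ℝ} {ω : En n → ℝ≥0∞} (H : AQ n q ω C) (x y : En n) {R τ : ℝ} (h : dist x y + τ ≤ R) :
    wm ω y τ ≤ wm ω x R := by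
  apply ENNReal.toReal_mono (H.fin x R).ne
  apply measure_mono
  apply Metric.closedBall_subset_closedBall'
  rw [dist_comm]; linarith

lemma AQ.W2 {q C : ℝ} {ω : En n → ℝ≥0∞} (H : AQ n q ω C) : ∃ D : ℝ, 1 ≤ D ∧ ∀ (x y : En n) (R τ : ℝ), 0 < τ →
    dist x y + τ ≤ R → wm ω x R ≤ D * (R / τ) ^ (n * q) * wm ω y τ := by
  set v := (volume (Metric.ball (0 : En n) 1)).toReal with hv
  have hv0 : 0 < v := ENNReal.toReal_pos (Metric.measure_ball_pos volume _ one_pos).ne' measure_ball_lt_top.ne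
  have hvE : volume (Metric.ball (0 : En n) 1) = ENNReal.ofReal v := (ENNReal.ofReal_toReal measure_ball_lt_top.ne).symm
  have hq0 : 0 < q := lt_of_lt_of_le one_pos H.hq
  have hC := H.hC
  refine ⟨max 1 (C / v ^ q), le_max_left _ _, fun x y R τ hτ hd => ?_⟩
  have hR : 0 < R := by have := dist_nonneg (x := x) (y := y); linarith
  have hsub : Metric.closedBall y τ ⊆ Metric.closedBall x R := by
    apply Metric.closedBall_subset_closedBall'
    rw [dist_comm]; linarith
  have h := H.aq x R hR ((Metric.closedBall y τ).indicator 1) (measurable_one.indicator measurableSet_closedBall)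
  have e1 : ∫⁻ z in Metric.closedBall x R, (Metric.closedBall y τ).indicator 1 z = ENNReal.ofReal (τ ^ n * v) := by
    rw [setLIntegral_indicator measurableSet_closedBall, Set.inter_eq_left.2 hsub]
    simp only [Pi.one_apply, setLIntegral_one]
    rw [vol_cball y hτ, hvE, ← ENNReal.ofReal_pow hτ.le, ← ENNReal.ofReal_mul (by positivity)]
  have e2 : ∫⁻ z in Metric.closedBall x R, (Metric.closedBall y τ).indicator (1 : En n → ℝ≥0∞) z ^ q ∂(volume.withDensity ω) = ENNReal.ofReal (wm ω y τ) := by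
    have : ∀ z, (Metric.closedBall y τ).indicator (1 : En n → ℝ≥0∞) z ^ q = (Metric.closedBall y τ).indicator (1 : En n → ℝ≥0∞) z := by
      intro z
      by_cases hz : z ∈ Metric.closedBall y τ
      · simp [hz]
      · simp [hz, hq0]
    simp only [this]
    rw [setLIntegral_indicator measurableSet_closedBall, Set.inter_eq_left.2 hsub]
    simp only [Pi.one_apply, setLIntegral_one]
    rw [H.ofReal_wm]
  rw [e1, e2, ← H.ofReal_wm, ENNReal.ofReal_rpow_of_pos (by positivity), ← ENNReal.ofReal_mul (by positivity), ← ENNReal.ofReal_mul (by positivity)] at h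
  rw [ENNReal.ofReal_le_ofReal_iff (mul_nonneg (by positivity) (wm_nonneg _ _ _))] at h
  rw [Real.mul_rpow (by positivity) hv0.le, ← Real.rpow_natCast, ← Real.rpow_mul hτ.le] at h
  have hm := wm_nonneg ω y τ
  calc wm ω x R ≤ (C / v ^ q) * (R / τ) ^ (n * q) * wm ω y τ := by
        rw [Real.div_rpow hR.le hτ.le]
        have : C / v ^ q * (R ^ (n * q) / τ ^ (n * q)) * wm ω y τ = (C * R ^ (n * q) * wm ω y τ) / (τ ^ (n * q) * v ^ q) := by
          field_simp
        rw [this, le_div_iff₀ (by positivity)]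
        linarith
    _ ≤ _ := by gcongr; exact le_max_right _ _

lemma geom_ind (ρ : ℝ) (h0 : 0 ≤ ρ) (h1 : ρ ≤ 1/2) (P : ℕ → Prop) [DecidablePred P] (k i0 : ℕ) (hP : ∀ i, P i → i0 ≤ i) :
    ∑ i ∈ Finset.range k, (if P i then ρ ^ i else 0) ≤ 2 * ρ ^ i0 := by
  calc ∑ i ∈ Finset.range k, (if P i then ρ ^ i else 0) ≤ ∑ i ∈ Finset.range k, (if i0 ≤ i then ρ ^ i else 0) := by
        refine Finset.sum_le_sum fun i _ => ?_
        by_cases h : P i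
        · simp [h, hP i h]
        · simp only [h, if_false]; split_ifs <;> positivity
    _ = ∑ i ∈ Finset.Ico i0 k, ρ ^ i := by
        rw [← Finset.sum_filter]; congr 1; ext i; simp; omega
    _ ≤ ρ ^ i0 / (1 - ρ) := geom_sum_Ico_le_of_lt_one h0 (by linarith)
    _ ≤ 2 * ρ ^ i0 := by
        rw [div_le_iff₀ (by linarith)]
        have : 0 ≤ ρ ^ i0 := by positivity
        nlinarith

/-- averaging step for self-improvement -/
lemma AQ.avg_step {q C : ℝ} {ω : En n → ℝ≥0∞} (H : AQ n q ω C) : ∃ D : ℝ, 0 < D ∧ ∀ (y : En n) (τ : ℝ), 0 < τ → ∀ k : ℕ,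
    ((k:ℝ) + 1) ^ q * wm ω y (3 ^ k * τ) ≤ D * (3 ^ k) ^ (n * q) * (((k:ℝ) + 1) * wm ω y τ) := by
  set v := (volume (Metric.ball (0 : En n) 1)).toReal with hv
  have hv0 : 0 < v := ENNReal.toReal_pos (Metric.measure_ball_pos volume _ one_pos).ne' measure_ball_lt_top.ne
  have hvE : volume (Metric.ball (0 : En n) 1) = ENNReal.ofReal v := (ENNReal.ofReal_toReal measure_ball_lt_top.ne).symm
  have hq0 : 0 < q := lt_of_lt_of_le one_pos H.hq
  have hC := H.hC
  obtain ⟨D, hD1, hD⟩ := H.W2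
  have hD0 : 0 < D := by linarith
  refine ⟨C * 2 ^ q * D / v ^ q, by positivity, fun y τ hτ k => ?_⟩
  classical
  set ρ : ℝ := (1/3)^n with hρ
  have hρ0 : 0 < ρ := by positivity
  have hρ1 : ρ ≤ 1/2 := by
    calc ρ ≤ (1/3)^1 := pow_le_pow_of_le_one (by norm_num) (by norm_num) H.hn
      _ ≤ 1/2 := by norm_num
  let B : ℕ → Set (En n) := fun i => Metric.closedBall y (3 ^ i * τ)
  have hBm : ∀ i, MeasurableSet (B i) := fun i => measurableSet_closedBall
  have hr : ∀ i : ℕ, 0 < 3 ^ i * τ := fun i => by positivity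
  have hBsub : ∀ i ∈ Finset.range (k+1), B i ⊆ B k := by
    intro i hi
    apply Metric.closedBall_subset_closedBall
    gcongr
    · norm_num
    · have := Finset.mem_range.1 hi; omega
  let h : En n → ℝ≥0∞ := fun z => ∑ i ∈ Finset.range (k+1), (B i).indicator (fun _ => ENNReal.ofReal (ρ ^ i)) z
  have hh : Measurable h := Finset.measurable_sum _ fun i _ => measurable_const.indicator (hBm i)
  have hAQ := H.aq y (3 ^ k * τ) (hr k) h hh
  have e1 : ∫⁻ z in B k, h z = ENNReal.ofReal (((k:ℝ)+1) * (τ ^ n * v)) := by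
    rw [lintegral_finsetSum _ fun i _ => measurable_const.indicator (hBm i)]
    have : ∀ i ∈ Finset.range (k+1), ∫⁻ z in B k, (B i).indicator (fun _ => ENNReal.ofReal (ρ ^ i)) z = ENNReal.ofReal (τ ^ n * v) := by
      intro i hi
      rw [setLIntegral_indicator (hBm i), Set.inter_eq_left.2 (hBsub i hi), setLIntegral_const]
      rw [vol_cball y (hr i), hvE, ← ENNReal.ofReal_pow (hr i).le, ← ENNReal.ofReal_mul (by positivity), ← ENNReal.ofReal_mul (by positivity)]
      congr 1
      rw [hρ, mul_pow, ← pow_mul, ← pow_mul, mul_comm i n, ← mul_assoc, ← mul_assoc, ← mul_pow]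
      norm_num
    rw [Finset.sum_congr rfl this, Finset.sum_const, Finset.card_range, nsmul_eq_mul, ← ENNReal.ofReal_natCast, ← ENNReal.ofReal_mul (by positivity)]
    congr 1; push_cast; ring
  have hpt : ∀ z, h z ^ q ≤ ∑ i ∈ Finset.range (k+1), (B i).indicator (fun _ => ENNReal.ofReal (2 ^ q * (ρ ^ i) ^ q)) z := by
    intro z
    have hz : h z = ENNReal.ofReal (∑ i ∈ Finset.range (k+1), (if z ∈ B i then ρ ^ i else 0)) := by
      rw [ENNReal.ofReal_sum_of_nonneg (fun i _ => by split_ifs <;> positivity)]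
      refine Finset.sum_congr rfl fun i _ => ?_
      by_cases hi : z ∈ B i <;> simp [hi]
    by_cases hex : ∃ i ∈ Finset.range (k+1), z ∈ B i
    · have hex' : ∃ i, i ∈ Finset.range (k+1) ∧ z ∈ B i := hex
      set i0 := Nat.find hex' with hi0
      have hspec := Nat.find_spec hex'
      have hmin : ∀ i, (z ∈ B i) → i0 ≤ i := by
        intro i hi
        by_contra hc
        push Not at hc
        have h1 := Finset.mem_range.1 hspec.1
        exact Nat.find_min hex' hc ⟨Finset.mem_range.2 (by omega), hi⟩
      have hg := geom_ind ρ hρ0.le hρ1 (fun i => z ∈ B i) (k+1) i0 hmin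
      have hle : h z ^ q ≤ ENNReal.ofReal (2 ^ q * (ρ ^ i0) ^ q) := by
        rw [← Real.mul_rpow (by norm_num) (by positivity), ← ENNReal.ofReal_rpow_of_pos (by positivity), hz]
        gcongr
      refine hle.trans ?_
      have := Finset.single_le_sum (f := fun i => (B i).indicator (fun _ => ENNReal.ofReal (2 ^ q * (ρ ^ i) ^ q)) z) (fun i _ => zero_le) hspec.1
      refine le_trans (le_of_eq ?_) this
      rw [Set.indicator_of_mem hspec.2]
    · have : h z = 0 := by
        apply Finset.sum_eq_zero
        intro i hi
        have : z ∉ B i := fun hc => hex ⟨i, hi, hc⟩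
        simp [this]
      rw [this, ENNReal.zero_rpow_of_pos hq0]; exact zero_le
  have e2 : ∫⁻ z in B k, h z ^ q ∂(volume.withDensity ω) ≤ ENNReal.ofReal (2 ^ q * D * (((k:ℝ)+1) * wm ω y τ)) := by
    refine (lintegral_mono hpt).trans ?_
    rw [lintegral_finsetSum _ fun i _ => measurable_const.indicator (hBm i)]
    have : ∀ i ∈ Finset.range (k+1), ∫⁻ z in B k, (B i).indicator (fun _ => ENNReal.ofReal (2 ^ q * (ρ ^ i) ^ q)) z ∂(volume.withDensity ω) ≤ ENNReal.ofReal (2 ^ q * D * wm ω y τ) := by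
      intro i hi
      rw [setLIntegral_indicator (hBm i), Set.inter_eq_left.2 (hBsub i hi), setLIntegral_const]
      change _ * volume.withDensity ω (Metric.closedBall y (3 ^ i * τ)) ≤ _
      rw [← H.ofReal_wm, ← ENNReal.ofReal_mul (by positivity)]
      apply ENNReal.ofReal_le_ofReal
      have h3 := hD y y (3 ^ i * τ) τ hτ (by
        rw [dist_self]
        have : (1:ℝ) ≤ 3 ^ i := one_le_pow₀ (by norm_num)
        nlinarith)
      rw [mul_div_cancel_right₀ _ hτ.ne'] at h3
      have h4 : (ρ ^ i) ^ q * (3 ^ i) ^ (n * q) = 1 := by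
        rw [Real.rpow_mul (by positivity), ← Real.mul_rpow (by positivity) (by positivity), Real.rpow_natCast, hρ, ← pow_mul, ← pow_mul, mul_comm i n, ← mul_pow]
        norm_num
      calc 2 ^ q * (ρ ^ i) ^ q * wm ω y (3 ^ i * τ) ≤ 2 ^ q * (ρ ^ i) ^ q * (D * (3 ^ i) ^ (n * q) * wm ω y τ) := by gcongr
        _ = 2 ^ q * ((ρ ^ i) ^ q * (3 ^ i) ^ (n * q)) * D * wm ω y τ := by ring
        _ = _ := by rw [h4]; ring
    refine (Finset.sum_le_sum this).trans_eq ?_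
    have hm := wm_nonneg ω y τ
    rw [Finset.sum_const, Finset.card_range, nsmul_eq_mul, ← ENNReal.ofReal_natCast, ← ENNReal.ofReal_mul (by positivity)]
    congr 1; push_cast; ring
  have hAQ2 := hAQ.trans (mul_le_mul_right e2 _)
  rw [e1, ← H.ofReal_wm, ENNReal.ofReal_rpow_of_pos (by positivity), ← ENNReal.ofReal_mul (by positivity), ← ENNReal.ofReal_mul (by positivity)] at hAQ2
  have hm := wm_nonneg ω y τ
  rw [ENNReal.ofReal_le_ofReal_iff (by positivity)] at hAQ2
  rw [Real.mul_rpow (by positivity) (by positivity), Real.mul_rpow (by positivity) hv0.le, Real.mul_rpow (by positivity) hτ.le, Real.rpow_mul hτ.le, Real.rpow_natCast] at hAQ2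
  have hτn : 0 < (τ ^ n) ^ q := by positivity
  have hvq : 0 < v ^ q := by positivity
  have e5 : C * 2 ^ q * D / v ^ q * (3 ^ k) ^ (n * q) * (((k:ℝ) + 1) * wm ω y τ) = (C * (3 ^ k) ^ (n * q) * (2 ^ q * D * (((k:ℝ)+1) * wm ω y τ))) / v ^ q := by
    field_simp
  rw [e5, le_div_iff₀ hvq]
  refine le_of_mul_le_mul_right ?_ hτn
  linarith

lemma AQ.W3 {q C : ℝ} {ω : En n → ℝ≥0∞} (H : AQ n q ω C) (hq1 : 1 < q) : ∃ K η : ℝ, 0 < K ∧ 0 < η ∧ ∀ (x y : En n) (R τ : ℝ), 0 < τ →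
    dist x y + τ ≤ R → wm ω x R ≤ K * (R / τ) ^ (n * q - η) * wm ω y τ := by
  obtain ⟨D, hD0, hD⟩ := H.avg_step
  obtain ⟨D2, hD21, hD2⟩ := H.W2
  have hlim : Filter.Tendsto (fun k : ℕ => D * ((k:ℝ) + 1) ^ (-(q - 1))) Filter.atTop (nhds (D * 0)) := by
    apply Filter.Tendsto.const_mul
    exact (tendsto_rpow_neg_atTop (by linarith)).comp (Filter.tendsto_atTop_add_const_right _ _ tendsto_natCast_atTop_atTop)
  rw [mul_zero] at hlim
  obtain ⟨k, hk1, hk⟩ := ((Filter.eventually_ge_atTop 1).and (hlim.eventually (gt_mem_nhds (show (0:ℝ) < 1/2 by norm_num)))).exists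
  set b : ℝ := 3 ^ k with hb
  have hb1 : 1 < b := one_lt_pow₀ (by norm_num) (by omega)
  have hb0 : 0 < b := by linarith
  have hstep : ∀ (y : En n) (τ : ℝ), 0 < τ → wm ω y (b * τ) ≤ b ^ (n * q) / 2 * wm ω y τ := by
    intro y τ hτ
    have h := hD y τ hτ k
    rw [← hb] at h
    have hk0 : (0:ℝ) < (k:ℝ) + 1 := by positivity
    have e : ((k:ℝ)+1) ^ q = ((k:ℝ)+1) * (((k:ℝ)+1) ^ (q-1)) := by
      rw [← Real.rpow_one_add' hk0.le (by linarith)]; congr 1; ring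
    rw [Real.rpow_neg hk0.le, ← div_eq_mul_inv, div_lt_iff₀ (by positivity)] at hk
    rw [e] at h
    have hm := wm_nonneg ω y τ
    have hm2 := wm_nonneg ω y (b * τ)
    set z := ((k:ℝ)+1) ^ (q-1)
    have hz : 0 < z := by positivity
    have hbq : 0 < b ^ (n * q) := by positivity
    have h' : z * wm ω y (b * τ) ≤ z * (b ^ (n * q) / 2 * wm ω y τ) := by
      have h2 : z * wm ω y (b * τ) ≤ D * b ^ (n * q) * wm ω y τ := by
        refine le_of_mul_le_mul_left ?_ hk0
        linarith
      have : D * (b ^ (n * q) * wm ω y τ) ≤ (1/2 * z) * (b ^ (n * q) * wm ω y τ) := by gcongr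
      linarith
    exact le_of_mul_le_mul_left h' hz
  have hiter : ∀ (y : En n) (τ : ℝ), 0 < τ → ∀ j : ℕ, wm ω y (b ^ j * τ) ≤ (b ^ (n * q) / 2) ^ j * wm ω y τ := by
    intro y τ hτ j
    induction j with
    | zero => simp
    | succ j ih =>
      rw [pow_succ', pow_succ', mul_assoc, mul_assoc]
      refine (hstep y _ (by positivity)).trans ?_
      gcongr
  set η := Real.log 2 / Real.log b with hη
  have hlb : 0 < Real.log b := Real.log_pos hb1
  have hη0 : 0 < η := div_pos (Real.log_pos (by norm_num)) hlb
  have hbη : b ^ η = 2 := by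
    rw [Real.rpow_def_of_pos hb0, hη, mul_div_cancel₀ _ hlb.ne', Real.exp_log (by norm_num)]
  have hbase : b ^ (n * q) / 2 = b ^ (n * q - η) := by rw [Real.rpow_sub hb0, hbη]
  set κ := n * q - η with hκ
  -- exponent nonneg is avoided: use max
  refine ⟨D2 * (2 * b) ^ (n * q) * (max 1 (b ^ (-κ))) , η, by positivity, hη0, fun x y R τ hτ hd => ?_⟩
  have hdn := dist_nonneg (x := x) (y := y)
  have hR : τ ≤ R := by linarith
  have hR0 : 0 < R := by linarith
  obtain ⟨j, hj1, hj2⟩ := exists_nat_pow_near ((one_le_div hτ).2 hR) hb1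
  rw [le_div_iff₀ hτ] at hj1
  rw [div_lt_iff₀ hτ] at hj2
  have h1 := hD2 x y (2 * R) (b ^ j * τ) (by positivity) (by linarith)
  have h0 : wm ω x R ≤ wm ω x (2 * R) := H.wm_mono x x (by rw [dist_self]; linarith)
  have h2 := hiter y τ hτ j
  have hsw : (b ^ κ) ^ j = (b ^ j) ^ κ := by
    rw [← Real.rpow_natCast, ← Real.rpow_mul hb0.le, mul_comm κ, Real.rpow_mul hb0.le, Real.rpow_natCast]
  rw [hbase, hsw] at h2
  have hm := wm_nonneg ω y τ
  have h3 : (2 * R / (b ^ j * τ)) ≤ 2 * b := by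
    rw [div_le_iff₀ (by positivity)]
    rw [pow_succ] at hj2
    nlinarith
  have h4 : (b ^ j) ^ κ ≤ max 1 (b ^ (-κ)) * (R / τ) ^ κ := by
    have hRτ : 0 < R / τ := by positivity
    have hbj : 0 < b ^ j := by positivity
    rcases le_total 0 κ with hκ0 | hκ0
    · calc (b ^ j) ^ κ ≤ (R / τ) ^ κ := Real.rpow_le_rpow hbj.le ((le_div_iff₀ hτ).2 hj1) hκ0
        _ ≤ _ := le_mul_of_one_le_left (by positivity) (le_max_left _ _)
    · calc (b ^ j) ^ κ = b ^ (-κ) * (b * b ^ j) ^ κ := by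
            rw [Real.mul_rpow hb0.le hbj.le, ← mul_assoc, ← Real.rpow_add hb0]; simp
        _ ≤ b ^ (-κ) * (R / τ) ^ κ := by
            gcongr ?_ * ?_
            apply Real.rpow_le_rpow_of_nonpos hRτ _ hκ0
            rw [← pow_succ']
            exact ((div_lt_iff₀ hτ).2 hj2).le
        _ ≤ _ := by gcongr; exact le_max_right _ _
  have hnq : 0 ≤ n * q := by have := H.hq; positivity
  calc wm ω x R ≤ D2 * (2 * R / (b ^ j * τ)) ^ (n * q) * wm ω y (b ^ j * τ) := h0.trans h1
    _ ≤ D2 * (2 * b) ^ (n * q) * ((b ^ j) ^ κ * wm ω y τ) := by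
        have : 0 ≤ D2 := by linarith
        have := wm_nonneg ω y (b ^ j * τ)
        gcongr
    _ ≤ D2 * (2 * b) ^ (n * q) * (max 1 (b ^ (-κ)) * (R / τ) ^ κ * wm ω y τ) := by
        have : 0 ≤ D2 := by linarith
        gcongr
    _ = _ := by ring
end

section
open MeasureTheory Real Set
open scoped ENNReal NNReal
variable {n : ℕ}

lemma cover_bdd (μ ν : Measure (En n)) (S : Set (En n)) (M : ℝ) (h : ∀ x ∈ S, ∃ R, 0 < R ∧ R ≤ M ∧
    μ (Metric.closedBall x (5 * R)) ≤ ν (Metric.closedBall x R)) : μ S ≤ ν univ := by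
  choose! r hr0 hrM hr using h
  obtain ⟨u, hut, hud, hcov⟩ := Vitali.exists_disjoint_subfamily_covering_enlargement_closedBall S id r M hrM 5 (by norm_num)
  simp only [id] at hud hcov
  have hcount : u.Countable := hud.countable_of_nonempty_interior fun i hi => by
    refine ⟨i, Metric.ball_subset_interior_closedBall ?_⟩
    exact Metric.mem_ball_self (hr0 i (hut hi))
  calc μ S ≤ μ (⋃ b ∈ u, Metric.closedBall b (5 * r b)) := by
        apply measure_mono
        intro a ha
        obtain ⟨b, hb, hab⟩ := hcov a ha
        exact Set.mem_biUnion hb (hab (Metric.mem_closedBall_self (hr0 a ha).le))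
    _ ≤ ∑' b : u, μ (Metric.closedBall b (5 * r b)) := measure_biUnion_le μ hcount _
    _ ≤ ∑' b : u, ν (Metric.closedBall b (r b)) := ENNReal.tsum_le_tsum fun b => hr b (hut b.2)
    _ = ν (⋃ b ∈ u, Metric.closedBall b (r b)) := (measure_biUnion hcount hud fun b _ => measurableSet_closedBall).symm
    _ ≤ ν univ := measure_mono (subset_univ _)

lemma cover_all (μ ν : Measure (En n)) (S : Set (En n)) (h : ∀ x ∈ S, ∃ R, 0 < R ∧
    μ (Metric.closedBall x (5 * R)) ≤ ν (Metric.closedBall x R)) : μ S ≤ ν univ := by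
  let T : ℕ → Set (En n) := fun m => {x ∈ S | ∃ R : ℝ, 0 < R ∧ R ≤ m ∧ μ (Metric.closedBall x (5 * R)) ≤ ν (Metric.closedBall x R)}
  have hT : S = ⋃ m, T m := by
    ext x
    simp only [mem_iUnion, T, mem_setOf_eq]
    constructor
    · intro hx
      obtain ⟨R, hR, hh⟩ := h x hx
      obtain ⟨m, hm⟩ := exists_nat_ge R
      exact ⟨m, hx, R, hR, hm, hh⟩
    · rintro ⟨m, hx, _⟩; exact hx
  have hmono : Monotone T := by
    intro i j hij x hx
    obtain ⟨hx, R, h1, h2, h3⟩ := hx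
    exact ⟨hx, R, h1, h2.trans (by exact_mod_cast hij), h3⟩
  rw [hT, hmono.directed_le.measure_iUnion]
  exact iSup_le fun m => cover_bdd μ ν (T m) m fun x hx => hx.2

/-- weighted weak (1,1) -/
lemma AQ.weak {q C : ℝ} {ω : En n → ℝ≥0∞} (H : AQ n q ω C) : ∃ K : ℝ, 0 < K ∧ ∀ (h : En n → ℝ≥0∞), Measurable h →
    ∀ (S : Set (En n)) (l : ℝ≥0∞), (∀ x ∈ S, ∃ R, 0 < R ∧ l * volume.withDensity ω (Metric.closedBall x R) ≤
      ∫⁻ y in Metric.closedBall x R, h y ∂(volume.withDensity ω)) →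
    l * volume.withDensity ω S ≤ ENNReal.ofReal K * ∫⁻ y, h y ∂(volume.withDensity ω) := by
  obtain ⟨D, hD1, hD⟩ := H.W2
  have hq := H.hq
  refine ⟨D * 5 ^ (n * q), by positivity, fun h hh S l hS => ?_⟩
  have := cover_all (l • volume.withDensity ω) (ENNReal.ofReal (D * 5 ^ (n * q)) • (volume.withDensity ω).withDensity h) S (by
    intro x hx
    obtain ⟨R, hR, hx⟩ := hS x hx
    refine ⟨R, hR, ?_⟩
    simp only [Measure.smul_apply, smul_eq_mul]
    have h1 := hD x x (5 * R) R hR (by rw [dist_self]; linarith)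
    rw [mul_div_cancel_right₀ _ hR.ne'] at h1
    rw [withDensity_apply h measurableSet_closedBall]
    calc l * volume.withDensity ω (Metric.closedBall x (5 * R)) ≤ l * (ENNReal.ofReal (D * 5 ^ (n * q)) * volume.withDensity ω (Metric.closedBall x R)) := by
          rw [← H.ofReal_wm, ← H.ofReal_wm, ← ENNReal.ofReal_mul (by positivity)]
          gcongr
      _ = ENNReal.ofReal (D * 5 ^ (n * q)) * (l * volume.withDensity ω (Metric.closedBall x R)) := by ring
      _ ≤ _ := by gcongr)
  simpa [withDensity_apply _ MeasurableSet.univ] using this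

lemma strong_of_weak (μ : Measure (En n)) (a b : En n → ℝ) (ha : Measurable a) (hb : Measurable b)
    (ha0 : ∀ x, 0 ≤ a x) (hb0 : ∀ x, 0 ≤ b x) (θ : ℝ) (hθ : 1 < θ) (K c : ℝ) (hK : 0 < K) (hc : 0 < c)
    (hw : ∀ t : ℝ, 0 < t → ENNReal.ofReal t * μ {x | t < a x} ≤ ENNReal.ofReal K * ∫⁻ x in {x | c * t < b x}, ENNReal.ofReal (b x) ∂μ) :
    ∫⁻ x, ENNReal.ofReal (a x ^ θ) ∂μ ≤ ENNReal.ofReal (θ * K / (θ - 1) * (c⁻¹) ^ (θ - 1)) * ∫⁻ x, ENNReal.ofReal (b x ^ θ) ∂μ := by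
  have hθ1 : 0 < θ - 1 := by linarith
  set ν := μ.withDensity (fun x => ENNReal.ofReal (b x)) with hν
  have hbE : Measurable fun x => ENNReal.ofReal (b x) := hb.ennreal_ofReal
  rw [lintegral_rpow_eq_lintegral_meas_lt_mul μ (Filter.Eventually.of_forall ha0) ha.aemeasurable (by linarith : 0 < θ)]
  have e1 := lintegral_rpow_eq_lintegral_meas_lt_mul ν (f := fun x => c⁻¹ * b x) (Filter.Eventually.of_forall fun x => mul_nonneg (by positivity) (hb0 x)) (hb.const_mul _).aemeasurable hθ1
  have e2 : ∫⁻ x, ENNReal.ofReal ((c⁻¹ * b x) ^ (θ - 1)) ∂ν = ENNReal.ofReal ((c⁻¹) ^ (θ - 1)) * ∫⁻ x, ENNReal.ofReal (b x ^ θ) ∂μ := by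
    rw [hν, lintegral_withDensity_eq_lintegral_mul _ hbE (by fun_prop), ← lintegral_const_mul _ (by fun_prop)]
    refine lintegral_congr fun x => ?_
    simp only [Pi.mul_apply]
    rw [← ENNReal.ofReal_mul (hb0 x), ← ENNReal.ofReal_mul (by positivity)]
    congr 1
    rw [Real.mul_rpow (by positivity) (hb0 x)]
    have : b x ^ θ = b x * b x ^ (θ - 1) := by
      rw [← Real.rpow_one_add' (hb0 x) (by linarith)]; congr 1; ring
    rw [this]; ring
  have e3 : ∫⁻ t in Ioi 0, μ {x | t < a x} * ENNReal.ofReal (t ^ (θ - 1)) ≤ ∫⁻ t in Ioi (0:ℝ), ENNReal.ofReal K * (ν {x | t < c⁻¹ * b x} * ENNReal.ofReal (t ^ (θ - 1 - 1))) := by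
    refine setLIntegral_mono' measurableSet_Ioi fun t (ht : 0 < t) => ?_
    have h1 := hw t ht
    have h2 : {x | c * t < b x} = {x | t < c⁻¹ * b x} := by
      ext x; simp only [mem_setOf_eq]
      rw [← div_eq_inv_mul, lt_div_iff₀ hc, mul_comm]
    have h3 : ∫⁻ x in {x | c * t < b x}, ENNReal.ofReal (b x) ∂μ = ν {x | t < c⁻¹ * b x} := by
      rw [hν, withDensity_apply _ (measurableSet_lt measurable_const (hb.const_mul _)), h2]
    rw [h3] at h1
    have h4 : t ^ (θ - 1) = t * t ^ (θ - 1 - 1) := by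
      rw [mul_comm, ← Real.rpow_add_one ht.ne']; congr 1; ring
    rw [h4, ENNReal.ofReal_mul ht.le]
    calc _ = (ENNReal.ofReal t * μ {x | t < a x}) * ENNReal.ofReal (t ^ (θ - 1 - 1)) := by ring
      _ ≤ (ENNReal.ofReal K * ν {x | t < c⁻¹ * b x}) * ENNReal.ofReal (t ^ (θ - 1 - 1)) := by gcongr
      _ = _ := by ring
  calc _ ≤ ENNReal.ofReal θ * ∫⁻ t in Ioi (0:ℝ), ENNReal.ofReal K * (ν {x | t < c⁻¹ * b x} * ENNReal.ofReal (t ^ (θ - 1 - 1))) := by gcongr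
    _ = ENNReal.ofReal θ * ENNReal.ofReal K * ∫⁻ t in Ioi (0:ℝ), (ν {x | t < c⁻¹ * b x} * ENNReal.ofReal (t ^ (θ - 1 - 1))) := by
        rw [lintegral_const_mul' _ _ ENNReal.ofReal_ne_top, mul_assoc]
    _ = ENNReal.ofReal θ * ENNReal.ofReal K * ENNReal.ofReal (θ - 1)⁻¹ * (ENNReal.ofReal (θ - 1) * ∫⁻ t in Ioi (0:ℝ), (ν {x | t < c⁻¹ * b x} * ENNReal.ofReal (t ^ (θ - 1 - 1)))) := by
        rw [← mul_assoc, mul_assoc _ (ENNReal.ofReal (θ - 1)⁻¹), ← ENNReal.ofReal_mul (p := (θ-1)⁻¹) (by positivity), inv_mul_cancel₀ hθ1.ne']; simp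
    _ = _ := by
        rw [← e1, e2, ← mul_assoc, ← ENNReal.ofReal_mul (by positivity), ← ENNReal.ofReal_mul (by positivity), ← ENNReal.ofReal_mul (by positivity)]
        congr 2

lemma radMax_ne_top (Φ f : Sw n) (x : En n) : radMax n Φ f x ≠ ⊤ := by
  obtain ⟨M, hM, h⟩ := sc_bdd Φ f
  rw [radMax_eq]
  refine ne_top_of_le_ne_top (ENNReal.ofReal_ne_top (r := M)) (iSup_le fun t => iSup_le fun ht => ?_)
  rw [← ofReal_norm_eq_enorm]
  exact ENNReal.ofReal_le_ofReal (h t ht x)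

/-- the nontangential-type maximal function is controlled in weighted `L^p` -/
lemma AM_strong {q C : ℝ} {ω : En n → ℝ≥0∞} (H : AQ n q ω C) (Φ : Sw n) (hΦ : (∫ x, Φ x) ≠ 0) (N : ℕ) (hN : 1 ≤ N)
    (p : ℝ) (hpN : n * q < p * N) : ∃ K : ℝ, 0 < K ∧ ∀ f : Sw n,
    ∫⁻ x, AM Φ N f x ^ p ∂(volume.withDensity ω) ≤ ENNReal.ofReal K * ∫⁻ x, radMax n Φ f x ^ p ∂(volume.withDensity ω) := by
  obtain ⟨c, hc0, hct, hmax⟩ := AM_max H.hn Φ hΦ N hN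
  obtain ⟨Kw, hKw, hweak⟩ := H.weak
  have hq := H.hq
  have hq0 : 0 < q := by linarith
  have hC := H.hC
  have hnN : 0 < (n:ℝ) / N := by
    have : (0:ℝ) < n := by exact_mod_cast H.hn
    have : (0:ℝ) < N := by exact_mod_cast hN
    positivity
  have hN0 : (0:ℝ) < N := by exact_mod_cast hN
  have hn0 : (0:ℝ) < n := by exact_mod_cast H.hn
  set e := (n:ℝ) / N * q with he
  have he0 : 0 < e := by positivity
  have hθ : 1 < p / e := by
    rw [one_lt_div he0, he, div_mul_eq_mul_div, div_lt_iff₀ hN0]; exact hpN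
  have hp0 : 0 < p := by
    have := hθ; by_contra h; push Not at h
    have : p / e ≤ 0 := div_nonpos_of_nonpos_of_nonneg h he0.le
    linarith
  set K1 := (c ^ q).toReal * C with hK1
  have hcq : c ^ q ≠ ⊤ := ENNReal.rpow_ne_top_of_nonneg hq0.le hct
  have hcq0 : 0 < (c ^ q).toReal := ENNReal.toReal_pos (ENNReal.rpow_pos (pos_iff_ne_zero.2 hc0) hct).ne' hcq
  have hK10 : 0 < K1 := by positivity
  set c1 := (2 * K1)⁻¹ with hc1
  have hc10 : 0 < c1 := by positivity
  refine ⟨(p / e) * (2 * K1 * Kw) / (p / e - 1) * (c1⁻¹) ^ (p / e - 1), ?_, fun f => ?_⟩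
  rotate_left
  · set μ := volume.withDensity ω with hμ
    set A := AM Φ N f with hA
    set g := radMax n Φ f with hg
    have hAm : Measurable A := (AM_lsc Φ N f).measurable
    have hgm : Measurable g := (radMax_lsc Φ f).measurable
    have hAt : ∀ x, A x ≠ ⊤ := AM_ne_top Φ N f
    have hgA : ∀ x, g x ≠ ⊤ := fun x => radMax_ne_top Φ f x
    have conv : ∀ (F : En n → ℝ≥0∞) (hF : ∀ x, F x ≠ ⊤) x, F x ^ p = ENNReal.ofReal (((F x).toReal ^ e) ^ (p / e)) := by
      intro F hF x
      rw [← Real.rpow_mul ENNReal.toReal_nonneg, mul_div_cancel₀ _ he0.ne', ← ENNReal.ofReal_rpow_of_nonneg ENNReal.toReal_nonneg hp0.le, ENNReal.ofReal_toReal (hF x)]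
    have conv2 : ∀ (F : En n → ℝ≥0∞) (hF : ∀ x, F x ≠ ⊤) x, ENNReal.ofReal ((F x).toReal ^ e) = F x ^ e := by
      intro F hF x
      rw [← ENNReal.ofReal_rpow_of_nonneg ENNReal.toReal_nonneg he0.le, ENNReal.ofReal_toReal (hF x)]
    simp only [conv A hAt, conv g hgA]
    refine strong_of_weak μ (fun x => (A x).toReal ^ e) (fun x => (g x).toReal ^ e) (by fun_prop) (by fun_prop)
      (fun x => by positivity) (fun x => by positivity) (p / e) hθ (2 * K1 * Kw) c1 (by positivity) hc10 fun t ht => ?_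
    have hmeasS : MeasurableSet {x | c1 * t < (g x).toReal ^ e} := measurableSet_lt measurable_const (by fun_prop)
    let h : En n → ℝ≥0∞ := {x | c1 * t < (g x).toReal ^ e}.indicator (fun x => ENNReal.ofReal (2 * K1) * ENNReal.ofReal ((g x).toReal ^ e))
    have hhm : Measurable h := Measurable.indicator (by fun_prop) hmeasS
    have hw := hweak h hhm {x | t < (A x).toReal ^ e} (ENNReal.ofReal t) (by
      intro x hx
      have hx' : ENNReal.ofReal t ≤ A x ^ e := by
        rw [← conv2 A hAt]; exact ENNReal.ofReal_le_ofReal (le_of_lt hx)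
      have hA0 : A x ≠ 0 := by
        intro h0
        have : t < 0 := by simpa [h0, Real.zero_rpow he0.ne'] using hx
        linarith
      obtain ⟨R, hR, hbd⟩ := hmax f x hA0
      refine ⟨R, hR, ?_⟩
      have haq := H.aq x R hR (fun y => g y ^ ((n:ℝ)/N)) (by fun_prop)
      set B := Metric.closedBall x R
      have e1 : ∀ y, (g y ^ ((n:ℝ)/N)) ^ q = g y ^ e := fun y => by rw [← ENNReal.rpow_mul]
      simp only [e1] at haq
      have h1 := ENNReal.rpow_le_rpow hbd hq0.le
      rw [ENNReal.mul_rpow_of_nonneg _ _ hq0.le, ENNReal.mul_rpow_of_nonneg _ _ hq0.le, ← ENNReal.rpow_mul, ← ENNReal.rpow_natCast, ← ENNReal.rpow_mul, ENNReal.ofReal_rpow_of_pos hR] at h1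
      have h2 : A x ^ e * μ B ≤ ENNReal.ofReal K1 * ∫⁻ y in B, g y ^ e ∂μ := by
        have hRp : 0 < R ^ (n * q) := by positivity
        have hne : ENNReal.ofReal (R ^ (n * q)) ≠ 0 := by simpa using hRp
        refine (ENNReal.mul_le_mul_iff_right hne ENNReal.ofReal_ne_top).1 ?_
        calc ENNReal.ofReal (R ^ (n * q)) * (A x ^ e * μ B) = (A x ^ e * ENNReal.ofReal (R ^ (n * q))) * μ B := by ring
          _ ≤ c ^ q * (∫⁻ y in B, g y ^ ((n:ℝ)/N)) ^ q * μ B := by gcongr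
          _ = c ^ q * ((∫⁻ y in B, g y ^ ((n:ℝ)/N)) ^ q * μ B) := by ring
          _ ≤ c ^ q * (ENNReal.ofReal (C * R ^ (n * q)) * ∫⁻ y in B, g y ^ e ∂μ) := by gcongr
          _ = _ := by
            rw [hK1, ENNReal.ofReal_mul hC.le, ENNReal.ofReal_mul ENNReal.toReal_nonneg, ENNReal.ofReal_toReal hcq]; ring
      have h3 : ∀ y, ENNReal.ofReal (2 * K1) * g y ^ e ≤ h y + ENNReal.ofReal t := by
        intro y
        by_cases hy : c1 * t < (g y).toReal ^ e
        · simp only [h]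
          rw [Set.indicator_of_mem (by exact hy), conv2 g hgA]
          exact le_self_add
        · rw [← conv2 g hgA, ← ENNReal.ofReal_mul (by positivity)]
          refine le_trans (ENNReal.ofReal_le_ofReal ?_) le_add_self
          push Not at hy
          calc 2 * K1 * (g y).toReal ^ e ≤ 2 * K1 * (c1 * t) := by gcongr
            _ = t := by rw [hc1]; field_simp
      have h4 : ENNReal.ofReal (2 * K1) * ∫⁻ y in B, g y ^ e ∂μ ≤ (∫⁻ y in B, h y ∂μ) + ENNReal.ofReal t * μ B := by
        rw [← lintegral_const_mul' _ _ ENNReal.ofReal_ne_top, ← setLIntegral_const, ← lintegral_add_left hhm]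
        exact lintegral_mono h3
      have h5 : ENNReal.ofReal t * μ B + ENNReal.ofReal t * μ B ≤ (∫⁻ y in B, h y ∂μ) + ENNReal.ofReal t * μ B := by
        refine le_trans ?_ h4
        rw [ENNReal.ofReal_mul (by norm_num), mul_assoc]
        calc _ = ENNReal.ofReal 2 * (ENNReal.ofReal t * μ B) := by simp [two_mul]
          _ ≤ ENNReal.ofReal 2 * (A x ^ e * μ B) := by gcongr
          _ ≤ _ := by gcongr
      exact (ENNReal.add_le_add_iff_right (ENNReal.mul_ne_top ENNReal.ofReal_ne_top (H.fin x R).ne)).1 h5)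
    refine hw.trans_eq ?_
    simp only [h]
    rw [lintegral_indicator hmeasS, lintegral_const_mul _ (by fun_prop), ← mul_assoc, ← ENNReal.ofReal_mul hKw.le]
    congr 2; ring
  · have : 0 < p / e - 1 := by linarith
    positivity
end

section
open MeasureTheory Real Set
open scoped ENNReal NNReal
open scoped FourierTransform LineDeriv
variable {n : ℕ}

lemma brKernel_integrable (hn : 1 ≤ n) (δ : ℝ) (hδ : ((n : ℝ) - 1) / 2 < δ) : Integrable (brKernel n δ) := by
  have hn1 : (1:ℝ) ≤ n := by exact_mod_cast hn
  have hδ0 : 0 < δ := by linarith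
  obtain ⟨C, hC, h⟩ := brKernel_decay n hn δ hδ0
  have hi := (integrable_one_add_norm (E := En n) (μ := volume) (r := ((n:ℝ)+1)/2 + δ) (by simp; linarith)).const_mul C
  exact hi.mono' (brKernel_cont n δ hδ0).aestronglyMeasurable (Filter.Eventually.of_forall h)

lemma dil_integrable {t : ℝ} (ht : 0 < t) {g : En n → ℂ} (hg : Integrable g) : Integrable (fun x => (t ^ n)⁻¹ • g (t⁻¹ • x)) :=
  Integrable.smul ((t ^ n)⁻¹ : ℝ) (hg.comp_smul (inv_ne_zero ht.ne'))

lemma conv_swap (hn : 1 ≤ n) (δ : ℝ) (hδ : ((n : ℝ) - 1) / 2 < δ) (Φ f : Sw n) {ε t : ℝ} (hε : 0 < ε) (ht : 0 < t) (x : En n) :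
    ∫ y, (t ^ n)⁻¹ • Φ (t⁻¹ • (x - y)) * brMeans n δ ε f y = ∫ y, brKernelDil n δ ε (x - y) * sc (dS t Φ) f y := by
  have hi := dil_integrable hε (brKernel_integrable hn δ hδ)
  have hi' : Integrable (brKernelDil n δ ε) := hi
  have hΦ : Integrable (fun y => dS t Φ (x - y)) := ((dS t Φ).integrable (μ := volume)).comp_sub_left x
  have hprod : Integrable (fun z : En n × En n => dS t Φ (x - z.1) * brKernelDil n δ ε z.2 * f (z.1 - z.2)) (volume.prod volume) := by
    have h1 := hΦ.mul_prod hi'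
    refine h1.mul_bdd (c := SchwartzMap.seminorm ℝ 0 0 f) ?_ ?_
    · exact (f.continuous.comp (continuous_fst.sub continuous_snd)).aestronglyMeasurable
    · exact Filter.Eventually.of_forall fun z => SchwartzMap.norm_le_seminorm ℝ f _
  have e1 : ∀ y, brMeans n δ ε f y = ∫ z, brKernelDil n δ ε z * f (y - z) := by
    intro y
    unfold brMeans
    rw [← integral_sub_left_eq_self _ volume y]
    refine integral_congr_ae (Filter.Eventually.of_forall fun z => ?_)
    simp [mul_comm]
  calc _ = ∫ y, ∫ z, dS t Φ (x - y) * brKernelDil n δ ε z * f (y - z) := by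
        refine integral_congr_ae (Filter.Eventually.of_forall fun y => ?_)
        simp only [e1, dS_apply ht, mul_assoc]
        rw [← integral_const_mul]
    _ = ∫ z, ∫ y, dS t Φ (x - y) * brKernelDil n δ ε z * f (y - z) := integral_integral_swap hprod
    _ = ∫ z, brKernelDil n δ ε z * sc (dS t Φ) f (x - z) := by
        refine integral_congr_ae (Filter.Eventually.of_forall fun z => ?_)
        simp only
        rw [sc_apply, ← integral_const_mul, ← integral_sub_right_eq_self (fun y => brKernelDil n δ ε z * (dS t Φ (x - z - y) * f y)) z]
        refine integral_congr_ae (Filter.Eventually.of_forall fun y => ?_)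
        simp only [sub_sub_sub_cancel_right]
        ring
    _ = _ := by
        rw [← integral_sub_left_eq_self _ volume x]
        simp

lemma u_lemma (hn : 1 ≤ n) (δ : ℝ) (hδ : ((n : ℝ) - 1) / 2 < δ) (Φ : Sw n) (hΦ : (∫ x, Φ x) ≠ 0) (N : ℕ) :
    ∃ C : ℝ, 0 < C ∧ ∀ (f : Sw n) (ε t : ℝ), 0 < ε → 0 < t → ∃ u : En n → ℝ≥0∞, Measurable u ∧
      (∀ y w, dist y w ≤ max t ε → u y ≤ ENNReal.ofReal C * AM Φ N f w) ∧
      ∀ x, ‖∫ y, (t ^ n)⁻¹ • Φ (t⁻¹ • (x - y)) * brMeans n δ ε f y‖ₑ ≤ ENNReal.ofReal C * AM Φ N f x +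
        ENNReal.ofReal C * ∫⁻ y in {y | max t ε ≤ dist x y},
          ENNReal.ofReal ((max t ε) ^ ((((n:ℝ)+1)/2 + δ) - n) * (dist x y) ^ (-(((n:ℝ)+1)/2 + δ))) * u y := by
  have hn1 : (1:ℝ) ≤ n := by exact_mod_cast hn
  have hδ0 : 0 < δ := by linarith
  set s := ((n:ℝ)+1)/2 + δ with hs
  have hsn : (n:ℝ) < s := by rw [hs]; linarith
  obtain ⟨Ck, hCk, hk⟩ := brKernel_decay n hn δ hδ0
  rw [← hs] at hk
  obtain ⟨Ψ, hΨ, -, -⟩ := exists_hat_bump (n := n) 1 2 one_pos (by norm_num)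
  obtain ⟨CF, hCF, hF⟩ := AM_FS Φ hΦ N Ψ
  set C1 := 2 ^ N * (1 + cK N Φ * CF) with hC1
  have hcK := cK_nonneg N Φ
  have hC1pos : 0 < C1 := by positivity
  set I := ∫ z, ‖brKernel n δ z‖ with hI
  have hI0 : 0 ≤ I := integral_nonneg fun z => norm_nonneg _
  refine ⟨C1 + C1 * I + Ck, by positivity, fun f ε t hε ht => ?_⟩
  set τ := max t ε with hτ
  have hτ0 : 0 < τ := lt_max_of_lt_left ht
  -- choose f'
  have key : ∃ f' : Sw n, brMeans n δ ε f' = brMeans n δ ε f ∧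
      ∀ y w, dist y w ≤ τ → ‖sc (dS t Φ) f' y‖ ≤ C1 * (AM Φ N f w).toReal := by
    rcases le_total t ε with hte | hte
    · refine ⟨sc (dS ε Ψ) f, brMeans_band δ hδ0 hε Ψ f hΨ, fun y w hyw => ?_⟩
      have h1 := conv_bound N Φ (sc (dS ε Ψ) f) w y (B := CF * (AM Φ N f w).toReal) ht hte (by positivity) (fun z => hF f w z ε hε)
      rw [hτ, max_eq_right hte] at hyw
      have h2 : dist w y / ε ≤ 1 := by rw [dist_comm, div_le_one hε]; exact hyw
      calc _ ≤ _ := h1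
        _ ≤ cK N Φ * (CF * (AM Φ N f w).toReal) * 2 ^ N := by
            gcongr; linarith
        _ ≤ C1 * (AM Φ N f w).toReal := by
            rw [hC1]
            have : 0 ≤ 2 ^ N * (AM Φ N f w).toReal := by positivity
            nlinarith
    · refine ⟨f, rfl, fun y w hyw => ?_⟩
      have h1 := AM_spec Φ N f w y ht
      rw [hτ, max_eq_left hte] at hyw
      have h2 : dist w y / t ≤ 1 := by rw [dist_comm, div_le_one ht]; exact hyw
      calc _ ≤ _ := h1
        _ ≤ (AM Φ N f w).toReal * 2 ^ N := by
            gcongr; linarith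
        _ ≤ C1 * (AM Φ N f w).toReal := by
            rw [hC1]
            have : 0 ≤ 2 ^ N * (cK N Φ * CF) * (AM Φ N f w).toReal := by positivity
            nlinarith
  obtain ⟨f', hf', hb⟩ := key
  have hbE : ∀ y w, dist y w ≤ τ → ‖sc (dS t Φ) f' y‖ₑ ≤ ENNReal.ofReal C1 * AM Φ N f w := by
    intro y w hyw
    rw [← ofReal_norm_eq_enorm, ← ENNReal.ofReal_toReal (AM_ne_top Φ N f w), ← ENNReal.ofReal_mul hC1pos.le]
    exact ENNReal.ofReal_le_ofReal (hb y w hyw)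
  refine ⟨fun y => ‖sc (dS t Φ) f' y‖ₑ, (sc (dS t Φ) f').continuous.enorm.measurable, fun y w hyw => ?_, fun x => ?_⟩
  · refine (hbE y w hyw).trans ?_
    gcongr
    have : 0 ≤ C1 * I := by positivity
    linarith
  rw [← hf', conv_swap hn δ hδ Φ f' hε ht]
  refine (enorm_integral_le_lintegral_enorm _).trans ?_
  have hms : MeasurableSet {y : En n | τ ≤ dist x y} := measurableSet_le measurable_const (by fun_prop)
  rw [← lintegral_add_compl _ hms, add_comm]
  have hCI : 0 ≤ C1 * I := by positivity
  gcongr ?_ + ?_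
  · calc ∫⁻ y in {y : En n | τ ≤ dist x y}ᶜ, ‖brKernelDil n δ ε (x - y) * sc (dS t Φ) f' y‖ₑ
        ≤ ∫⁻ y in {y : En n | τ ≤ dist x y}ᶜ, ‖brKernelDil n δ ε (x - y)‖ₑ * (ENNReal.ofReal C1 * AM Φ N f x) := by
          refine setLIntegral_mono' hms.compl fun y hy => ?_
          rw [enorm_mul]
          gcongr
          apply hbE
          simp only [mem_compl_iff, mem_setOf_eq, not_le] at hy
          rw [dist_comm]; exact hy.le
      _ ≤ ∫⁻ y, ‖brKernelDil n δ ε (x - y)‖ₑ * (ENNReal.ofReal C1 * AM Φ N f x) := setLIntegral_le_lintegral _ _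
      _ = (∫⁻ y, ‖brKernelDil n δ ε (x - y)‖ₑ) * (ENNReal.ofReal C1 * AM Φ N f x) := lintegral_mul_const' _ _ (ENNReal.mul_ne_top ENNReal.ofReal_ne_top (AM_ne_top Φ N f x))
      _ = ENNReal.ofReal I * (ENNReal.ofReal C1 * AM Φ N f x) := by
          congr 1
          rw [lintegral_sub_left_eq_self (fun y => ‖brKernelDil n δ ε y‖ₑ) x]
          have hi : Integrable (brKernelDil n δ ε) := dil_integrable hε (brKernel_integrable hn δ hδ)
          rw [← ofReal_integral_norm_eq_lintegral_enorm hi, hI, ← integral_dil hε (fun z => ‖brKernel n δ z‖)]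
          congr 2; ext z
          unfold brKernelDil
          rw [norm_smul, Real.norm_of_nonneg (by positivity), smul_eq_mul]
      _ ≤ _ := by
          rw [← mul_assoc, ← ENNReal.ofReal_mul hI0]
          gcongr
          linarith
  · rw [← lintegral_const_mul' _ _ ENNReal.ofReal_ne_top]
    refine setLIntegral_mono' hms fun y hy => ?_
    simp only [mem_setOf_eq] at hy
    rw [enorm_mul, ← mul_assoc]
    gcongr
    have hd0 : 0 < dist x y := by linarith
    rw [← ofReal_norm_eq_enorm, ← ENNReal.ofReal_mul (by positivity)]
    apply ENNReal.ofReal_le_ofReal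
    unfold brKernelDil
    rw [norm_smul, Real.norm_of_nonneg (by positivity)]
    have hdist : ‖ε⁻¹ • (x - y)‖ = ε⁻¹ * dist x y := by
      rw [norm_smul, dist_eq_norm, Real.norm_of_nonneg (by positivity)]
    have h1 := hk (ε⁻¹ • (x - y))
    rw [hdist] at h1
    have hpow : (1 + ε⁻¹ * dist x y) ^ (-s) ≤ (ε⁻¹ * dist x y) ^ (-s) :=
      Real.rpow_le_rpow_of_nonpos (by positivity) (by linarith) (by linarith)
    rw [Real.mul_rpow (by positivity) hd0.le] at hpow
    have h3 : (ε ^ n)⁻¹ * (ε⁻¹) ^ (-s) = ε ^ (s - n) := by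
      rw [Real.inv_rpow hε.le, Real.rpow_neg hε.le, inv_inv, Real.rpow_sub hε, Real.rpow_natCast]
      field_simp
    have h4 : ε ^ (s - n) ≤ τ ^ (s - n) := Real.rpow_le_rpow hε.le (le_max_right _ _) (by linarith)
    calc (ε ^ n)⁻¹ * ‖brKernel n δ (ε⁻¹ • (x - y))‖ ≤ (ε ^ n)⁻¹ * (Ck * ((ε⁻¹) ^ (-s) * dist x y ^ (-s))) := by
          gcongr
          exact h1.trans (by gcongr)
      _ = Ck * (((ε ^ n)⁻¹ * (ε⁻¹) ^ (-s)) * dist x y ^ (-s)) := by ring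
      _ ≤ (C1 + C1 * I + Ck) * (τ ^ (s - n) * dist x y ^ (-s)) := by
          rw [h3]
          gcongr
          linarith
end

section
open MeasureTheory Real Set
open scoped ENNReal NNReal
variable {n : ℕ}

/-- dyadic tail estimate -/
lemma tail_bound (ν : Measure (En n)) (x : En n) {L s b M : ℝ} (hL : 0 < L) (hs : 0 < s) (hbs : b < s) (hM : 0 ≤ M)
    (h : ∀ j : ℕ, ν (Metric.closedBall x (2 ^ (j + 1) * L)) ≤ ENNReal.ofReal (M * (2 ^ j) ^ b)) :
    ∫⁻ y in {y | L ≤ dist x y}, ENNReal.ofReal (dist x y ^ (-s)) ∂ν ≤ ENNReal.ofReal (M * L ^ (-s) * (1 - 2 ^ (b - s))⁻¹) := by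
  let T : ℕ → Set (En n) := fun j => {y | 2 ^ j * L ≤ dist x y ∧ dist x y ≤ 2 ^ (j+1) * L}
  have hTm : ∀ j, MeasurableSet (T j) := by
    intro j
    have h1 : MeasurableSet {y : En n | 2 ^ j * L ≤ dist x y} := measurableSet_le measurable_const (by fun_prop)
    have h2 : MeasurableSet {y : En n | dist x y ≤ 2 ^ (j+1) * L} := measurableSet_le (by fun_prop) measurable_const
    exact h1.inter h2
  have hsub : {y | L ≤ dist x y} ⊆ ⋃ j, T j := by
    intro y hy
    simp only [mem_setOf_eq] at hy
    obtain ⟨j, hj1, hj2⟩ := exists_nat_pow_near ((one_le_div hL).2 hy) (by norm_num : (1:ℝ) < 2)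
    rw [le_div_iff₀ hL] at hj1
    rw [div_lt_iff₀ hL] at hj2
    exact mem_iUnion.2 ⟨j, hj1, hj2.le⟩
  have h2 : (2:ℝ) ^ (b - s) < 1 := Real.rpow_lt_one_of_one_lt_of_neg (by norm_num) (by linarith)
  have h20 : 0 < (2:ℝ) ^ (b - s) := by positivity
  calc ∫⁻ y in {y | L ≤ dist x y}, ENNReal.ofReal (dist x y ^ (-s)) ∂ν
      ≤ ∫⁻ y in ⋃ j, T j, ENNReal.ofReal (dist x y ^ (-s)) ∂ν := lintegral_mono_set hsub
    _ ≤ ∑' j, ∫⁻ y in T j, ENNReal.ofReal (dist x y ^ (-s)) ∂ν := lintegral_iUnion_le _ _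
    _ ≤ ∑' j : ℕ, ENNReal.ofReal (M * L ^ (-s) * (2 ^ (b - s)) ^ j) := by
        refine ENNReal.tsum_le_tsum fun j => ?_
        calc ∫⁻ y in T j, ENNReal.ofReal (dist x y ^ (-s)) ∂ν ≤ ∫⁻ y in T j, ENNReal.ofReal ((2 ^ j * L) ^ (-s)) ∂ν := by
              refine setLIntegral_mono' (hTm j) fun y hy => ENNReal.ofReal_le_ofReal ?_
              exact Real.rpow_le_rpow_of_nonpos (by positivity) hy.1 (by linarith)
          _ = ENNReal.ofReal ((2 ^ j * L) ^ (-s)) * ν (T j) := setLIntegral_const _ _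
          _ ≤ ENNReal.ofReal ((2 ^ j * L) ^ (-s)) * ENNReal.ofReal (M * (2 ^ j) ^ b) := by
              gcongr
              refine (measure_mono fun y hy => ?_).trans (h j)
              rw [Metric.mem_closedBall, dist_comm]; exact hy.2
          _ = _ := by
              rw [← ENNReal.ofReal_mul (by positivity)]
              congr 1
              have e : ((2:ℝ) ^ (b - s)) ^ j = (2 ^ j) ^ (-s) * (2 ^ j) ^ b := by
                rw [← Real.rpow_add (by positivity), ← Real.rpow_natCast, ← Real.rpow_mul (by norm_num), ← Real.rpow_natCast, ← Real.rpow_mul (by norm_num)]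
                congr 1; ring
              rw [e, Real.mul_rpow (by positivity) hL.le]; ring
    _ = _ := by
        rw [← ENNReal.ofReal_tsum_of_nonneg (fun j => by positivity) ((summable_geometric_of_lt_one h20.le h2).mul_left _), tsum_mul_left, tsum_geometric_of_lt_one h20.le h2]

/-- pointwise estimate when `q > 1` -/
lemma AQ.pointwise {q C : ℝ} {ω : En n → ℝ≥0∞} (H : AQ n q ω C) (hq1 : 1 < q) (hpos : ∀ x r, 0 < r → 0 < wm ω x r)
    {s p : ℝ} (hsn : n < s) (hp0 : 0 < p) (hq : n * q = p * s) : ∃ K : ℝ, 0 < K ∧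
    ∀ (A u : En n → ℝ≥0∞) (x : En n) (τ l : ℝ), Measurable u → 0 < τ → 0 < l → (∀ y w, dist y w ≤ τ → u y ≤ A w) →
    (∀ R, 0 < R → ∫⁻ y in Metric.closedBall x R, A y ^ p ∂(volume.withDensity ω) ≤ ENNReal.ofReal (l ^ p) * volume.withDensity ω (Metric.closedBall x R)) →
    ∫⁻ y in {y | τ ≤ dist x y}, ENNReal.ofReal (τ ^ (s - n) * (dist x y) ^ (-s)) * u y ≤ ENNReal.ofReal (K * l) := by
  obtain ⟨K3, η, hK3, hη, hW⟩ := H.W3 hq1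
  have hC := H.hC
  have hn0 : (0:ℝ) < n := by exact_mod_cast H.hn
  have hs0 : 0 < s := by linarith
  have hq0 : 0 < q := by linarith
  set r := (n:ℝ) / s with hr
  have hr0 : 0 < r := by positivity
  have hr1 : r < 1 := by rw [hr, div_lt_one hs0]; exact hsn
  have hrq : r * q = p := by rw [hr]; field_simp; linarith
  have hrs : r * s = n := by rw [hr]; field_simp
  set κ := n * q - η with hκ
  set b := κ * ((1 - r) / p) + n with hb
  have hbs : b < s := by
    have e : b = s - η * (1 - r) / p := by
      rw [hb, hκ, hq]; field_simp; rw [← hrs]; ring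
    have : 0 < η * (1 - r) / p := by have : 0 < 1 - r := by linarith
                                     positivity
    linarith
  have h2b : (2:ℝ) ^ (b - s) < 1 := Real.rpow_lt_one_of_one_lt_of_neg (by norm_num) (by linarith)
  have hinv : 0 < (1 - (2:ℝ) ^ (b - s))⁻¹ := inv_pos.2 (by linarith)
  set K0 := (K3 * 4 ^ κ) ^ ((1 - r) / p) * C ^ (1/q) * 2 ^ n with hK0
  have hK00 : 0 < K0 := by positivity
  refine ⟨K0 * (1 - 2 ^ (b - s))⁻¹, by positivity, fun A u x τ l hu hτ hl huA hY => ?_⟩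
  set μ := volume.withDensity ω with hμ
  have hμpos : ∀ x r, 0 < r → μ (Metric.closedBall x r) ≠ 0 := by
    intro x r hr h0
    have := hpos x r hr
    simp only [wm] at this
    rw [← hμ, h0] at this
    simp at this
  have hμtop : ∀ x r, μ (Metric.closedBall x r) ≠ ⊤ := fun x r => (H.fin x r).ne
  -- sup bound
  have hsup : ∀ (j : ℕ), ∀ y ∈ Metric.closedBall x (2 ^ (j+1) * τ), u y ≤ ENNReal.ofReal (l * (K3 * 4 ^ κ * (2 ^ j) ^ κ) ^ (1/p)) := by
    intro j y hy
    have h2j : (1:ℝ) ≤ 2 ^ j := one_le_pow₀ (by norm_num)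
    rw [Metric.mem_closedBall, dist_comm] at hy
    have hd : dist x y + τ ≤ 4 * 2 ^ j * τ := by
      rw [pow_succ] at hy; nlinarith
    have hw := hW x y (4 * 2 ^ j * τ) τ hτ hd
    rw [mul_div_cancel_right₀ _ hτ.ne'] at hw
    have hwE : μ (Metric.closedBall x (4 * 2 ^ j * τ)) ≤ ENNReal.ofReal (K3 * (4 * 2 ^ j) ^ κ) * μ (Metric.closedBall y τ) := by
      rw [hμ, ← H.ofReal_wm x, ← H.ofReal_wm y, ← ENNReal.ofReal_mul (by positivity)]
      exact ENNReal.ofReal_le_ofReal hw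
    have h1 : u y ^ p * μ (Metric.closedBall y τ) ≤ ENNReal.ofReal (l ^ p * (K3 * (4 * 2 ^ j) ^ κ)) * μ (Metric.closedBall y τ) := by
      calc u y ^ p * μ (Metric.closedBall y τ) = ∫⁻ w in Metric.closedBall y τ, u y ^ p ∂μ := (setLIntegral_const _ _).symm
        _ ≤ ∫⁻ w in Metric.closedBall y τ, A w ^ p ∂μ := by
            refine setLIntegral_mono' measurableSet_closedBall fun w hw => ?_
            rw [Metric.mem_closedBall, dist_comm] at hw
            exact ENNReal.rpow_le_rpow (huA y w hw) hp0.le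
        _ ≤ ∫⁻ w in Metric.closedBall x (4 * 2 ^ j * τ), A w ^ p ∂μ := by
            refine lintegral_mono_set (Metric.closedBall_subset_closedBall' ?_)
            rw [dist_comm]; linarith
        _ ≤ ENNReal.ofReal (l ^ p) * μ (Metric.closedBall x (4 * 2 ^ j * τ)) := hY _ (by positivity)
        _ ≤ ENNReal.ofReal (l ^ p) * (ENNReal.ofReal (K3 * (4 * 2 ^ j) ^ κ) * μ (Metric.closedBall y τ)) := by
            gcongr
        _ = _ := by rw [ENNReal.ofReal_mul (p := l ^ p) (by positivity), mul_assoc]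
    have h2 := (ENNReal.mul_le_mul_iff_left (hμpos y τ hτ) (hμtop y τ)).1 h1
    have h3 := ENNReal.rpow_le_rpow h2 (by positivity : 0 ≤ 1/p)
    rw [← ENNReal.rpow_mul, mul_one_div_cancel hp0.ne', ENNReal.rpow_one, ENNReal.ofReal_rpow_of_pos (by positivity)] at h3
    refine h3.trans_eq ?_
    congr 1
    have e4 : ((4:ℝ) * 2 ^ j) ^ κ = 4 ^ κ * (2 ^ j) ^ κ := Real.mul_rpow (by norm_num) (by positivity)
    rw [e4, Real.mul_rpow (x := l ^ p) (by positivity) (by positivity), ← Real.rpow_mul hl.le, mul_one_div_cancel hp0.ne', Real.rpow_one, mul_assoc K3]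
  -- integral bound of u ^ r
  have hInteg : ∀ R, 0 < R → ∫⁻ y in Metric.closedBall x R, u y ^ r ≤ ENNReal.ofReal (C ^ (1/q) * R ^ n * l ^ r) := by
    intro R hR
    have h1 := H.aq x R hR (fun y => u y ^ r) (by fun_prop)
    simp only [← ENNReal.rpow_mul, hrq] at h1
    have h2 : (∫⁻ y in Metric.closedBall x R, u y ^ r) ^ q * μ (Metric.closedBall x R) ≤ ENNReal.ofReal (C * R ^ (n * q) * l ^ p) * μ (Metric.closedBall x R) := by
      refine h1.trans ?_
      calc _ ≤ ENNReal.ofReal (C * R ^ (n * q)) * ∫⁻ y in Metric.closedBall x R, A y ^ p ∂μ := by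
            gcongr with y
            exact huA y y (by rw [dist_self]; exact hτ.le)
        _ ≤ ENNReal.ofReal (C * R ^ (n * q)) * (ENNReal.ofReal (l ^ p) * μ (Metric.closedBall x R)) := by gcongr; exact hY R hR
        _ = _ := by rw [ENNReal.ofReal_mul (p := C * R ^ (n * q)) (by positivity), mul_assoc]
    have h3 := (ENNReal.mul_le_mul_iff_left (hμpos x R hR) (hμtop x R)).1 h2
    have h4 := ENNReal.rpow_le_rpow h3 (by positivity : 0 ≤ 1/q)
    rw [← ENNReal.rpow_mul, mul_one_div_cancel hq0.ne', ENNReal.rpow_one, ENNReal.ofReal_rpow_of_pos (by positivity)] at h4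
    refine h4.trans_eq ?_
    congr 1
    rw [Real.mul_rpow (by positivity) (by positivity), Real.mul_rpow (by positivity) (by positivity), ← Real.rpow_mul hR.le, ← Real.rpow_mul hl.le]
    have e1 : n * q * (1/q) = n := by field_simp
    have e2 : p * (1/q) = r := by rw [← hrq]; field_simp
    rw [e1, e2, Real.rpow_natCast]
  have hball : ∀ j : ℕ, (volume.withDensity u) (Metric.closedBall x (2 ^ (j + 1) * τ)) ≤ ENNReal.ofReal ((K0 * l * τ ^ n) * (2 ^ j) ^ b) := by
    intro j
    rw [withDensity_apply _ measurableSet_closedBall]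
    set S := l * (K3 * 4 ^ κ * (2 ^ j) ^ κ) ^ (1/p) with hS
    have hS0 : 0 < S := by positivity
    calc ∫⁻ y in Metric.closedBall x (2 ^ (j + 1) * τ), u y ≤ ∫⁻ y in Metric.closedBall x (2 ^ (j + 1) * τ), ENNReal.ofReal (S ^ (1 - r)) * u y ^ r := by
          refine setLIntegral_mono' measurableSet_closedBall fun y hy => ?_
          have h1 := hsup j y hy
          calc u y = u y ^ (1 - r) * u y ^ r := by
                rw [← ENNReal.rpow_add_of_nonneg _ _ (by linarith) hr0.le]; simp
            _ ≤ _ := by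
                rw [← ENNReal.ofReal_rpow_of_pos hS0]
                gcongr
      _ = ENNReal.ofReal (S ^ (1 - r)) * ∫⁻ y in Metric.closedBall x (2 ^ (j + 1) * τ), u y ^ r := lintegral_const_mul' _ _ ENNReal.ofReal_ne_top
      _ ≤ ENNReal.ofReal (S ^ (1 - r)) * ENNReal.ofReal (C ^ (1/q) * (2 ^ (j + 1) * τ) ^ n * l ^ r) := by
          gcongr; exact hInteg _ (by positivity)
      _ = _ := by
          rw [← ENNReal.ofReal_mul (by positivity)]
          congr 1
          have e1 : S ^ (1 - r) = l ^ (1 - r) * ((K3 * 4 ^ κ) ^ ((1 - r) / p) * (2 ^ j) ^ (κ * ((1 - r)/p))) := by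
            rw [hS, Real.mul_rpow hl.le (by positivity), ← Real.rpow_mul (by positivity), Real.mul_rpow (by positivity) (by positivity), ← Real.rpow_mul (by positivity)]
            congr 3 <;> ring
          have e2 : l = l ^ (1 - r) * l ^ r := by rw [← Real.rpow_add hl]; simp
          have e3 : ((2:ℝ) ^ j) ^ b = (2 ^ j) ^ (κ * ((1 - r)/p)) * (2 ^ j) ^ n := by
            rw [hb, Real.rpow_add (by positivity), Real.rpow_natCast]
          rw [e1, e3, hK0]
          conv_rhs => rw [e2]
          rw [mul_pow, pow_succ, mul_pow]
          ring
  have hfin := tail_bound (volume.withDensity u) x hτ hs0 hbs (by positivity) hball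
  have hms : MeasurableSet {y : En n | τ ≤ dist x y} := measurableSet_le measurable_const (by fun_prop)
  calc _ = ENNReal.ofReal (τ ^ (s - n)) * ∫⁻ y in {y | τ ≤ dist x y}, ENNReal.ofReal (dist x y ^ (-s)) ∂(volume.withDensity u) := by
        rw [setLIntegral_withDensity_eq_setLIntegral_mul _ hu (by fun_prop) hms, ← lintegral_const_mul' _ _ ENNReal.ofReal_ne_top]
        refine lintegral_congr fun y => ?_
        simp only [Pi.mul_apply]
        rw [ENNReal.ofReal_mul (by positivity)]; ring
    _ ≤ ENNReal.ofReal (τ ^ (s - n)) * ENNReal.ofReal ((K0 * l * τ ^ n) * τ ^ (-s) * (1 - 2 ^ (b - s))⁻¹) := by gcongr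
    _ = _ := by
        rw [← ENNReal.ofReal_mul (by positivity)]
        congr 1
        have e : τ ^ (s - n) * τ ^ n * τ ^ (-s) = 1 := by
          rw [← Real.rpow_natCast, ← Real.rpow_add hτ, ← Real.rpow_add hτ]; ring_nf; simp
        calc _ = (τ ^ (s - n) * τ ^ n * τ ^ (-s)) * (K0 * l * (1 - 2 ^ (b - s))⁻¹) := by ring
          _ = _ := by rw [e]; ring
end

section
open MeasureTheory Real Set
open scoped ENNReal NNReal
variable {n : ℕ}

lemma dy_sum {p l : ℝ} (hp : 0 < p) (hl : 0 < l) (a : ℝ≥0∞) :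
    ∑' k : ℕ, (if ENNReal.ofReal (2 ^ k * l) < a then ENNReal.ofReal ((2 ^ k * l) ^ p) else 0) ≤ ENNReal.ofReal (2 ^ p / (2 ^ p - 1)) * a ^ p := by
  have h2p : 1 < (2:ℝ) ^ p := Real.one_lt_rpow (by norm_num) hp
  have hc : 0 < (2:ℝ) ^ p / (2 ^ p - 1) := div_pos (by linarith) (by linarith)
  rcases eq_or_ne a ⊤ with rfl | ha
  · rw [ENNReal.top_rpow_of_pos hp, ENNReal.mul_top (by simpa using hc)]; exact le_top
  lift a to ℝ≥0 using ha
  have e : (a : ℝ≥0∞) = ENNReal.ofReal a := by simp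
  have hlt : ∀ k : ℕ, ENNReal.ofReal (2 ^ k * l) < (a:ℝ≥0∞) ↔ 2 ^ k * l < (a:ℝ) := by
    intro k; rw [e, ENNReal.ofReal_lt_ofReal_iff_of_nonneg (by positivity)]
  simp only [hlt]
  by_cases hal : (a:ℝ) ≤ l
  · have : ∀ k : ℕ, ¬ (2 ^ k * l < (a:ℝ)) := by
      intro k
      have : (1:ℝ) ≤ 2 ^ k := one_le_pow₀ (by norm_num)
      nlinarith
    simp [this]
  push Not at hal
  have ha0 : 0 < (a:ℝ) := hl.trans hal
  obtain ⟨K, hK1, hK2⟩ := exists_nat_pow_near ((one_le_div hl).2 hal.le) (by norm_num : (1:ℝ) < 2)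
  rw [le_div_iff₀ hl] at hK1
  rw [div_lt_iff₀ hl] at hK2
  rw [tsum_eq_sum (s := Finset.range (K+1))]
  · calc _ ≤ ∑ k ∈ Finset.range (K+1), ENNReal.ofReal ((2 ^ k * l) ^ p) := by
          refine Finset.sum_le_sum fun k _ => ?_
          split_ifs <;> simp
      _ = ENNReal.ofReal (∑ k ∈ Finset.range (K+1), (2 ^ k * l) ^ p) := (ENNReal.ofReal_sum_of_nonneg fun k _ => by positivity).symm
      _ ≤ ENNReal.ofReal (2 ^ p / (2 ^ p - 1) * (a:ℝ) ^ p) := by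
          apply ENNReal.ofReal_le_ofReal
          have e1 : ∀ k : ℕ, ((2:ℝ) ^ k * l) ^ p = (2 ^ p) ^ k * l ^ p := by
            intro k
            rw [Real.mul_rpow (by positivity) hl.le, ← Real.rpow_natCast, ← Real.rpow_mul (by norm_num), ← Real.rpow_natCast, ← Real.rpow_mul (by norm_num), mul_comm p]
          have h3 : (2 ^ p) ^ K * l ^ p ≤ (a:ℝ) ^ p := by
            rw [← e1]; exact Real.rpow_le_rpow (by positivity) hK1 hp.le
          simp only [e1]
          rw [← Finset.sum_mul, geom_sum_eq h2p.ne', div_mul_eq_mul_div, div_mul_eq_mul_div]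
          apply div_le_div_of_nonneg_right _ (by linarith)
          have : 0 < l ^ p := by positivity
          rw [pow_succ]
          nlinarith
      _ = _ := by
          rw [ENNReal.ofReal_mul hc.le, e, ENNReal.ofReal_rpow_of_pos ha0]
  · intro k hk
    rw [if_neg]
    simp only [Finset.mem_range, not_lt] at hk
    have : (2:ℝ) ^ (K+1) ≤ 2 ^ k := pow_le_pow_right₀ (by norm_num) hk
    nlinarith

lemma dy_dom {l : ℝ} (hl : 0 < l) (a : ℝ≥0∞) (ha : a ≠ ⊤) :
    a ≤ 4 * (ENNReal.ofReal l + ∑' k : ℕ, (if ENNReal.ofReal (2 ^ k * l) < a then ENNReal.ofReal (2 ^ k * l) else 0)) := by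
  lift a to ℝ≥0 using ha
  have e : (a : ℝ≥0∞) = ENNReal.ofReal a := by simp
  have e4 : (4:ℝ≥0∞) = ENNReal.ofReal 4 := by simp
  by_cases hal : (a:ℝ) ≤ 2 * l
  · calc (a:ℝ≥0∞) ≤ 4 * ENNReal.ofReal l := by
          rw [e, e4, ← ENNReal.ofReal_mul (by norm_num)]; exact ENNReal.ofReal_le_ofReal (by linarith)
      _ ≤ _ := by gcongr; exact le_self_add
  push Not at hal
  obtain ⟨K, hK1, hK2⟩ := exists_nat_pow_near ((one_le_div hl).2 (by linarith : l ≤ (a:ℝ))) (by norm_num : (1:ℝ) < 2)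
  rw [le_div_iff₀ hl] at hK1
  rw [div_lt_iff₀ hl] at hK2
  obtain _ | K := K
  · simp at hK2; linarith
  have h1 : 2 ^ K * l < (a:ℝ) := by
    have : (0:ℝ) < 2 ^ K * l := by positivity
    rw [pow_succ] at hK1; nlinarith
  have h2 : ENNReal.ofReal (2 ^ K * l) < (a:ℝ≥0∞) := by
    rw [e, ENNReal.ofReal_lt_ofReal_iff_of_nonneg (by positivity)]; exact h1
  calc (a:ℝ≥0∞) ≤ 4 * ENNReal.ofReal (2 ^ K * l) := by
        rw [e, e4, ← ENNReal.ofReal_mul (by norm_num)]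
        apply ENNReal.ofReal_le_ofReal
        rw [pow_succ, pow_succ] at hK2; linarith
    _ = 4 * (if ENNReal.ofReal (2 ^ K * l) < (a:ℝ≥0∞) then ENNReal.ofReal (2 ^ K * l) else 0) := by rw [if_pos h2]
    _ ≤ _ := by
        gcongr
        refine le_trans ?_ le_add_self
        exact ENNReal.le_tsum (f := fun k : ℕ => if ENNReal.ofReal (2 ^ k * l) < (a:ℝ≥0∞) then ENNReal.ofReal (2 ^ k * l) else 0) K

/-- Whitney type estimate. -/
lemma whitney (hn : 1 ≤ n) (μ : Measure (En n)) [SFinite μ] (Ω : Set (En n)) (hΩ : MeasurableSet Ω) (ρ : En n → ℝ) (hρ : ∀ y, ρ y = Metric.infDist y Ωᶜ) :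
    ∫⁻ y in {y | 0 < ρ y}, ENNReal.ofReal ((ρ y) ^ (-(n:ℝ))) * μ (Metric.closedBall y (ρ y / 2)) ≤
      ENNReal.ofReal ((3/2)^n) * volume (Metric.ball (0 : En n) 1) * μ Ω := by
  have hρm : Measurable ρ := by
    have : ρ = fun y => Metric.infDist y Ωᶜ := funext hρ
    rw [this]; exact (Metric.continuous_infDist_pt _).measurable
  have hLip : ∀ x y, ρ x ≤ ρ y + dist x y := by
    intro x y; rw [hρ, hρ]; exact Metric.infDist_le_infDist_add_dist
  set g : En n → En n → ℝ≥0∞ := fun y x => {z : En n × En n | 0 < ρ z.1 ∧ dist z.2 z.1 ≤ ρ z.1 / 2}.indicator (fun z => ENNReal.ofReal ((ρ z.1) ^ (-(n:ℝ)))) (y, x) with hg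
  have hgset : MeasurableSet {z : En n × En n | 0 < ρ z.1 ∧ dist z.2 z.1 ≤ ρ z.1 / 2} := by
    have h1 : MeasurableSet {z : En n × En n | 0 < ρ z.1} := measurableSet_lt measurable_const (by fun_prop)
    have h2 : MeasurableSet {z : En n × En n | dist z.2 z.1 ≤ ρ z.1 / 2} := measurableSet_le (by fun_prop) (by fun_prop)
    exact h1.inter h2
  have hgm : Measurable (Function.uncurry g) := by
    have : Function.uncurry g = {z : En n × En n | 0 < ρ z.1 ∧ dist z.2 z.1 ≤ ρ z.1 / 2}.indicator (fun z => ENNReal.ofReal ((ρ z.1) ^ (-(n:ℝ)))) := by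
      ext z; rfl
    rw [this]
    exact Measurable.indicator (by fun_prop) hgset
  have hS : MeasurableSet {y | 0 < ρ y} := measurableSet_lt measurable_const hρm
  calc ∫⁻ y in {y | 0 < ρ y}, ENNReal.ofReal ((ρ y) ^ (-(n:ℝ))) * μ (Metric.closedBall y (ρ y / 2))
      ≤ ∫⁻ y in {y | 0 < ρ y}, ∫⁻ x, g y x ∂μ := by
        refine setLIntegral_mono' hS fun y hy => ?_
        rw [← setLIntegral_const, ← lintegral_indicator measurableSet_closedBall]
        refine lintegral_mono fun x => ?_
        simp only [hg, indicator, Metric.mem_closedBall, mem_setOf_eq]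
        simp only [mem_setOf_eq] at hy
        simp [hy]
    _ ≤ ∫⁻ y, ∫⁻ x, g y x ∂μ := setLIntegral_le_lintegral _ _
    _ = ∫⁻ x, (∫⁻ y, g y x) ∂μ := lintegral_lintegral_swap hgm.aemeasurable
    _ ≤ ∫⁻ x, Ω.indicator (fun _ => ENNReal.ofReal ((3/2)^n) * volume (Metric.ball (0 : En n) 1)) x ∂μ := by
        refine lintegral_mono fun x => ?_
        by_cases hx : 0 < ρ x
        · have hxΩ : x ∈ Ω := by
            by_contra hc
            rw [hρ, Metric.infDist_zero_of_mem hc] at hx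
            exact lt_irrefl _ hx
          rw [indicator_of_mem hxΩ]
          calc ∫⁻ y, g y x ≤ ∫⁻ y, (Metric.closedBall x (ρ x)).indicator (fun _ => ENNReal.ofReal ((2 / 3 * ρ x) ^ (-(n:ℝ)))) y := by
                refine lintegral_mono fun y => ?_
                simp only [hg]
                by_cases hy : 0 < ρ y ∧ dist x y ≤ ρ y / 2
                · have h1 := hLip x y
                  have h2 := hLip y x
                  rw [dist_comm] at h2
                  rw [indicator_of_mem (show (y, x) ∈ {z : En n × En n | 0 < ρ z.1 ∧ dist z.2 z.1 ≤ ρ z.1 / 2} from hy), indicator_of_mem (by rw [Metric.mem_closedBall, dist_comm]; linarith [hy.2])]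
                  apply ENNReal.ofReal_le_ofReal
                  exact Real.rpow_le_rpow_of_nonpos (by positivity) (by linarith [hy.2]) (by simp)
                · rw [indicator_of_notMem (show (y, x) ∉ {z : En n × En n | 0 < ρ z.1 ∧ dist z.2 z.1 ≤ ρ z.1 / 2} from hy)]; exact zero_le
            _ = ENNReal.ofReal ((2 / 3 * ρ x) ^ (-(n:ℝ))) * (ENNReal.ofReal (ρ x) ^ n * volume (Metric.ball (0 : En n) 1)) := by
                rw [lintegral_indicator measurableSet_closedBall, setLIntegral_const, vol_cball x hx]
            _ = _ := by
                rw [← mul_assoc, ← ENNReal.ofReal_pow hx.le, ← ENNReal.ofReal_mul (by positivity)]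
                congr 2
                rw [Real.rpow_neg (by positivity), Real.rpow_natCast, mul_pow, mul_inv, mul_assoc, inv_mul_cancel₀ (by positivity), ← inv_pow]
                norm_num
        · have : ∀ y, g y x = 0 := by
            intro y
            simp only [hg]
            apply indicator_of_notMem
            rintro ⟨h1, h2⟩
            simp only at h1 h2
            have := hLip y x
            rw [dist_comm] at this
            linarith
          simp [this]
    _ = _ := by
        rw [lintegral_indicator hΩ, setLIntegral_const]
end

section
open MeasureTheory Real Set
open scoped ENNReal NNReal
variable {n : ℕ}

/-- first term -/
lemma tail_vol {s : ℝ} (hsn : n < s) : ∃ K : ℝ, 0 < K ∧ ∀ (x : En n) (τ : ℝ), 0 < τ →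
    ∫⁻ y in {y | τ ≤ dist x y}, ENNReal.ofReal (τ ^ (s - n) * (dist x y) ^ (-s)) ≤ ENNReal.ofReal K := by
  have hs0 : 0 < s := lt_of_le_of_lt (by positivity) hsn
  set v := (volume (Metric.ball (0 : En n) 1)).toReal with hv
  have hv' : volume (Metric.ball (0 : En n) 1) = ENNReal.ofReal v := (ENNReal.ofReal_toReal measure_ball_lt_top.ne).symm
  have hv0 : 0 ≤ v := ENNReal.toReal_nonneg
  have h2 : (2:ℝ) ^ ((n:ℝ) - s) < 1 := Real.rpow_lt_one_of_one_lt_of_neg (by norm_num) (by linarith)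
  have hinv : 0 < (1 - (2:ℝ) ^ ((n:ℝ) - s))⁻¹ := inv_pos.2 (by linarith)
  refine ⟨(2 ^ n * v + 1) * (1 - (2:ℝ) ^ ((n:ℝ) - s))⁻¹, by positivity, fun x τ hτ => ?_⟩
  have := tail_bound volume x (M := 2 ^ n * v * τ ^ n) hτ hs0 hsn (by positivity) (by
    intro j
    rw [vol_cball x (by positivity), hv', ← ENNReal.ofReal_pow (by positivity), ← ENNReal.ofReal_mul (by positivity)]
    apply ENNReal.ofReal_le_ofReal
    rw [Real.rpow_natCast, mul_pow, pow_succ, mul_pow]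
    apply le_of_eq; ring)
  calc _ = ENNReal.ofReal (τ ^ (s - n)) * ∫⁻ y in {y | τ ≤ dist x y}, ENNReal.ofReal ((dist x y) ^ (-s)) := by
        rw [← lintegral_const_mul' _ _ ENNReal.ofReal_ne_top]
        refine lintegral_congr fun y => ?_
        rw [ENNReal.ofReal_mul (by positivity)]
    _ ≤ ENNReal.ofReal (τ ^ (s - n)) * ENNReal.ofReal (2 ^ n * v * τ ^ n * τ ^ (-s) * (1 - 2 ^ ((n:ℝ) - s))⁻¹) := by gcongr
    _ ≤ _ := by
        rw [← ENNReal.ofReal_mul (by positivity)]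
        apply ENNReal.ofReal_le_ofReal
        have e : τ ^ (s - n) * τ ^ n * τ ^ (-s) = 1 := by
          rw [← Real.rpow_natCast, ← Real.rpow_add hτ, ← Real.rpow_add hτ]; ring_nf; simp
        calc _ = (τ ^ (s - n) * τ ^ n * τ ^ (-s)) * (2 ^ n * v * (1 - 2 ^ ((n:ℝ) - s))⁻¹) := by ring
          _ ≤ _ := by rw [e]; nlinarith

lemma AQ.endpoint {C : ℝ} {ω : En n → ℝ≥0∞} (H : AQ n 1 ω C) (hpos : ∀ x r, 0 < r → 0 < wm ω x r)
    {s p : ℝ} (hsn : n < s) (hp0 : 0 < p) (hps : (n:ℝ) = p * s) : ∃ K : ℝ, 0 < K ∧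
    ∀ (A : En n → ℝ≥0∞) (_ : Measurable A) (l : ℝ), 0 < l → ∃ G : En n → ℝ≥0∞, Measurable G ∧
      ∫⁻ x, G x ∂(volume.withDensity ω) ≤ ENNReal.ofReal (K * l ^ (1 - p)) * ∫⁻ x, A x ^ p ∂(volume.withDensity ω) ∧
      ∀ x, A x ≤ ENNReal.ofReal l → (∀ R, 0 < R → ∫⁻ y in Metric.closedBall x R, A y ^ p ∂(volume.withDensity ω) ≤ ENNReal.ofReal (l ^ p) * volume.withDensity ω (Metric.closedBall x R)) →
      ∀ (u : En n → ℝ≥0∞) (τ : ℝ), Measurable u → 0 < τ → (∀ y, u y ≠ ⊤) → (∀ y w, dist y w ≤ τ → u y ≤ A w) →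
      ∫⁻ y in {y | τ ≤ dist x y}, ENNReal.ofReal (τ ^ (s - n) * (dist x y) ^ (-s)) * u y ≤ ENNReal.ofReal (K * l) + G x := by
  obtain ⟨D, hD1, hW⟩ := H.W2
  simp only [mul_one] at hW
  obtain ⟨K1, hK1, hT⟩ := tail_vol hsn
  have hn0 : (0:ℝ) < n := by exact_mod_cast H.hn
  have hs0 : 0 < s := by linarith
  have h2b : (2:ℝ) ^ ((n:ℝ) - s) < 1 := Real.rpow_lt_one_of_one_lt_of_neg (by norm_num) (by linarith)
  set c0 := (1 - (2:ℝ) ^ ((n:ℝ) - s))⁻¹ with hc0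
  have hc00 : 0 < c0 := inv_pos.2 (by linarith)
  have h2p : 1 < (2:ℝ) ^ p := Real.one_lt_rpow (by norm_num) hp0
  set cp := (2:ℝ) ^ p / (2 ^ p - 1) with hcp
  have hcp0 : 0 < cp := div_pos (by linarith) (by linarith)
  set v := (volume (Metric.ball (0 : En n) 1)).toReal with hv
  have hv' : volume (Metric.ball (0 : En n) 1) = ENNReal.ofReal v := (ENNReal.ofReal_toReal measure_ball_lt_top.ne).symm
  have hv0 : 0 ≤ v := ENNReal.toReal_nonneg
  set K2 := D * 4 ^ n * (4 * D) ^ s * c0 with hK2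
  have hK20 : 0 < K2 := by positivity
  refine ⟨4 * K1 + 4 * (K2 * ((3/2) ^ n * v) * cp), by positivity, fun A hA l hl => ?_⟩
  set μ := volume.withDensity ω with hμ
  have hμpos : ∀ x r, 0 < r → μ (Metric.closedBall x r) ≠ 0 := by
    intro x r hr h0
    have := hpos x r hr
    simp only [wm] at this
    rw [← hμ, h0] at this
    simp at this
  have hμtop : ∀ x r, μ (Metric.closedBall x r) ≠ ⊤ := fun x r => (H.fin x r).ne
  set Ω : ℕ → Set (En n) := fun k => {x | ENNReal.ofReal (2 ^ k * l) < A x} with hΩ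
  have hΩm : ∀ k, MeasurableSet (Ω k) := fun k => measurableSet_lt measurable_const hA
  set ρ : ℕ → En n → ℝ := fun k y => Metric.infDist y (Ω k)ᶜ with hρ
  have hρm : ∀ k, Measurable (ρ k) := fun k => (Metric.continuous_infDist_pt _).measurable
  set a : ℕ → ℝ := fun k => (2:ℝ) ^ ((k:ℝ) / s) with ha
  have ha1 : ∀ k, 1 ≤ a k := fun k => Real.one_le_rpow (by norm_num) (by positivity)
  have has : ∀ k, a k ^ s = 2 ^ k := by
    intro k
    rw [ha]; simp only
    rw [← Real.rpow_mul (by norm_num), div_mul_cancel₀ _ hs0.ne', Real.rpow_natCast]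
  have han : ∀ k, a k ^ n = (2 ^ k) ^ p := by
    intro k
    rw [← has k, ← Real.rpow_mul (by linarith [ha1 k]), mul_comm s p, ← hps, Real.rpow_natCast]
  set T : ℕ → Set (En n × En n) := fun k => {z | 0 < ρ k z.2 ∧ a k * ρ k z.2 / (4 * D) ≤ dist z.1 z.2} with hT'
  have hTm : ∀ k, MeasurableSet (T k) := by
    intro k
    have := hρm k
    have h1 : MeasurableSet {z : En n × En n | 0 < ρ k z.2} := measurableSet_lt measurable_const (by fun_prop)
    have h2 : MeasurableSet {z : En n × En n | a k * ρ k z.2 / (4 * D) ≤ dist z.1 z.2} := measurableSet_le (by fun_prop) (by fun_prop)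
    exact h1.inter h2
  set g : ℕ → En n × En n → ℝ≥0∞ := fun k => (T k).indicator (fun z => ENNReal.ofReal (ρ k z.2 ^ (s - n) * dist z.1 z.2 ^ (-s)) * ENNReal.ofReal (2 ^ k * l)) with hg
  have hgm : ∀ k, Measurable (g k) := by
    intro k
    have := hρm k
    exact Measurable.indicator (by fun_prop) (hTm k)
  have hGm : ∀ k, Measurable fun x => ∫⁻ y, g k (x, y) := fun k => (hgm k).lintegral_prod_right'
  refine ⟨fun x => 4 * ∑' k, ∫⁻ y, g k (x, y), (Measurable.ennreal_tsum hGm).const_mul _, ?_, ?_⟩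
  · -- integral bound
    have hk : ∀ k, ∫⁻ x, (∫⁻ y, g k (x, y)) ∂μ ≤ ENNReal.ofReal (l ^ (1 - p) * (K2 * ((3/2) ^ n * v))) * (ENNReal.ofReal ((2 ^ k * l) ^ p) * μ (Ω k)) := by
      intro k
      have hiny : ∀ y, ∫⁻ x, g k (x, y) ∂μ ≤ {y | 0 < ρ k y}.indicator (fun y => ENNReal.ofReal (l * K2 * (2 ^ k) ^ p) * (ENNReal.ofReal ((ρ k y) ^ (-(n:ℝ))) * μ (Metric.closedBall y (ρ k y / 2)))) y := by
        intro y
        by_cases hy : 0 < ρ k y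
        · rw [indicator_of_mem (by exact hy)]
          set r := ρ k y with hr
          have hL : 0 < a k * r / (4 * D) := by have := ha1 k; positivity
          have hak := ha1 k
          have hD0 : 0 < D := by linarith
          have htail := tail_bound μ y (M := D * 4 ^ n * a k ^ n * wm ω y (r / 2)) hL hs0 hsn (by have := wm_nonneg ω y (r/2); positivity) (by
            intro j
            have h2j : (1:ℝ) ≤ 2 ^ j := one_le_pow₀ (by norm_num)
            rw [hμ, ← H.ofReal_wm]
            apply ENNReal.ofReal_le_ofReal
            have hle : r / (8 * D) ≤ 2 ^ (j+1) * (a k * r / (4 * D)) := by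
              have : (1:ℝ) ≤ 2 ^ j * a k := by nlinarith
              calc r / (8 * D) = r / (4 * D) * (1/2) := by field_simp; norm_num
                _ ≤ r / (4 * D) * (2 * (2 ^ j * a k)) := by gcongr; linarith
                _ = _ := by rw [pow_succ]; ring
            have hw := hW y y (2 ^ (j+1) * (a k * r / (4 * D))) (r / (8 * D)) (by positivity) (by rw [dist_self]; linarith)
            have hw2 := H.wm_mono y y (τ := r / (8 * D)) (R := r / 2) (by
              rw [dist_self, zero_add]; gcongr; linarith)
            have e : 2 ^ (j+1) * (a k * r / (4 * D)) / (r / (8 * D)) = 4 * a k * 2 ^ j := by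
              rw [pow_succ]; field_simp; norm_num
            rw [e, Real.rpow_natCast] at hw
            rw [Real.rpow_natCast]
            calc _ ≤ _ := hw
              _ ≤ D * (4 * a k * 2 ^ j) ^ n * wm ω y (r / 2) := by gcongr
              _ = _ := by rw [mul_pow, mul_pow]; ring)
          have hms : MeasurableSet {x : En n | a k * r / (4 * D) ≤ dist y x} := measurableSet_le measurable_const (by fun_prop)
          calc ∫⁻ x, g k (x, y) ∂μ ≤ ∫⁻ x, {x : En n | a k * r / (4 * D) ≤ dist y x}.indicator (fun x => ENNReal.ofReal (2 ^ k * l * r ^ (s - n)) * ENNReal.ofReal (dist y x ^ (-s))) x ∂μ := by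
                refine lintegral_mono fun x => ?_
                simp only [hg, indicator, hT', mem_setOf_eq]
                rw [dist_comm x y]
                split_ifs with h1 h2 h2
                · apply le_of_eq
                  rw [← ENNReal.ofReal_mul (by positivity), ← ENNReal.ofReal_mul (by positivity)]
                  congr 1; ring
                · exact absurd h1.2 h2
                · exact zero_le
                · exact zero_le
            _ = ENNReal.ofReal (2 ^ k * l * r ^ (s - n)) * ∫⁻ x in {x : En n | a k * r / (4 * D) ≤ dist y x}, ENNReal.ofReal (dist y x ^ (-s)) ∂μ := by
                rw [lintegral_indicator hms, lintegral_const_mul' _ _ ENNReal.ofReal_ne_top]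
            _ ≤ ENNReal.ofReal (2 ^ k * l * r ^ (s - n)) * ENNReal.ofReal (D * 4 ^ n * a k ^ n * wm ω y (r / 2) * (a k * r / (4 * D)) ^ (-s) * c0) := by gcongr
            _ = _ := by
                have hwn := wm_nonneg ω y (r/2)
                rw [hμ, ← H.ofReal_wm, ← ENNReal.ofReal_mul (by positivity), ← ENNReal.ofReal_mul (by positivity), ← ENNReal.ofReal_mul (by positivity)]
                congr 1
                have e1 : (a k * r / (4 * D)) ^ (-s) = (2 ^ k)⁻¹ * r ^ (-s) * (4 * D) ^ s := by
                  rw [Real.div_rpow (by positivity) (by positivity), Real.mul_rpow (by positivity) hy.le, Real.rpow_neg (by positivity), has, Real.rpow_neg (x := 4 * D) (by positivity), div_inv_eq_mul]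
                have e2 : r ^ (s - n) * r ^ (-s) = r ^ (-(n:ℝ)) := by
                  rw [← Real.rpow_add hy]; congr 1; ring
                rw [e1, han, ← e2, hK2]
                have : (2:ℝ) ^ k ≠ 0 := by positivity
                field_simp
        · have : ∀ x, g k (x, y) = 0 := by
            intro x
            apply indicator_of_notMem
            exact fun h => hy h.1
          simp [this]
      have hS : MeasurableSet {y | 0 < ρ k y} := measurableSet_lt measurable_const (hρm k)
      calc ∫⁻ x, (∫⁻ y, g k (x, y)) ∂μ = ∫⁻ y, ∫⁻ x, g k (x, y) ∂μ := lintegral_lintegral_swap (f := fun x y => g k (x, y)) (hgm k).aemeasurable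
        _ ≤ _ := lintegral_mono hiny
        _ = ENNReal.ofReal (l * K2 * (2 ^ k) ^ p) * ∫⁻ y in {y | 0 < ρ k y}, ENNReal.ofReal ((ρ k y) ^ (-(n:ℝ))) * μ (Metric.closedBall y (ρ k y / 2)) := by
            rw [lintegral_indicator hS, lintegral_const_mul' _ _ ENNReal.ofReal_ne_top]
        _ ≤ ENNReal.ofReal (l * K2 * (2 ^ k) ^ p) * (ENNReal.ofReal ((3/2)^n) * volume (Metric.ball (0 : En n) 1) * μ (Ω k)) := by
            gcongr
            exact whitney H.hn μ (Ω k) (hΩm k) (ρ k) fun y => rfl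
        _ = _ := by
            rw [hv', ← ENNReal.ofReal_mul (p := (3/2) ^ n) (by positivity), ← mul_assoc (ENNReal.ofReal _), ← mul_assoc (ENNReal.ofReal (l ^ (1 - p) * _)), ← ENNReal.ofReal_mul (by positivity), ← ENNReal.ofReal_mul (by positivity)]
            congr 2
            rw [Real.mul_rpow (by positivity) hl.le]
            have e : l = l ^ (1 - p) * l ^ p := by rw [← Real.rpow_add hl]; simp
            conv_lhs => rw [e]
            ring
    rw [lintegral_const_mul _ (Measurable.ennreal_tsum hGm), lintegral_tsum fun k => (hGm k).aemeasurable]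
    have hsum : ∑' k, ENNReal.ofReal ((2 ^ k * l) ^ p) * μ (Ω k) ≤ ENNReal.ofReal cp * ∫⁻ x, A x ^ p ∂μ := by
      calc _ = ∑' k : ℕ, ∫⁻ x, (if ENNReal.ofReal (2 ^ k * l) < A x then ENNReal.ofReal ((2 ^ k * l) ^ p) else 0) ∂μ := by
            congr 1; ext k
            rw [← setLIntegral_const, ← lintegral_indicator (hΩm k)]
            refine lintegral_congr fun x => ?_
            simp only [indicator, hΩ, mem_setOf_eq]
        _ = ∫⁻ x, ∑' k : ℕ, (if ENNReal.ofReal (2 ^ k * l) < A x then ENNReal.ofReal ((2 ^ k * l) ^ p) else 0) ∂μ := by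
            rw [lintegral_tsum]
            intro k
            exact (Measurable.ite (hΩm k) measurable_const measurable_const).aemeasurable
        _ ≤ ∫⁻ x, ENNReal.ofReal cp * A x ^ p ∂μ := lintegral_mono fun x => dy_sum hp0 hl _
        _ = _ := lintegral_const_mul' _ _ ENNReal.ofReal_ne_top
    calc _ ≤ 4 * ∑' k, ENNReal.ofReal (l ^ (1 - p) * (K2 * ((3/2) ^ n * v))) * (ENNReal.ofReal ((2 ^ k * l) ^ p) * μ (Ω k)) := by
          gcongr with k; exact hk k
      _ = 4 * (ENNReal.ofReal (l ^ (1 - p) * (K2 * ((3/2) ^ n * v))) * ∑' k, ENNReal.ofReal ((2 ^ k * l) ^ p) * μ (Ω k)) := by rw [ENNReal.tsum_mul_left]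
      _ ≤ 4 * (ENNReal.ofReal (l ^ (1 - p) * (K2 * ((3/2) ^ n * v))) * (ENNReal.ofReal cp * ∫⁻ x, A x ^ p ∂μ)) := by gcongr
      _ = ENNReal.ofReal (4 * (l ^ (1 - p) * (K2 * ((3/2) ^ n * v))) * cp) * ∫⁻ x, A x ^ p ∂μ := by
          rw [ENNReal.ofReal_mul (p := 4 * _) (by positivity), ENNReal.ofReal_mul (p := 4) (by positivity)]
          simp only [ENNReal.ofReal_ofNat]
          ring
      _ ≤ _ := by
          refine mul_le_mul_left (ENNReal.ofReal_le_ofReal ?_) _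
          have h1 : 0 < l ^ (1 - p) := by positivity
          have h3 : 0 ≤ K1 * l ^ (1 - p) := by positivity
          clear_value K2 cp
          nlinarith
  · intro x hx hY u τ hu hτ hutop huA
    have hD0 : 0 < D := by linarith
    have hxΩ : ∀ k, x ∈ (Ω k)ᶜ := by
      intro k
      simp only [hΩ, mem_compl_iff, mem_setOf_eq, not_lt]
      refine hx.trans (ENNReal.ofReal_le_ofReal ?_)
      have : (1:ℝ) ≤ 2 ^ k := one_le_pow₀ (by norm_num)
      nlinarith
    have hkey : ∀ k y, 0 < ρ k y → a k * ρ k y / (4 * D) ≤ dist x y := by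
      intro k y hy
      set r := ρ k y with hr
      have hrd : r ≤ dist x y := by rw [dist_comm]; exact Metric.infDist_le_dist_of_mem (hxΩ k)
      have hd0 : 0 < dist x y := hy.trans_le hrd
      have hsub : Metric.closedBall y (r/2) ⊆ Ω k := by
        intro z hz
        by_contra hc
        have : r ≤ dist y z := Metric.infDist_le_dist_of_mem hc
        rw [Metric.mem_closedBall, dist_comm] at hz
        linarith
      have hw := hW x y (2 * dist x y) (r/2) (by positivity) (by linarith)
      rw [Real.rpow_natCast] at hw
      have hwE : μ (Metric.closedBall x (2 * dist x y)) ≤ ENNReal.ofReal (D * (2 * dist x y / (r/2)) ^ n) * μ (Metric.closedBall y (r/2)) := by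
        rw [hμ, ← H.ofReal_wm x, ← H.ofReal_wm y, ← ENNReal.ofReal_mul (by positivity)]
        exact ENNReal.ofReal_le_ofReal hw
      have h1 : ENNReal.ofReal ((2 ^ k * l) ^ p) * μ (Metric.closedBall y (r/2)) ≤ ENNReal.ofReal (l ^ p * (D * (2 * dist x y / (r/2)) ^ n)) * μ (Metric.closedBall y (r/2)) := by
        calc _ = ∫⁻ w in Metric.closedBall y (r/2), ENNReal.ofReal ((2 ^ k * l) ^ p) ∂μ := (setLIntegral_const _ _).symm
          _ ≤ ∫⁻ w in Metric.closedBall y (r/2), A w ^ p ∂μ := by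
              refine setLIntegral_mono' measurableSet_closedBall fun w hw => ?_
              rw [← ENNReal.ofReal_rpow_of_pos (by positivity)]
              exact ENNReal.rpow_le_rpow (le_of_lt (hsub hw)) hp0.le
          _ ≤ ∫⁻ w in Metric.closedBall x (2 * dist x y), A w ^ p ∂μ := by
              refine lintegral_mono_set (Metric.closedBall_subset_closedBall' ?_)
              rw [dist_comm y x]; linarith
          _ ≤ ENNReal.ofReal (l ^ p) * μ (Metric.closedBall x (2 * dist x y)) := hY _ (by positivity)
          _ ≤ ENNReal.ofReal (l ^ p) * (ENNReal.ofReal (D * (2 * dist x y / (r/2)) ^ n) * μ (Metric.closedBall y (r/2))) := by gcongr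
          _ = _ := by rw [ENNReal.ofReal_mul (p := l ^ p) (by positivity), mul_assoc]
      have h2 := (ENNReal.mul_le_mul_iff_left (hμpos y (r/2) (by positivity)) (hμtop y (r/2))).1 h1
      rw [ENNReal.ofReal_le_ofReal_iff (by positivity), Real.mul_rpow (by positivity) hl.le, ← han, mul_comm] at h2
      have h3 := le_of_mul_le_mul_left h2 (by positivity : 0 < l ^ p)
      have h4 : a k ^ n ≤ (D * (2 * dist x y / (r/2))) ^ n := by
        rw [mul_pow]
        refine h3.trans ?_
        gcongr
        exact le_self_pow₀ hD1 (by have := H.hn; omega)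
      have h5 := le_of_pow_le_pow_left₀ (by have := H.hn; omega) (by positivity) h4
      rw [div_le_iff₀ (by positivity)]
      have e : D * (2 * dist x y / (r/2)) = dist x y * (4 * D) / r := by field_simp; norm_num
      rwa [e, le_div_iff₀ hy] at h5
    have hms : MeasurableSet {y : En n | τ ≤ dist x y} := measurableSet_le measurable_const (by fun_prop)
    set w : En n → ℝ≥0∞ := fun y => ENNReal.ofReal (τ ^ (s - n) * (dist x y) ^ (-s)) with hw
    have hwm : Measurable w := by fun_prop
    have hterm : ∀ k y, w y * (if ENNReal.ofReal (2 ^ k * l) < u y then ENNReal.ofReal (2 ^ k * l) else 0) ≤ g k (x, y) := by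
      intro k y
      split_ifs with h
      · have hτρ : τ ≤ ρ k y := by
          rw [hρ]
          refine (Metric.le_infDist ⟨x, hxΩ k⟩).2 fun z hz => ?_
          by_contra hc
          push Not at hc
          have := huA y z hc.le
          exact hz (h.trans_le this)
        have hρ0 : 0 < ρ k y := hτ.trans_le hτρ
        rw [show g k (x, y) = ENNReal.ofReal (ρ k y ^ (s - n) * dist x y ^ (-s)) * ENNReal.ofReal (2 ^ k * l) from indicator_of_mem (show (x, y) ∈ T k from ⟨hρ0, hkey k y hρ0⟩) _]
        simp only [hw]
        gcongr
      · simp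
    calc ∫⁻ y in {y | τ ≤ dist x y}, w y * u y
        ≤ ∫⁻ y in {y | τ ≤ dist x y}, 4 * (ENNReal.ofReal l * w y + ∑' k, g k (x, y)) := by
          refine lintegral_mono fun y => ?_
          calc w y * u y ≤ w y * (4 * (ENNReal.ofReal l + ∑' k : ℕ, (if ENNReal.ofReal (2 ^ k * l) < u y then ENNReal.ofReal (2 ^ k * l) else 0))) := by
                gcongr; exact dy_dom hl _ (hutop y)
            _ = 4 * (ENNReal.ofReal l * w y + ∑' k : ℕ, w y * (if ENNReal.ofReal (2 ^ k * l) < u y then ENNReal.ofReal (2 ^ k * l) else 0)) := by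
                rw [ENNReal.tsum_mul_left]; ring
            _ ≤ _ := by
                gcongr with k; exact hterm k y
      _ = 4 * (ENNReal.ofReal l * (∫⁻ y in {y | τ ≤ dist x y}, w y) + ∑' k, ∫⁻ y in {y | τ ≤ dist x y}, g k (x, y)) := by
          have hm1 : ∀ k, Measurable fun y => g k (x, y) := fun k => (hgm k).comp measurable_prodMk_left
          rw [lintegral_const_mul' _ _ (by simp), lintegral_add_left (by fun_prop), lintegral_const_mul' _ _ ENNReal.ofReal_ne_top, lintegral_tsum fun k => (hm1 k).aemeasurable]
      _ ≤ 4 * (ENNReal.ofReal l * ENNReal.ofReal K1 + ∑' k, ∫⁻ y, g k (x, y)) := by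
          refine mul_le_mul_right (add_le_add (mul_le_mul_right (hT x τ hτ) _) (ENNReal.tsum_le_tsum fun k => ?_)) _
          exact setLIntegral_le_lintegral _ _
      _ = ENNReal.ofReal (4 * (l * K1)) + 4 * ∑' k, ∫⁻ y, g k (x, y) := by
          rw [mul_add, ENNReal.ofReal_mul (p := 4) (by norm_num), ENNReal.ofReal_mul hl.le]
          simp
      _ ≤ _ := by
          refine add_le_add (ENNReal.ofReal_le_ofReal ?_) le_rfl
          have h1 : 0 ≤ 4 * (K2 * ((3/2) ^ n * v) * cp) * l := by positivity
          clear_value K2 cp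
          nlinarith
end

section
open MeasureTheory Real Set
open scoped ENNReal NNReal
variable {n : ℕ}

lemma AQ.good {q C : ℝ} {ω : En n → ℝ≥0∞} (H : AQ n q ω C) (hpos : ∀ x r, 0 < r → 0 < wm ω x r)
    {s p : ℝ} (hsn : n < s) (hp0 : 0 < p) (hq : n * q = p * s) : ∃ K : ℝ, 0 < K ∧
    ∀ (A : En n → ℝ≥0∞) (_ : Measurable A) (l : ℝ), 0 < l → ∃ G : En n → ℝ≥0∞, Measurable G ∧
      ∫⁻ x, G x ∂(volume.withDensity ω) ≤ ENNReal.ofReal (K * l ^ (1 - p)) * ∫⁻ x, A x ^ p ∂(volume.withDensity ω) ∧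
      ∀ x, A x ≤ ENNReal.ofReal l → (∀ R, 0 < R → ∫⁻ y in Metric.closedBall x R, A y ^ p ∂(volume.withDensity ω) ≤ ENNReal.ofReal (l ^ p) * volume.withDensity ω (Metric.closedBall x R)) →
      ∀ (u : En n → ℝ≥0∞) (τ : ℝ), Measurable u → 0 < τ → (∀ y, u y ≠ ⊤) → (∀ y w, dist y w ≤ τ → u y ≤ A w) →
      ∫⁻ y in {y | τ ≤ dist x y}, ENNReal.ofReal (τ ^ (s - n) * (dist x y) ^ (-s)) * u y ≤ ENNReal.ofReal (K * l) + G x := by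
  rcases H.hq.eq_or_lt with h1 | h1
  · subst h1
    exact H.endpoint hpos hsn hp0 (by linarith)
  · obtain ⟨K, hK, h⟩ := H.pointwise h1 hpos hsn hp0 hq
    refine ⟨K, hK, fun A _ l hl => ⟨fun _ => 0, measurable_const, by simp, fun x _ hY u τ hu hτ _ huA => ?_⟩⟩
    rw [add_zero]
    exact h A u x τ l hu hτ hl huA hY

lemma AQ.weak_main {q Cq : ℝ} {ω : En n → ℝ≥0∞} (H : AQ n q ω Cq) (hpos : ∀ x r, 0 < r → 0 < wm ω x r)
    {δ p : ℝ} (hδ : ((n : ℝ) - 1) / 2 < δ) (hp0 : 0 < p) (hq : n * q = p * (((n:ℝ) + 1) / 2 + δ))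
    (Φ : SchwartzMap (En n) ℂ) (hΦ : (∫ x, Φ x) ≠ 0) :
    ∃ K : ℝ, 0 < K ∧ ∀ (f : SchwartzMap (En n) ℂ) (ε α : ℝ), 0 < ε → 0 < α →
      ENNReal.ofReal (α ^ p) * volume.withDensity ω {x | ENNReal.ofReal α < radMax n Φ (brMeans n δ ε f) x} ≤
        ENNReal.ofReal K * ∫⁻ x, radMax n Φ f x ^ p ∂(volume.withDensity ω) := by
  set s := ((n:ℝ) + 1) / 2 + δ with hs
  have hsn : (n:ℝ) < s := by rw [hs]; linarith
  obtain ⟨N0, hN0⟩ := exists_nat_gt (n * q / p)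
  set N := N0 + 1 with hN
  have hN1 : 1 ≤ N := by omega
  have hpN : n * q < p * N := by
    rw [div_lt_iff₀ hp0] at hN0
    rw [hN]; push_cast; nlinarith
  obtain ⟨KS, hKS, hS⟩ := AM_strong H Φ hΦ N hN1 p hpN
  obtain ⟨C, hC, hu⟩ := u_lemma H.hn δ hδ Φ hΦ N
  obtain ⟨K, hK, hgood⟩ := H.good hpos hsn hp0 hq
  obtain ⟨Kw, hKw, hweak⟩ := H.weak
  set B := 1 + C * (K + 1) with hB
  have hB0 : 0 < B := by positivity
  set μ := volume.withDensity ω with hμ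
  refine ⟨B ^ p * ((1 + Kw + K) * (C ^ p * KS)), by positivity, fun f ε α hε hα => ?_⟩
  set A : En n → ℝ≥0∞ := fun x => ENNReal.ofReal C * AM Φ N f x with hA
  have hAm : Measurable A := (AM_lsc Φ N f).measurable.const_mul _
  have hAt : ∀ x, A x ≠ ⊤ := fun x => ENNReal.mul_ne_top ENNReal.ofReal_ne_top (AM_ne_top Φ N f x)
  set l := α / B with hl'
  have hl : 0 < l := by positivity
  have hαl : α = B * l := by rw [hl']; field_simp
  obtain ⟨G, hGm, hGint, hGp⟩ := hgood A hAm l hl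
  set I := ∫⁻ x, A x ^ p ∂μ with hI
  have hIle : I ≤ ENNReal.ofReal (C ^ p * KS) * ∫⁻ x, radMax n Φ f x ^ p ∂μ := by
    calc I = ENNReal.ofReal (C ^ p) * ∫⁻ x, AM Φ N f x ^ p ∂μ := by
          rw [hI, ← lintegral_const_mul' _ _ ENNReal.ofReal_ne_top]
          refine lintegral_congr fun x => ?_
          rw [hA]; simp only
          rw [ENNReal.mul_rpow_of_nonneg _ _ hp0.le, ENNReal.ofReal_rpow_of_pos hC]
      _ ≤ ENNReal.ofReal (C ^ p) * (ENNReal.ofReal KS * ∫⁻ x, radMax n Φ f x ^ p ∂μ) := by gcongr; exact hS f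
      _ = _ := by rw [ENNReal.ofReal_mul (by positivity), mul_assoc]
  set E1 : Set (En n) := {x | ENNReal.ofReal l < A x} with hE1
  set E2 : Set (En n) := {x | ∃ R, 0 < R ∧ ENNReal.ofReal (l ^ p) * μ (Metric.closedBall x R) ≤ ∫⁻ y in Metric.closedBall x R, A y ^ p ∂μ} with hE2
  set E3 : Set (En n) := {x | ENNReal.ofReal l ≤ G x} with hE3
  have hlp : ENNReal.ofReal (l ^ p) = ENNReal.ofReal l ^ p := (ENNReal.ofReal_rpow_of_pos hl).symm
  have h1 : ENNReal.ofReal (l ^ p) * μ E1 ≤ I := by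
    refine le_trans ?_ (mul_meas_ge_le_lintegral (hAm.pow_const p) (ENNReal.ofReal (l ^ p)))
    gcongr
    intro x hx
    simp only [mem_setOf_eq, hlp]
    exact ENNReal.rpow_le_rpow (le_of_lt hx) hp0.le
  have h2 : ENNReal.ofReal (l ^ p) * μ E2 ≤ ENNReal.ofReal Kw * I :=
    hweak (fun y => A y ^ p) (hAm.pow_const p) E2 _ fun x hx => hx
  have h3 : ENNReal.ofReal (l ^ p) * μ E3 ≤ ENNReal.ofReal K * I := by
    have := (mul_meas_ge_le_lintegral hGm (ENNReal.ofReal l)).trans hGint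
    calc ENNReal.ofReal (l ^ p) * μ E3 = ENNReal.ofReal (l ^ (p - 1)) * (ENNReal.ofReal l * μ E3) := by
          rw [← mul_assoc, ← ENNReal.ofReal_mul (by positivity)]
          congr 2
          rw [Real.rpow_sub_one hl.ne']; field_simp
      _ ≤ ENNReal.ofReal (l ^ (p - 1)) * (ENNReal.ofReal (K * l ^ (1 - p)) * I) := by gcongr
      _ = _ := by
          rw [← mul_assoc, ← ENNReal.ofReal_mul (by positivity)]
          congr 2
          rw [mul_left_comm, ← Real.rpow_add hl]; simp
  have hsub : {x | ENNReal.ofReal α < radMax n Φ (brMeans n δ ε f) x} ⊆ E1 ∪ E2 ∪ E3 := by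
    intro x hx
    by_contra hc
    simp only [mem_union, not_or] at hc
    obtain ⟨⟨hx1, hx2⟩, hx3⟩ := hc
    simp only [hE1, mem_setOf_eq, not_lt] at hx1
    simp only [hE3, mem_setOf_eq, not_le] at hx3
    have hx2' : ∀ R, 0 < R → ∫⁻ y in Metric.closedBall x R, A y ^ p ∂μ ≤ ENNReal.ofReal (l ^ p) * μ (Metric.closedBall x R) := by
      intro R hR
      by_contra hc
      push Not at hc
      exact hx2 ⟨R, hR, hc.le⟩
    rw [mem_setOf_eq] at hx
    refine absurd hx (not_lt.2 ?_)
    refine iSup₂_le fun t ht => ?_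
    obtain ⟨u, hum, huA, hub⟩ := hu f ε t hε ht
    have hτ : 0 < max t ε := lt_max_of_lt_left ht
    have h4 := hGp x hx1 hx2' u (max t ε) hum hτ (fun y => ne_top_of_le_ne_top (hAt y) (huA y y (by rw [dist_self]; exact hτ.le))) huA
    calc _ ≤ _ := hub x
      _ ≤ ENNReal.ofReal l + ENNReal.ofReal C * (ENNReal.ofReal (K * l) + ENNReal.ofReal l) := by
          refine add_le_add hx1 (mul_le_mul_right (h4.trans ?_) _)
          gcongr
      _ = ENNReal.ofReal α := by
          rw [← ENNReal.ofReal_add (by positivity) hl.le, ← ENNReal.ofReal_mul hC.le, ← ENNReal.ofReal_add hl.le (by positivity)]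
          congr 1
          rw [hαl, hB]; ring
  calc ENNReal.ofReal (α ^ p) * μ {x | ENNReal.ofReal α < radMax n Φ (brMeans n δ ε f) x}
      ≤ ENNReal.ofReal (α ^ p) * (μ E1 + μ E2 + μ E3) := by
        refine mul_le_mul_right ((measure_mono hsub).trans ((measure_union_le _ _).trans ?_)) _
        exact add_le_add (measure_union_le _ _) le_rfl
    _ = ENNReal.ofReal (B ^ p) * (ENNReal.ofReal (l ^ p) * μ E1 + ENNReal.ofReal (l ^ p) * μ E2 + ENNReal.ofReal (l ^ p) * μ E3) := by
        rw [hαl, Real.mul_rpow hB0.le hl.le, ENNReal.ofReal_mul (by positivity)]; ring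
    _ ≤ ENNReal.ofReal (B ^ p) * (I + ENNReal.ofReal Kw * I + ENNReal.ofReal K * I) := by gcongr
    _ = ENNReal.ofReal (B ^ p * (1 + Kw + K)) * I := by
        rw [ENNReal.ofReal_mul (by positivity), ENNReal.ofReal_add (by positivity) hK.le, ENNReal.ofReal_add (by positivity) hKw.le, ENNReal.ofReal_one]; ring
    _ ≤ ENNReal.ofReal (B ^ p * (1 + Kw + K)) * (ENNReal.ofReal (C ^ p * KS) * ∫⁻ x, radMax n Φ f x ^ p ∂μ) := by gcongr
    _ = _ := by
        rw [← mul_assoc, ← ENNReal.ofReal_mul (by positivity)]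
        congr 2; ring

lemma AQ.null_of_not_pos {q C : ℝ} {ω : En n → ℝ≥0∞} (H : AQ n q ω C) (hpos : ¬ ∀ x r, 0 < r → 0 < wm ω x r) :
    volume.withDensity ω = 0 := by
  push Not at hpos
  obtain ⟨x, r, hr, h0⟩ := hpos
  obtain ⟨D, hD, hW⟩ := H.W2
  have h0' : wm ω x r = 0 := le_antisymm h0 (wm_nonneg _ _ _)
  rw [← Measure.measure_univ_eq_zero, ← Metric.iUnion_closedBall_nat x, measure_iUnion_null_iff]
  intro k
  have h1 := hW x x (k + r) r hr (by simp)
  rw [h0', mul_zero] at h1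
  have h2 := H.wm_mono x x (τ := k) (R := k + r) (by simp [hr.le])
  rw [← H.ofReal_wm, ENNReal.ofReal_eq_zero]
  linarith
end

theorem bochnerRiesz_weightedHardy_to_weakWeightedHardy {n : ℕ} (hn : 1 ≤ n) (δ p : ℝ)
    (hδ : ((n : ℝ) - 1) / 2 < δ) (hp0 : 0 < p)
    (hplow : 2 * (n : ℝ) / ((n : ℝ) + 1 + 2 * δ) ≤ p)
    (ω : En n → ℝ≥0∞) (hωmeas : Measurable ω)
    (hωloc : ∀ (x : En n) (r : ℝ), 0 < r → (∫⁻ y in Metric.ball x r, ω y) < ⊤)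
    (hω : IsAp n (p * ((n : ℝ) + 1 + 2 * δ) / (2 * (n : ℝ))) ω)
    (Φ : SchwartzMap (En n) ℂ) (hΦ : (∫ x, Φ x) ≠ 0) :
    ∃ C : ℝ≥0, 0 < C ∧ ∀ (f : SchwartzMap (En n) ℂ) (ε : ℝ), 0 < ε →
      wWLp n ω p (radMax n (⇑Φ) (brMeans n δ ε (⇑f))) ≤
        (C : ℝ≥0∞) * wLp n ω p (radMax n (⇑Φ) (⇑f)) := by
  have hn0 : (0:ℝ) < n := by exact_mod_cast hn
  have hn1 : (1:ℝ) ≤ n := by exact_mod_cast hn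
  have hden : 0 < (n:ℝ) + 1 + 2 * δ := by linarith
  have hq1 : 1 ≤ p * ((n : ℝ) + 1 + 2 * δ) / (2 * (n : ℝ)) := by
    rw [div_le_iff₀ hden] at hplow
    rw [le_div_iff₀ (by positivity)]; linarith
  obtain ⟨Cq, H⟩ := exists_AQ hn ω hωmeas _ hq1 hωloc hω
  by_cases hpos : ∀ x r, 0 < r → 0 < wm ω x r
  · obtain ⟨K, hK, h⟩ := H.weak_main hpos hδ hp0 (by field_simp) Φ hΦ
    refine ⟨Real.toNNReal (K ^ (1/p)), by simpa using Real.rpow_pos_of_pos hK _, fun f ε hε => ?_⟩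
    have hI : wLp n ω p (radMax n Φ f) = (∫⁻ x, radMax n Φ f x ^ p ∂(volume.withDensity ω)) ^ (1/p) := by
      have hm : Measurable (fun x => radMax n Φ f x ^ p) := (radMax_lsc Φ f).measurable.pow_const p
      rw [wLp, lintegral_withDensity_eq_lintegral_mul _ hωmeas hm]
      congr 1
      refine lintegral_congr fun x => ?_
      simp only [Pi.mul_apply]; rw [mul_comm]
    rw [hI, wWLp]
    refine iSup₂_le fun α hα => ?_
    have h1 := h f ε α hε hα
    have h2 := ENNReal.rpow_le_rpow h1 (by positivity : 0 ≤ 1/p)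
    rw [ENNReal.mul_rpow_of_nonneg _ _ (by positivity), ENNReal.mul_rpow_of_nonneg _ _ (by positivity), ENNReal.ofReal_rpow_of_pos hK,
      ENNReal.ofReal_rpow_of_pos (by positivity), ← Real.rpow_mul (by positivity), mul_one_div_cancel hp0.ne', Real.rpow_one, ENNReal.ofReal_coe_nnreal, withDensity_apply'] at h2
    exact h2
  · have h0 := H.null_of_not_pos hpos
    refine ⟨1, one_pos, fun f ε hε => ?_⟩
    rw [wWLp]
    refine iSup₂_le fun α hα => ?_
    rw [← withDensity_apply', h0]
    simp [ENNReal.zero_rpow_of_pos, hp0]
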